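/- arXiv:2503.19610 — 2 statements merged into one kernel-verified Lean document; each statement's English description precedes it below -/
import Mathlib

section
/- Let E, F ⊆ ℝⁿ be sets of finite perimeter. Then, up to a set of ℋⁿ⁻¹-measure zero, the intersection of their reduced boundaries equals the union of the set where their measure-theoretic unit normals agree and the set where they are opposite: ∂*E ∩ ∂*F ≃ {ν_E = ν_F} ∪ {ν_E = -ν_F}. -/
open MeasureTheory Metric Filter Set
open scoped Topology ENNReal NNReal

noncomputable section
open scoped Classical

/-- Gauss–Green data for a set `E ⊆ ℝⁿ`: a finite total-variation measure
`mu = |Dχ_E|` together with a `mu`-a.e. unit vector field `nu` (the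
measure-theoretic outer normal), satisfying the integration-by-parts formula
`∫_E ∂ᵢφ dx = ∫ φ νᵢ dmu` for all smooth compactly supported `φ`. A set has
finite perimeter iff such data exist. -/
structure GaussGreenData (n : ℕ) (E : Set (EuclideanSpace ℝ (Fin n))) where
  mu : Measure (EuclideanSpace ℝ (Fin n))
  nu : EuclideanSpace ℝ (Fin n) → EuclideanSpace ℝ (Fin n)
  finite : IsFiniteMeasure mu
  nu_unit : ∀ᵐ x ∂mu, ‖nu x‖ = 1
  parts : ∀ φ : EuclideanSpace ℝ (Fin n) → ℝ, ContDiff ℝ (⊤ : ℕ∞) φ → HasCompactSupport φ →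
    ∀ i : Fin n, ∫ x in E, fderiv ℝ φ x (EuclideanSpace.single i 1) ∂volume
      = ∫ x, φ x * nu x i ∂mu

variable {n : ℕ} {E : Set (EuclideanSpace ℝ (Fin n))}

/-- `v` is the measure-theoretic unit normal of `E` at `x` (with respect to the
Gauss–Green data `D`): all balls around `x` have positive `|Dχ_E|`-measure and
the normalized averages `∫_{B(x,r)} ν d|Dχ_E| / |Dχ_E|(B(x,r))` converge to the
unit vector `v` as `r → 0⁺`. -/
def IsUnitNormalAt (D : GaussGreenData n E) (x v : EuclideanSpace ℝ (Fin n)) : Prop :=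
  (∀ r > (0 : ℝ), 0 < D.mu (ball x r)) ∧ ‖v‖ = 1 ∧
    Tendsto (fun r : ℝ => ((D.mu (ball x r)).toReal)⁻¹ • ∫ y in ball x r, D.nu y ∂D.mu)
      (𝓝[>] 0) (𝓝 v)

/-- The reduced boundary `∂*E`. -/
def reducedBoundary (D : GaussGreenData n E) : Set (EuclideanSpace ℝ (Fin n)) :=
  {x | ∃ v, IsUnitNormalAt D x v}

/-- The measure-theoretic unit normal `ν_E`, defined on the reduced boundary. -/
def mtNormal (D : GaussGreenData n E) (x : EuclideanSpace ℝ (Fin n)) :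
    EuclideanSpace ℝ (Fin n) :=
  if h : ∃ v, IsUnitNormalAt D x v then h.choose else 0

abbrev EV (n : ℕ) := EuclideanSpace ℝ (Fin n)

structure LD {n : ℕ} (U E : Set (EV n)) (μ : Measure (EV n)) (ν : EV n → EV n) : Prop where
  isOpen : IsOpen U
  fin : IsFiniteMeasure μ
  meas : AEStronglyMeasurable ν μ
  unit : ∀ᵐ x ∂μ, ‖ν x‖ = 1
  parts : ∀ φ : EV n → ℝ, ContDiff ℝ (⊤ : ℕ∞) φ → HasCompactSupport φ → tsupport φ ⊆ U →
    ∀ w : EV n, ∫ x in E, fderiv ℝ φ x w = ∫ x, φ x * inner ℝ (ν x) w ∂μ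

structure Pt {n : ℕ} (μ : Measure (EV n)) (ν : EV n → EV n) (x v : EV n) : Prop where
  norm_v : ‖v‖ = 1
  pos : ∀ r > 0, 0 < μ (ball x r)
  exc : ∀ ε > 0, ∀ᶠ r in 𝓝[>] (0:ℝ),
    ∫ y in ball x r, (1 - inner ℝ (ν y) v) ∂μ ≤ ε * μ.real (ball x r)

lemma smoothTransition_lip : ∃ K : ℝ≥0, 0 < K ∧ LipschitzWith K Real.smoothTransition := by
  have hc : Continuous (deriv Real.smoothTransition) :=
    (Real.smoothTransition.contDiff (n := 1)).continuous_deriv le_rfl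
  obtain ⟨M, hM⟩ := (isCompact_Icc (a := (0:ℝ)) (b := 1)).exists_bound_of_continuousOn hc.continuousOn
  have hM0 : 0 ≤ M := (norm_nonneg _).trans (hM 0 (by simp))
  refine ⟨Real.toNNReal (M + 1), ?_, ?_⟩
  · rw [Real.toNNReal_pos]; positivity
  apply lipschitzWith_of_nnnorm_deriv_le
    ((Real.smoothTransition.contDiff (n := 1)).differentiable one_ne_zero)
  intro x
  rw [← NNReal.coe_le_coe, coe_nnnorm, Real.coe_toNNReal _ (by positivity)]
  by_cases hx : x ∈ Icc (0:ℝ) 1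
  · linarith [hM x hx]
  · have : deriv Real.smoothTransition x = 0 := by
      rw [mem_Icc, not_and_or, not_le, not_le] at hx
      rcases hx with hx | hx
      · have : Real.smoothTransition =ᶠ[𝓝 x] fun _ => 0 := by
          filter_upwards [Iio_mem_nhds hx] with y hy
          exact Real.smoothTransition.zero_of_nonpos (le_of_lt hy)
        rw [this.deriv_eq]; simp
      · have : Real.smoothTransition =ᶠ[𝓝 x] fun _ => 1 := by
          filter_upwards [Ioi_mem_nhds hx] with y hy
          exact Real.smoothTransition.one_of_one_le (le_of_lt hy)
        rw [this.deriv_eq]; simp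
    rw [this]; simp; positivity

lemma exists_cutoff : ∃ A : ℝ, 0 < A ∧ ∀ (n : ℕ) (x : EV n) (ρ R : ℝ), 0 < ρ → ρ < R →
    ∃ φ : EV n → ℝ, ContDiff ℝ (⊤ : ℕ∞) φ ∧ HasCompactSupport φ ∧ (∀ y, 0 ≤ φ y) ∧
      (∀ y, φ y ≤ 1) ∧ (∀ y ∈ ball x ρ, φ y = 1) ∧ tsupport φ ⊆ ball x R ∧
      ∀ y, ‖fderiv ℝ φ y‖ ≤ A / (R - ρ) := by
  obtain ⟨K, hK, hKl⟩ := smoothTransition_lip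
  refine ⟨2 * K, by positivity, fun n x ρ R hρ hR => ?_⟩
  set R' := (ρ + R) / 2 with hR'
  have hs : 0 < R' - ρ := by rw [hR']; linarith
  set φ : EV n → ℝ := fun y => Real.smoothTransition ((R' - ρ)⁻¹ * (R' - ‖y - x‖)) with hφ
  have hsupp : Function.support φ ⊆ closedBall x R' := by
    intro y hy
    by_contra h
    apply hy
    apply Real.smoothTransition.zero_of_nonpos
    rw [mem_closedBall, dist_eq_norm, not_le] at h
    have : 0 < (R' - ρ)⁻¹ := by positivity
    nlinarith
  have hts : tsupport φ ⊆ closedBall x R' := closure_minimal hsupp isClosed_closedBall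
  have h1 : ∀ y ∈ ball x ρ, φ y = 1 := by
    intro y hy
    apply Real.smoothTransition.one_of_one_le
    rw [mem_ball, dist_eq_norm] at hy
    rw [inv_mul_eq_div, le_div_iff₀ hs]; linarith
  refine ⟨φ, ?_, ?_, fun y => Real.smoothTransition.nonneg _,
    fun y => Real.smoothTransition.le_one _, h1, hts.trans (closedBall_subset_ball (by rw [hR']; linarith)), ?_⟩
  · rw [contDiff_iff_contDiffAt]
    intro y
    by_cases hy : y = x
    · have : φ =ᶠ[𝓝 y] fun _ => 1 := by
        filter_upwards [isOpen_ball.mem_nhds (by rw [hy]; exact mem_ball_self hρ : y ∈ ball x ρ)] with z hz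
        exact h1 z hz
      exact contDiffAt_const.congr_of_eventuallyEq this
    · apply Real.smoothTransition.contDiffAt.comp
      apply contDiffAt_const.mul
      apply contDiffAt_const.sub
      exact (contDiffAt_id.sub contDiffAt_const).norm ℝ (sub_ne_zero.2 hy)
  · exact HasCompactSupport.of_support_subset_isCompact (isCompact_closedBall x R') hsupp
  · intro y
    have hl : LipschitzWith (K * Real.toNNReal (R' - ρ)⁻¹) φ := by
      apply hKl.comp
      apply LipschitzWith.of_dist_le_mul
      intro a b
      rw [Real.coe_toNNReal _ (by positivity)]
      rw [Real.dist_eq, ← mul_sub, abs_mul, abs_of_pos (by positivity : 0 < (R' - ρ)⁻¹)]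
      gcongr
      have : R' - ‖a - x‖ - (R' - ‖b - x‖) = ‖b - x‖ - ‖a - x‖ := by ring
      rw [this]
      refine (abs_norm_sub_norm_le _ _).trans ?_
      rw [dist_comm, dist_eq_norm]; simp
    have := norm_fderiv_le_of_lipschitz ℝ hl (x₀ := y)
    refine this.trans (le_of_eq ?_)
    rw [NNReal.coe_mul, Real.coe_toNNReal _ (by positivity)]
    have e : R' - ρ = (R - ρ) / 2 := by rw [hR']; ring
    rw [e]
    have : R - ρ ≠ 0 := by linarith
    field_simp

def cutA : ℝ := exists_cutoff.choose
lemma cutA_pos : 0 < cutA := exists_cutoff.choose_spec.1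
lemma cutoff {n : ℕ} (x : EV n) {ρ R : ℝ} (hρ : 0 < ρ) (hR : ρ < R) :
    ∃ φ : EV n → ℝ, ContDiff ℝ (⊤ : ℕ∞) φ ∧ HasCompactSupport φ ∧ (∀ y, 0 ≤ φ y) ∧
      (∀ y, φ y ≤ 1) ∧ (∀ y ∈ ball x ρ, φ y = 1) ∧ tsupport φ ⊆ ball x R ∧
      ∀ y, ‖fderiv ℝ φ y‖ ≤ cutA / (R - ρ) :=
  exists_cutoff.choose_spec.2 n x ρ R hρ hR

section
variable {n : ℕ} {U E : Set (EV n)} {μ : Measure (EV n)} {ν : EV n → EV n}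

lemma LD.abs_inner_le (h : LD U E μ ν) (w : EV n) : ∀ᵐ y ∂μ, |inner ℝ (ν y) w| ≤ ‖w‖ := by
  filter_upwards [h.unit] with y hy
  have := abs_real_inner_le_norm (ν y) w
  rwa [hy, one_mul] at this

lemma LD.integrable_inner (h : LD U E μ ν) (w : EV n) : Integrable (fun y => inner ℝ (ν y) w) μ := by
  have := h.fin
  refine Integrable.of_bound (h.meas.inner aestronglyMeasurable_const) ‖w‖ ?_
  filter_upwards [h.abs_inner_le w] with y hy
  simpa using hy

lemma LD.integrable_exc (h : LD U E μ ν) (w : EV n) :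
    Integrable (fun y => 1 - inner ℝ (ν y) w) μ := by
  have := h.fin
  exact (integrable_const 1).sub (h.integrable_inner w)

lemma LD.exc_nonneg (h : LD U E μ ν) {v : EV n} (hv : ‖v‖ = 1) :
    ∀ᵐ y ∂μ, 0 ≤ 1 - inner ℝ (ν y) v := by
  filter_upwards [h.abs_inner_le v] with y hy
  rw [hv] at hy
  linarith [le_abs_self (inner ℝ (ν y) v)]

lemma integrable_smooth_mul {φ f : EV n → ℝ} (hφ : Continuous φ) (hc : HasCompactSupport φ)
    (hf : Integrable f μ) : Integrable (fun y => φ y * f y) μ := by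
  obtain ⟨C, hC⟩ := hφ.bounded_above_of_compact_support hc
  exact hf.bdd_mul (c := C) hφ.aestronglyMeasurable (Eventually.of_forall hC)

lemma LD.caccioppoli (h : LD U E μ ν) {x v : EV n} (hv : ‖v‖ = 1) {ρ R : ℝ} (hρ : 0 < ρ)
    (hR : ρ < R) (hU : ball x R ⊆ U) :
    μ.real (ball x ρ) ≤ ∫ y in ball x R, (1 - inner ℝ (ν y) v) ∂μ
      + cutA / (R - ρ) * volume.real (E ∩ ball x R) := by
  have := h.fin
  obtain ⟨φ, hφ, hc, h0, h1, hone, hts, hd⟩ := cutoff x hρ hR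
  have hi1 : Integrable (fun y => φ y * (1 - inner ℝ (ν y) v)) μ :=
    integrable_smooth_mul hφ.continuous hc (h.integrable_exc v)
  have hi2 : Integrable (fun y => φ y * inner ℝ (ν y) v) μ :=
    integrable_smooth_mul hφ.continuous hc (h.integrable_inner v)
  have e1 : ∫ y, φ y ∂μ = ∫ y, φ y * (1 - inner ℝ (ν y) v) ∂μ + ∫ y, φ y * inner ℝ (ν y) v ∂μ := by
    rw [← integral_add hi1 hi2]
    congr 1; ext y; ring
  have e2 : μ.real (ball x ρ) ≤ ∫ y, φ y ∂μ := by
    rw [← integral_indicator_one measurableSet_ball]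
    apply integral_mono_ae
    · exact (integrable_const (1:ℝ)).indicator measurableSet_ball
    · exact hφ.continuous.integrable_of_hasCompactSupport hc
    · refine Eventually.of_forall fun y => ?_
      by_cases hy : y ∈ ball x ρ
      · simp only [indicator_of_mem hy, hone y hy, Pi.one_apply, le_refl]
      · simp only [indicator_of_notMem hy, h0 y]
  have e3 : ∫ y, φ y * (1 - inner ℝ (ν y) v) ∂μ ≤ ∫ y in ball x R, (1 - inner ℝ (ν y) v) ∂μ := by
    rw [← integral_indicator measurableSet_ball]
    apply integral_mono_ae hi1 ((h.integrable_exc v).indicator measurableSet_ball)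
    filter_upwards [h.exc_nonneg hv] with y hy
    by_cases hyR : y ∈ ball x R
    · simp only [indicator_of_mem hyR]
      nlinarith [h1 y, h0 y]
    · simp only [indicator_of_notMem hyR]
      rw [image_eq_zero_of_notMem_tsupport (fun hh => hyR (hts hh))]; simp
  have e4 : ∫ y, φ y * inner ℝ (ν y) v ∂μ ≤ cutA / (R - ρ) * volume.real (E ∩ ball x R) := by
    rw [← h.parts φ hφ hc (hts.trans hU) v]
    have hsub : ∫ y in E, fderiv ℝ φ y v = ∫ y in E ∩ ball x R, fderiv ℝ φ y v := by
      rw [inter_comm]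
      rw [← Measure.restrict_restrict measurableSet_ball]
      symm
      apply setIntegral_eq_integral_of_forall_compl_eq_zero
      intro y hy
      have : y ∉ tsupport (fderiv ℝ φ) := fun hh => hy (hts (tsupport_fderiv_subset ℝ hh))
      rw [image_eq_zero_of_notMem_tsupport this]; simp
    rw [hsub]
    refine (le_abs_self _).trans ?_
    rw [← Real.norm_eq_abs]
    apply norm_setIntegral_le_of_norm_le_const
    · exact (measure_mono inter_subset_right).trans_lt measure_ball_lt_top
    · intro y _
      have := (fderiv ℝ φ y).le_opNorm v
      rw [hv, mul_one] at this
      exact this.trans (hd y)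
  linarith

lemma ball_vol (x : EV n) {r : ℝ} (hr : 0 < r) :
    volume.real (ball x r) = r ^ n * volume.real (ball (0 : EV n) 1) := by
  rw [Measure.real, Measure.addHaar_ball_of_pos volume x hr, ENNReal.toReal_mul, finrank_euclideanSpace_fin,
    ENNReal.toReal_ofReal (by positivity)]
  rfl

lemma LD.upper (h : LD U E μ ν) {x v : EV n} (hx : x ∈ U) (hp : Pt μ ν x v) (hn : 1 ≤ n) :
    ∃ C : ℝ, 0 < C ∧ ∀ᶠ r in 𝓝[>] (0:ℝ), μ.real (ball x r) ≤ C * r ^ (n - 1) := by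
  have := h.fin
  obtain ⟨R0, hR0, hU⟩ := Metric.isOpen_iff.1 h.isOpen x hx
  have hex := hp.exc ((2 ^ n)⁻¹) (by positivity)
  obtain ⟨R1, hR1, hex⟩ := (mem_nhdsGT_iff_exists_Ioo_subset).1 hex
  simp only [mem_Ioi] at hR1
  obtain ⟨r0, hr0, hr0'⟩ := exists_between (lt_min hR0 hR1)
  set B := volume.real (ball (0 : EV n) 1)
  have key : ∀ r, 0 < r → r ≤ r0 → μ.real (ball x (r/2)) ≤ (2^n)⁻¹ * μ.real (ball x r)
      + (2 * cutA * B) * r ^ (n-1) := by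
    intro r hr hrr
    have h1 := h.caccioppoli hp.norm_v (half_pos hr) (half_lt_self hr)
      ((ball_subset_ball (hrr.trans (hr0'.le.trans (min_le_left _ _)))).trans hU)
    have h2 := hex ⟨hr, hrr.trans_lt (hr0'.trans_le (min_le_right _ _))⟩
    simp only [mem_ofPred_eq] at h2
    have h3 : volume.real (E ∩ ball x r) ≤ r ^ n * B := by
      rw [← ball_vol x hr]
      exact measureReal_mono inter_subset_right measure_ball_lt_top.ne
    have h4 : cutA / (r - r/2) * volume.real (E ∩ ball x r) ≤ (2 * cutA * B) * r ^ (n-1) := by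
      have := cutA_pos
      have hrn : r ^ n = r ^ (n-1) * r := by rw [← pow_succ]; congr 1; omega
      calc _ ≤ cutA / (r - r/2) * (r ^ n * B) := by
            have : 0 ≤ cutA / (r - r/2) := div_nonneg this.le (by linarith)
            gcongr
        _ = _ := by
          rw [hrn]
          have : r - r/2 = r/2 := by ring
          rw [this]
          field_simp
    linarith
  set C := max (μ.real univ / (r0/2) ^ (n-1)) (2 * (2 * cutA * B) * 2 ^ n) + 1
  have hC1 : μ.real univ / (r0/2) ^ (n-1) ≤ C := by
    have := le_max_left (μ.real univ / (r0/2) ^ (n-1)) (2 * (2 * cutA * B) * 2 ^ n)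
    simp only [C]; linarith
  have hC2 : 2 * (2 * cutA * B) * 2 ^ n ≤ C := by
    have := le_max_right (μ.real univ / (r0/2) ^ (n-1)) (2 * (2 * cutA * B) * 2 ^ n)
    simp only [C]; linarith
  have hCp : 0 < C := by
    have : 0 ≤ max (μ.real univ / (r0/2) ^ (n-1)) (2 * (2 * cutA * B) * 2 ^ n) :=
      le_max_of_le_left (by positivity)
    simp only [C]; linarith
  have claim : ∀ k : ℕ, ∀ r, r0 / 2 ^ (k+1) < r → r ≤ r0 → μ.real (ball x r) ≤ C * r ^ (n-1) := by
    intro k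
    induction k with
    | zero =>
      intro r hr _
      simp only [zero_add, pow_one] at hr
      calc μ.real (ball x r) ≤ μ.real univ := measureReal_mono (subset_univ _)
        _ = μ.real univ / (r0/2) ^ (n-1) * (r0/2)^(n-1) := by field_simp
        _ ≤ C * r ^ (n-1) := by gcongr
    | succ k ih =>
      intro r hr hrr
      by_cases hc : r0 / 2 ^ (k+1) < r
      · exact ih r hc hrr
      have hrp : 0 < r := lt_trans (by positivity) hr
      have h2r : r0 / 2 ^ (k+1) < 2 * r := by
        rw [pow_succ, ← div_div] at hr; linarith
      have h2r' : 2 * r ≤ r0 := by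
        have : r0 / 2 ^ (k+1) ≤ r0 / 2 := by
          apply div_le_div_of_nonneg_left hr0.le (by norm_num)
          exact le_self_pow₀ (by norm_num) (by omega)
        linarith
      have i1 := ih (2 * r) h2r h2r'
      have i2 := key (2 * r) (by positivity) h2r'
      rw [mul_div_cancel_left₀ r (by norm_num : (2:ℝ) ≠ 0)] at i2
      have hpn : (2:ℝ) ^ n = 2 ^ (n-1) * 2 := by rw [← pow_succ]; congr 1; omega
      rw [mul_pow] at i1 i2
      have e1 : (2^n)⁻¹ * μ.real (ball x (2*r)) ≤ C / 2 * r ^ (n-1) := by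
        calc _ ≤ (2^n)⁻¹ * (C * (2 ^ (n-1) * r ^ (n-1))) := by gcongr
          _ = _ := by rw [hpn]; field_simp
      have e2 : 2 * cutA * B * (2 ^ (n-1) * r ^ (n-1)) ≤ C / 2 * r ^ (n-1) := by
        have : 2 * cutA * B * 2 ^ (n-1) ≤ C / 2 := by
          have hA := cutA_pos
          have hB : 0 ≤ B := measureReal_nonneg
          have : 0 ≤ 2 * cutA * B * 2 ^ (n-1) := by positivity
          rw [hpn] at hC2
          linarith
        calc _ = 2 * cutA * B * 2 ^ (n-1) * r ^ (n-1) := by ring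
          _ ≤ _ := by gcongr
      linarith
  refine ⟨C, hCp, ?_⟩
  filter_upwards [Ioo_mem_nhdsGT hr0] with r hr
  obtain ⟨k, hk⟩ := pow_unbounded_of_one_lt (r0 / r) (one_lt_two)
  apply claim k r _ hr.2.le
  rw [div_lt_iff₀ (by positivity)]
  rw [div_lt_iff₀ hr.1] at hk
  rw [pow_succ]
  nlinarith [hr.1, pow_pos (zero_lt_two' ℝ) k, mul_pos hr.1 (pow_pos (zero_lt_two' ℝ) k)]

end

section
variable {n : ℕ} {U E : Set (EV n)} {μ : Measure (EV n)} {ν : EV n → EV n}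

lemma LD.moll (h : LD U E μ ν) (hE : MeasurableSet E) {x : EV n} {ρ R : ℝ}
    (hR : ρ < R) (hU : ball x R ⊆ U) :
    ∃ u : ℕ → EV n → ℝ, (∀ k, ContDiff ℝ 1 (u k)) ∧ (∀ k y, 0 ≤ u k y) ∧ (∀ k y, u k y ≤ 1) ∧
      (∀ᵐ y, Tendsto (fun k => u k y) atTop (𝓝 (E.indicator (fun _ => (1:ℝ)) y))) ∧
      ∀ k, ∫⁻ y in ball x ρ, ‖fderiv ℝ (u k) y‖ₑ ≤ μ (ball x R) := by
  have := h.fin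
  set s := R - ρ with hs
  have hs0 : 0 < s := by rw [hs]; linarith
  let b : ℕ → ContDiffBump (0 : EV n) := fun k =>
    ⟨s / (k + 1) / 2, s / (k + 1), by positivity, half_lt_self (by positivity)⟩
  have hbs : ∀ k, (b k).rOut ≤ s := fun k => by
    change s / (k + 1) ≤ s
    exact div_le_self hs0.le (by simp)
  set g : EV n → ℝ := E.indicator (fun _ => (1:ℝ)) with hg
  have hgm : Measurable g := measurable_const.indicator hE
  have hg0 : ∀ y, 0 ≤ g y := fun y => indicator_nonneg (fun _ _ => zero_le_one) y
  have hg1 : ∀ y, g y ≤ 1 := fun y => indicator_le_self' (fun _ _ => zero_le_one) y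
  have hgl : LocallyIntegrable g volume :=
    (locallyIntegrable_const (1:ℝ)).mono hgm.aestronglyMeasurable (Eventually.of_forall fun y => by
      rw [Real.norm_of_nonneg (hg0 y)]; simpa using hg1 y)
  let f : ℕ → EV n → ℝ := fun k => (b k).normed volume
  have hf : ∀ k, ContDiff ℝ (⊤ : ℕ∞) (f k) := fun k => (b k).contDiff_normed
  have hfc : ∀ k, HasCompactSupport (f k) := fun k => (b k).hasCompactSupport_normed
  have hf0 : ∀ k y, 0 ≤ f k y := fun k y => (b k).nonneg_normed y
  have hfi : ∀ k, Integrable (f k) volume := fun k => (b k).integrable_normed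
  refine ⟨fun k => convolution (f k) g (ContinuousLinearMap.lsmul ℝ ℝ) volume, ?_, ?_, ?_, ?_, ?_⟩
  · intro k
    exact (hfc k).contDiff_convolution_left _ ((hf k).of_le (by exact_mod_cast le_top)) hgl
  · intro k y
    simp only [convolution_def]
    apply integral_nonneg
    intro t
    simp only [ContinuousLinearMap.lsmul_apply, smul_eq_mul]
    exact mul_nonneg (hf0 k t) (hg0 _)
  · intro k y
    simp only [convolution_def]
    rw [← (b k).integral_normed (μ := volume)]
    apply integral_mono_of_nonneg
    · refine Eventually.of_forall fun t => ?_
      simp only [ContinuousLinearMap.lsmul_apply, smul_eq_mul, Pi.zero_apply]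
      exact mul_nonneg (hf0 k t) (hg0 _)
    · exact hfi k
    · refine Eventually.of_forall fun t => ?_
      simp only [ContinuousLinearMap.lsmul_apply, smul_eq_mul]
      exact mul_le_of_le_one_right (hf0 k t) (hg1 _)
  · apply ContDiffBump.ae_convolution_tendsto_right_of_locallyIntegrable (K := 2) _ _ hgl
    · have : Tendsto (fun k : ℕ => s * (1 / ((k:ℝ) + 1))) atTop (𝓝 (s * 0)) :=
        tendsto_one_div_add_atTop_nhds_zero_nat.const_mul s
      rw [mul_zero] at this
      refine this.congr fun k => ?_
      change _ = s / (k + 1)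
      ring
    · refine Eventually.of_forall fun k => ?_
      change s / (k + 1) ≤ 2 * (s / (k + 1) / 2)
      linarith
  · intro k
    have hpt : ∀ z ∈ ball x ρ, ‖fderiv ℝ (convolution (f k) g (ContinuousLinearMap.lsmul ℝ ℝ) volume) z‖ₑ
        ≤ ∫⁻ t, ENNReal.ofReal (f k (z - t)) ∂μ := by
      intro z hz
      set φ : EV n → ℝ := fun t => f k (z - t) with hφ
      have hφd : ContDiff ℝ (⊤ : ℕ∞) φ := (hf k).comp (contDiff_const.sub contDiff_id)
      have hsupp : Function.support φ ⊆ closedBall z (b k).rOut := by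
        intro t ht
        have : z - t ∈ Function.support (f k) := ht
        rw [(b k).support_normed_eq] at this
        rw [mem_ball_zero_iff] at this
        rw [mem_closedBall, dist_comm, dist_eq_norm]; exact this.le
      have hφc : HasCompactSupport φ :=
        HasCompactSupport.of_support_subset_isCompact (isCompact_closedBall _ _) hsupp
      have hts : tsupport φ ⊆ U := by
        refine (closure_minimal hsupp isClosed_closedBall).trans (Subset.trans ?_ hU)
        intro t ht
        rw [mem_ball] at hz ⊢
        rw [mem_closedBall] at ht
        have := dist_triangle t z x
        have := hbs k
        linarith
      have hφi : Integrable φ μ := hφd.continuous.integrable_of_hasCompactSupport hφc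
      have hderiv := (hfc k).hasFDerivAt_convolution_left (ContinuousLinearMap.lsmul ℝ ℝ)
        ((hf k).of_le (by exact_mod_cast le_top)) hgl z
      rw [hderiv.fderiv]
      have hn : ‖convolution (fderiv ℝ (f k)) g
          (ContinuousLinearMap.precompL (EV n) (ContinuousLinearMap.lsmul ℝ ℝ)) volume z‖
          ≤ ∫ t, φ t ∂μ := by
        apply ContinuousLinearMap.opNorm_le_bound _ (integral_nonneg fun t => hf0 k _)
        intro w
        have e1 : (convolution (fderiv ℝ (f k)) g
          (ContinuousLinearMap.precompL (EV n) (ContinuousLinearMap.lsmul ℝ ℝ)) volume z) w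
            = - ∫ t in E, fderiv ℝ φ t w := by
          have hex := ((hfc k).fderiv ℝ).convolutionExists_left
            (ContinuousLinearMap.precompL (EV n) (ContinuousLinearMap.lsmul ℝ ℝ))
            ((hf k).continuous_fderiv (by simp)) hgl z
          rw [convolution_eq_swap, ContinuousLinearMap.integral_apply hex.integrable_swap,
            ← integral_neg, ← integral_indicator hE]
          congr 1
          ext t
          have : fderiv ℝ φ t w = - fderiv ℝ (f k) (z - t) w := by
            have h1 : HasFDerivAt φ ((fderiv ℝ (f k) (z - t)).comp (-(ContinuousLinearMap.id ℝ (EV n)))) t := by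
              exact HasFDerivAt.comp (g := f k) (f := fun t => z - t) t
                ((hf k).differentiable (by simp) _).hasFDerivAt ((hasFDerivAt_id t).const_sub z)
            rw [h1.fderiv]; simp
          by_cases ht : t ∈ E
          · simp [hg, ht, this]
          · simp [hg, ht]
        rw [e1, h.parts φ hφd hφc hts w, norm_neg, ← integral_mul_const]
        apply norm_integral_le_of_norm_le (hφi.mul_const _)
        filter_upwards [h.abs_inner_le w] with t ht
        rw [norm_mul, Real.norm_of_nonneg (hf0 k _), Real.norm_eq_abs]
        exact mul_le_mul_of_nonneg_left ht (hf0 k _)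
      rw [← ofReal_norm, ← ofReal_integral_eq_lintegral_ofReal hφi
        (Eventually.of_forall fun t => hf0 k _)]
      exact ENNReal.ofReal_le_ofReal hn
    calc ∫⁻ z in ball x ρ, ‖fderiv ℝ (convolution (f k) g (ContinuousLinearMap.lsmul ℝ ℝ) volume) z‖ₑ
        ≤ ∫⁻ z in ball x ρ, ∫⁻ t, ENNReal.ofReal (f k (z - t)) ∂μ :=
          setLIntegral_mono' measurableSet_ball hpt
      _ = ∫⁻ t, ∫⁻ z in ball x ρ, ENNReal.ofReal (f k (z - t)) ∂volume ∂μ := by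
          apply lintegral_lintegral_swap
          apply Measurable.aemeasurable
          have := (hf k).continuous
          apply Continuous.measurable
          exact ENNReal.continuous_ofReal.comp (this.comp (continuous_fst.sub continuous_snd))
      _ ≤ ∫⁻ t, (ball x R).indicator 1 t ∂μ := by
          apply lintegral_mono
          intro t
          by_cases ht : t ∈ ball x R
          · simp only [indicator_of_mem ht, Pi.one_apply]
            refine (setLIntegral_le_lintegral _ _).trans ?_
            rw [lintegral_sub_right_eq_self (fun z => ENNReal.ofReal (f k z)) t,
              ← ofReal_integral_eq_lintegral_ofReal (hfi k) (Eventually.of_forall fun t => hf0 k _),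
              (b k).integral_normed]
            simp
          · simp only [indicator_of_notMem ht]
            rw [nonpos_iff_eq_zero]
            apply setLIntegral_eq_zero measurableSet_ball
            intro z hz
            have : f k (z - t) = 0 := by
              by_contra hne
              have hm : z - t ∈ Function.support (f k) := hne
              rw [(b k).support_normed_eq, mem_ball_zero_iff, ← dist_eq_norm] at hm
              apply ht
              rw [mem_ball] at hz ⊢
              have := dist_triangle t z x
              have := hbs k
              rw [dist_comm] at hm
              linarith
            simp [this]
      _ = μ (ball x R) := by
          rw [lintegral_indicator_one measurableSet_ball]
end

section
variable {n : ℕ} {U E : Set (EV n)} {μ : Measure (EV n)} {ν : EV n → EV n}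

lemma ftc_enorm {u : EV n → ℝ} (hu : ContDiff ℝ 1 u) (y h : EV n) :
    ‖u (y + h) - u y‖ₑ ≤ ∫⁻ t in Icc (0:ℝ) 1, ‖fderiv ℝ u (y + t • h)‖ₑ * ‖h‖ₑ := by
  have hd : ∀ t ∈ uIcc (0:ℝ) 1, HasDerivAt (fun t : ℝ => u (y + t • h)) (fderiv ℝ u (y + t • h) h) t := by
    intro t _
    have h1 : HasDerivAt (fun t : ℝ => y + t • h) h t := by
      simpa using ((hasDerivAt_id t).smul_const h).const_add y
    exact ((hu.differentiable one_ne_zero _).hasFDerivAt).comp_hasDerivAt t h1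
  have hcont : Continuous fun t : ℝ => fderiv ℝ u (y + t • h) h := by
    have := hu.continuous_fderiv one_ne_zero
    fun_prop
  have := intervalIntegral.integral_eq_sub_of_hasDerivAt hd (hcont.intervalIntegrable 0 1)
  simp only [one_smul, zero_smul, add_zero] at this
  rw [← this, intervalIntegral.integral_of_le zero_le_one]
  refine (enorm_integral_le_lintegral_enorm _).trans ?_
  refine (lintegral_mono fun t => ?_).trans (lintegral_mono_set Ioc_subset_Icc_self)
  exact ContinuousLinearMap.le_opENorm _ _

lemma poincare_smooth {u : EV n → ℝ} (hu : ContDiff ℝ 1 u) (x : EV n) (ρ : ℝ) :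
    ∫⁻ y in ball x ρ, ∫⁻ z in ball x ρ, ‖u z - u y‖ₑ ≤
      volume (ball (0 : EV n) (2 * ρ)) * ENNReal.ofReal (2 * ρ) * ∫⁻ y in ball x ρ, ‖fderiv ℝ u y‖ₑ := by
  set g : EV n → ℝ≥0∞ := (ball x ρ).indicator (fun y => ‖fderiv ℝ u y‖ₑ) with hg
  have hgm : Measurable g :=
    ((hu.continuous_fderiv one_ne_zero).enorm.measurable).indicator measurableSet_ball
  set k : EV n → ℝ≥0∞ := (ball (0 : EV n) (2 * ρ)).indicator (fun _ => ENNReal.ofReal (2 * ρ)) with hk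
  have hkm : Measurable k := measurable_const.indicator measurableSet_ball
  have hpt : ∀ y ∈ ball x ρ, ∫⁻ z in ball x ρ, ‖u z - u y‖ₑ ≤
      ∫⁻ h, ∫⁻ t in Icc (0:ℝ) 1, g (y + t • h) * k h := by
    intro y hy
    rw [← lintegral_indicator measurableSet_ball,
      ← lintegral_add_left_eq_self _ y]
    apply lintegral_mono
    intro h
    by_cases hh : y + h ∈ ball x ρ
    · simp only [indicator_of_mem hh]
      refine (ftc_enorm hu y h).trans ?_
      apply setLIntegral_mono' measurableSet_Icc
      intro t ht
      have hm : y + t • h ∈ ball x ρ := (convex_ball x ρ).add_smul_mem hy hh ht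
      have hh2 : ‖h‖ < 2 * ρ := by
        rw [mem_ball, dist_eq_norm] at hy hh
        have : h = (y + h - x) - (y - x) := by abel
        rw [this]
        have := norm_sub_le (y + h - x) (y - x)
        linarith
      have hkk : k h = ENNReal.ofReal (2 * ρ) := by
        rw [hk, indicator_of_mem]; rwa [mem_ball_zero_iff]
      have hgg : g (y + t • h) = ‖fderiv ℝ u (y + t • h)‖ₑ := by
        rw [hg, indicator_of_mem hm]
      rw [hkk, hgg, ← ofReal_norm h]
      gcongr
    · simp only [indicator_of_notMem hh, zero_le]
  calc ∫⁻ y in ball x ρ, ∫⁻ z in ball x ρ, ‖u z - u y‖ₑ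
      ≤ ∫⁻ y in ball x ρ, ∫⁻ h, ∫⁻ t in Icc (0:ℝ) 1, g (y + t • h) * k h :=
        setLIntegral_mono' measurableSet_ball hpt
    _ ≤ ∫⁻ y, ∫⁻ h, ∫⁻ t in Icc (0:ℝ) 1, g (y + t • h) * k h := setLIntegral_le_lintegral _ _
    _ = ∫⁻ h, ∫⁻ y, ∫⁻ t in Icc (0:ℝ) 1, g (y + t • h) * k h := by
        apply lintegral_lintegral_swap
        apply Measurable.aemeasurable
        apply Measurable.lintegral_prod_right (f := fun (p : (EV n × EV n)) t => g (p.1 + t • p.2) * k p.2)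
        apply Measurable.mul
        · apply hgm.comp; fun_prop
        · apply hkm.comp; fun_prop
    _ = ∫⁻ h, k h * ∫⁻ y, g y := by
        congr 1; ext h
        rw [lintegral_lintegral_swap]
        · have : ∀ t : ℝ, ∫⁻ y, g (y + t • h) * k h = k h * ∫⁻ y, g y := by
            intro t
            have hm : Measurable fun y => g (y + t • h) := hgm.comp (measurable_id.add_const _)
            rw [lintegral_mul_const _ hm, mul_comm,
              lintegral_add_right_eq_self g]
          simp [this]
        · apply Measurable.aemeasurable
          apply Measurable.mul _ measurable_const
          apply hgm.comp; fun_prop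
    _ = _ := by
        rw [lintegral_mul_const _ hkm, hk, lintegral_indicator measurableSet_ball, hg,
          lintegral_indicator measurableSet_ball, setLIntegral_const]
        ring

lemma LD.poincare (h : LD U E μ ν) (hE : MeasurableSet E) {x : EV n} {ρ R : ℝ} (hρ : 0 < ρ)
    (hR : ρ < R) (hU : ball x R ⊆ U) :
    volume.real (E ∩ ball x ρ) * volume.real (Eᶜ ∩ ball x ρ) ≤
      volume.real (ball (0 : EV n) (2 * ρ)) * (2 * ρ) * μ.real (ball x R) := by
  have := h.fin
  obtain ⟨u, hu, h0, h1, hlim, hint⟩ := h.moll hE hR hU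
  have hfat : ∫⁻ y in ball x ρ, ∫⁻ z in ball x ρ,
      ‖E.indicator (fun _ => (1:ℝ)) z - E.indicator (fun _ => (1:ℝ)) y‖ₑ ≤
      volume (ball (0 : EV n) (2 * ρ)) * ENNReal.ofReal (2 * ρ) * μ (ball x R) := by
    have key : ∀ᵐ y ∂(volume.restrict (ball x ρ)), ∫⁻ z in ball x ρ,
        ‖E.indicator (fun _ => (1:ℝ)) z - E.indicator (fun _ => (1:ℝ)) y‖ₑ ≤
        liminf (fun k => ∫⁻ z in ball x ρ, ‖u k z - u k y‖ₑ) atTop := by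
      filter_upwards [ae_restrict_of_ae hlim] with y hy
      calc _ = ∫⁻ z in ball x ρ, liminf (fun k => ‖u k z - u k y‖ₑ) atTop := by
            apply lintegral_congr_ae
            filter_upwards [ae_restrict_of_ae hlim] with z hz
            exact ((hz.sub hy).enorm).liminf_eq.symm
        _ ≤ _ := by
            apply lintegral_liminf_le
            intro k
            exact (((hu k).continuous.sub continuous_const).enorm).measurable
    calc _ ≤ ∫⁻ y in ball x ρ, liminf (fun k => ∫⁻ z in ball x ρ, ‖u k z - u k y‖ₑ) atTop :=
          lintegral_mono_ae key
      _ ≤ liminf (fun k => ∫⁻ y in ball x ρ, ∫⁻ z in ball x ρ, ‖u k z - u k y‖ₑ) atTop := by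
          apply lintegral_liminf_le
          intro k
          apply Measurable.lintegral_prod_right (f := fun y z => ‖u k z - u k y‖ₑ)
          have := (hu k).continuous
          apply Continuous.measurable
          fun_prop
      _ ≤ liminf (fun k : ℕ => volume (ball (0 : EV n) (2 * ρ)) * ENNReal.ofReal (2 * ρ) * μ (ball x R)) atTop := by
          refine liminf_le_liminf ?_
          refine Eventually.of_forall fun k => ?_
          refine (poincare_smooth (hu k) x ρ).trans ?_
          gcongr
          exact hint k
      _ = _ := by simp
  have hlow : volume (E ∩ ball x ρ) * volume (Eᶜ ∩ ball x ρ) ≤ ∫⁻ y in ball x ρ, ∫⁻ z in ball x ρ,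
      ‖E.indicator (fun _ => (1:ℝ)) z - E.indicator (fun _ => (1:ℝ)) y‖ₑ := by
    calc volume (E ∩ ball x ρ) * volume (Eᶜ ∩ ball x ρ)
        = ∫⁻ y in ball x ρ, E.indicator (fun _ => volume (Eᶜ ∩ ball x ρ)) y := by
          rw [lintegral_indicator_const hE, Measure.restrict_apply hE, mul_comm]
      _ ≤ _ := by
          apply lintegral_mono
          intro y
          by_cases hy : y ∈ E
          · simp only [indicator_of_mem hy]
            rw [← Measure.restrict_apply hE.compl, ← lintegral_indicator_one hE.compl]
            apply lintegral_mono
            intro z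
            by_cases hz : z ∈ E
            · simp [hz]
            · simp [hz]
          · simp [hy]
  have := ENNReal.toReal_mono (by finiteness) (hlow.trans hfat)
  simpa [ENNReal.toReal_mul, Measure.real, ENNReal.toReal_ofReal (by positivity : (0:ℝ) ≤ 2 * ρ), hρ.le] using this
end

section
variable {n : ℕ} {U E : Set (EV n)} {μ : Measure (EV n)} {ν : EV n → EV n}

def sobK (n : ℕ) : ℝ≥0 :=
  lintegralPowLePowLIntegralFDerivConst (volume : Measure (EV n)) ((n:ℝ) / ((n:ℝ) - 1))

lemma tendsto_ind {u : ℕ → EV n → ℝ} (hu : ∀ k, ContDiff ℝ 1 (u k))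
    (h0 : ∀ k y, 0 ≤ u k y) (h1 : ∀ k y, u k y ≤ 1) (hE : MeasurableSet E)
    (hlim : ∀ᵐ y, Tendsto (fun k => u k y) atTop (𝓝 (E.indicator (fun _ => (1:ℝ)) y)))
    (x : EV n) (ρ : ℝ) {p : ℝ} (hp : 0 < p) :
    Tendsto (fun k => ∫⁻ y in ball x ρ, ‖u k y‖ₑ ^ p) atTop (𝓝 (volume (E ∩ ball x ρ))) := by
  have hv : volume (E ∩ ball x ρ) = ∫⁻ y in ball x ρ, ‖E.indicator (fun _ => (1:ℝ)) y‖ₑ ^ p := by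
    have : ∀ y, ‖E.indicator (fun _ => (1:ℝ)) y‖ₑ ^ p = E.indicator (fun _ => (1:ℝ≥0∞)) y := by
      intro y
      by_cases hy : y ∈ E <;> simp [hy, hp]
    simp only [this]
    rw [lintegral_indicator_const hE, Measure.restrict_apply hE, one_mul]
  rw [hv]
  apply tendsto_lintegral_of_dominated_convergence (fun _ => (1:ℝ≥0∞))
  · intro k
    exact ((hu k).continuous.enorm.measurable).pow_const _
  · intro k
    refine Eventually.of_forall fun y => ?_
    apply ENNReal.rpow_le_one _ hp.le
    rw [Real.enorm_eq_ofReal (h0 k y)]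
    exact ENNReal.ofReal_le_one.2 (h1 k y)
  · simp [measure_ball_lt_top.ne]
  · filter_upwards [ae_restrict_of_ae hlim] with y hy
    exact (ENNReal.continuous_rpow_const.tendsto _).comp hy.enorm

lemma LD.sobolev (h : LD U E μ ν) (hE : MeasurableSet E) (hn : 2 ≤ n) {x : EV n} {ρ R : ℝ} (hρ : 0 < ρ)
    (hR : ρ < R) (hU : ball x R ⊆ U) :
    volume.real (E ∩ ball x ρ) ≤ sobK n * (μ.real (ball x R) +
      cutA / ((R - ρ) / 2) * volume.real (E ∩ ball x R)) ^ ((n:ℝ) / ((n:ℝ) - 1)) := by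
  have := h.fin
  have hn' : (2:ℝ) ≤ n := by exact_mod_cast hn
  set p : ℝ := (n:ℝ) / ((n:ℝ) - 1) with hp
  have hp0 : 0 < p := div_pos (by linarith) (by linarith)
  have hpc : Real.HolderConjugate (Module.finrank ℝ (EV n)) p := by
    rw [finrank_euclideanSpace_fin]
    exact Real.HolderConjugate.conjExponent (by linarith)
  set ρ' := (ρ + R) / 2 with hρ'
  have e1 : ρ < ρ' := by linarith
  have e2 : ρ' < R := by linarith
  have e3 : ρ' - ρ = (R - ρ) / 2 := by linarith
  obtain ⟨φ, hφ, hc, hf0, hf1, hone, hts, hd⟩ := cutoff x hρ e1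
  obtain ⟨u, hu, h0, h1, hlim, hint⟩ := h.moll hE e2 hU
  rw [e3] at hd
  set c := cutA / ((R - ρ) / 2) with hcc
  have hc0 : 0 ≤ c := div_nonneg cutA_pos.le (by linarith)
  have hφ1 : ContDiff ℝ 1 φ := hφ.of_le (by exact_mod_cast le_top)
  have step : ∀ k, ∫⁻ y in ball x ρ, ‖u k y‖ₑ ^ p ≤
      sobK n * (μ (ball x R) + ENNReal.ofReal c * ∫⁻ y in ball x ρ', ‖u k y‖ₑ ^ (1:ℝ)) ^ p := by
    intro k
    have hs := lintegral_pow_le_pow_lintegral_fderiv (volume : Measure (EV n))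
      (u := fun y => φ y * u k y) (hφ1.mul (hu k)) hc.mul_right hpc
    have hl : ∫⁻ y in ball x ρ, ‖u k y‖ₑ ^ p ≤ ∫⁻ y, ‖φ y * u k y‖ₑ ^ p := by
      calc _ = ∫⁻ y in ball x ρ, ‖φ y * u k y‖ₑ ^ p := by
            apply setLIntegral_congr_fun measurableSet_ball
            intro y hy
            simp only [hone y hy, one_mul]
        _ ≤ _ := setLIntegral_le_lintegral _ _
    have hr : ∫⁻ y, ‖fderiv ℝ (fun y => φ y * u k y) y‖ₑ ≤
        μ (ball x R) + ENNReal.ofReal c * ∫⁻ y in ball x ρ', ‖u k y‖ₑ ^ (1:ℝ) := by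
      have hsupp : ∀ y, y ∉ ball x ρ' → fderiv ℝ (fun y => φ y * u k y) y = 0 := by
        intro y hy
        have : y ∉ tsupport (fun y => φ y * u k y) := fun hh => hy (hts (tsupport_mul_subset_left hh))
        by_contra hne
        exact this (support_fderiv_subset ℝ hne)
      have hpt : ∀ y, ‖fderiv ℝ (fun y => φ y * u k y) y‖ₑ ≤
          (ball x ρ').indicator (fun y => ‖fderiv ℝ (u k) y‖ₑ + ENNReal.ofReal c * ‖u k y‖ₑ ^ (1:ℝ)) y := by
        intro y
        by_cases hy : y ∈ ball x ρ'
        · rw [indicator_of_mem hy, fderiv_fun_mul (hφ1.differentiable one_ne_zero y)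
            ((hu k).differentiable one_ne_zero y)]
          have hadd : ‖φ y • fderiv ℝ (u k) y + u k y • fderiv ℝ φ y‖ₑ ≤
            ‖φ y • fderiv ℝ (u k) y‖ₑ + ‖u k y • fderiv ℝ φ y‖ₑ := by
            simp only [← ofReal_norm]
            rw [← ENNReal.ofReal_add (norm_nonneg _) (norm_nonneg _)]
            exact ENNReal.ofReal_le_ofReal (norm_add_le _ _)
          refine hadd.trans ?_
          rw [enorm_smul, enorm_smul, mul_comm ‖u k y‖ₑ, ENNReal.rpow_one]
          gcongr
          · rw [Real.enorm_eq_ofReal (hf0 y)]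
            exact mul_le_of_le_one_left (zero_le) (ENNReal.ofReal_le_one.2 (hf1 y))
          · rw [← ofReal_norm (fderiv ℝ φ y)]
            gcongr
            exact hd y
        · have hz : ‖fderiv ℝ (fun y => φ y * u k y) y‖ₑ = 0 := by
            rw [← ofReal_norm, hsupp y hy, norm_zero, ENNReal.ofReal_zero]
          rw [hz]; exact zero_le
      calc _ ≤ _ := lintegral_mono hpt
        _ = ∫⁻ y in ball x ρ', (‖fderiv ℝ (u k) y‖ₑ + ENNReal.ofReal c * ‖u k y‖ₑ ^ (1:ℝ)) :=
            lintegral_indicator measurableSet_ball _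
        _ = (∫⁻ y in ball x ρ', ‖fderiv ℝ (u k) y‖ₑ) + ∫⁻ y in ball x ρ', ENNReal.ofReal c * ‖u k y‖ₑ ^ (1:ℝ) :=
            lintegral_add_left (((hu k).continuous_fderiv one_ne_zero).enorm.measurable) _
        _ ≤ _ := by
            rw [lintegral_const_mul _ (((hu k).continuous.enorm.measurable).pow_const _)]
            gcongr
            exact hint k
    refine hl.trans (hs.trans ?_)
    rw [sobK]
    gcongr
  have hlimit : volume (E ∩ ball x ρ) ≤
      sobK n * (μ (ball x R) + ENNReal.ofReal c * volume (E ∩ ball x ρ')) ^ p := by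
    refine le_of_tendsto_of_tendsto' (tendsto_ind hu h0 h1 hE hlim x ρ hp0) ?_ step
    refine ENNReal.Tendsto.const_mul ?_ (Or.inr ENNReal.coe_ne_top)
    refine (ENNReal.continuous_rpow_const.tendsto _).comp ?_
    refine tendsto_const_nhds.add ?_
    exact ENNReal.Tendsto.const_mul (tendsto_ind hu h0 h1 hE hlim x ρ' one_pos) (Or.inr ENNReal.ofReal_ne_top)
  have hfin : ∀ r, volume (E ∩ ball x r) ≠ ∞ := fun r =>
    ((measure_mono inter_subset_right).trans_lt measure_ball_lt_top).ne
  have hlimit2 : volume (E ∩ ball x ρ) ≤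
      sobK n * (μ (ball x R) + ENNReal.ofReal c * volume (E ∩ ball x R)) ^ p := by
    refine hlimit.trans ?_
    gcongr
  have hne : (μ (ball x R) + ENNReal.ofReal c * volume (E ∩ ball x R)) ≠ ∞ :=
    ENNReal.add_ne_top.2 ⟨measure_ne_top _ _, ENNReal.mul_ne_top ENNReal.ofReal_ne_top (hfin R)⟩
  have := ENNReal.toReal_mono (ENNReal.mul_ne_top ENNReal.coe_ne_top
    (ENNReal.rpow_ne_top_of_nonneg hp0.le hne)) hlimit2
  rw [ENNReal.toReal_mul, ← ENNReal.toReal_rpow, ENNReal.toReal_add (measure_ne_top _ _)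
    (ENNReal.mul_ne_top ENNReal.ofReal_ne_top (hfin R)), ENNReal.toReal_mul, ENNReal.toReal_ofReal hc0] at this
  exact this
end

lemma iter_aux {A K : ℝ} (hA : 0 < A) (hK : 0 ≤ K) {n : ℕ} (hn : 2 ≤ n) :
    ∃ q ε δ1 δ2 : ℝ, 0 < q ∧ q < 1 ∧ 0 < ε ∧ 0 < δ1 ∧ 0 < δ2 ∧ ∀ h M : ℕ → ℝ, (∀ k, 0 ≤ h k) → (∀ k, 0 ≤ M k) →
      h 0 ≤ δ2 → M 0 ≤ δ1 → (∀ k, h (k+1) ≤ ε * h k + A * 2 ^ (k+2) * M k) →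
      (∀ k, M (k+1) ≤ K * (h k + 2 * A * 2 ^ (k+2) * M k) ^ ((n:ℝ) / ((n:ℝ) - 1))) →
      ∀ k, h k ≤ δ2 * q ^ k ∧ M k ≤ δ1 * (q / 4) ^ k := by
  have hn' : (2:ℝ) ≤ n := by exact_mod_cast hn
  set p : ℝ := (n:ℝ) / ((n:ℝ) - 1) with hp
  have hp1 : 0 < p - 1 := by
    rw [hp, div_sub_one (by linarith)]
    apply div_pos <;> linarith
  set q : ℝ := (4:ℝ) ^ (-((n:ℝ) - 1)) with hq
  have hq0 : 0 < q := by positivity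
  have hq1 : q < 1 := Real.rpow_lt_one_of_one_lt_of_neg (by norm_num) (by linarith)
  have hqp : q ^ p = q / 4 := by
    rw [hq, ← Real.rpow_mul (by norm_num)]
    have : -((n:ℝ) - 1) * p = -((n:ℝ) - 1) - 1 := by
      rw [hp]; field_simp [show (n:ℝ) - 1 ≠ 0 by linarith]; ring
    rw [this, Real.rpow_sub_one (by norm_num)]
  have hlim : Tendsto (fun t : ℝ => K * t ^ (p - 1)) (𝓝[>] 0) (𝓝 0) := by
    have : Tendsto (fun t : ℝ => K * t ^ (p - 1)) (𝓝 0) (𝓝 (K * 0 ^ (p-1))) :=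
      ((Real.continuousAt_rpow_const 0 (p-1) (Or.inr hp1.le)).const_mul K)
    rw [Real.zero_rpow hp1.ne', mul_zero] at this
    exact this.mono_left nhdsWithin_le_nhds
  have hev := (hlim.eventually_le_const (show 0 < q ^ 2 / (64 * A) by positivity)).and self_mem_nhdsWithin
  obtain ⟨t, ht, ht0'⟩ := hev.exists
  have ht0 : 0 < t := ht0'
  have hδ : q * (t/2) / (8 * A) * (8 * A) = q * (t / 2) := by field_simp
  set δ2 := t / 2 with hd2
  set δ1 := q * δ2 / (8 * A) with hd1
  refine ⟨q, q / 2, δ1, δ2, hq0, hq1, by positivity, by positivity, by positivity, ?_⟩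
  intro h M h0 M0 hh0 hM0 hh hM k
  induction k with
  | zero => simpa using ⟨hh0, hM0⟩
  | succ k ih =>
    obtain ⟨ih1, ih2⟩ := ih
    have hm : A * 2 ^ (k+2) * M k ≤ 4 * A * δ1 * q ^ k := by
      calc A * 2 ^ (k+2) * M k ≤ A * 2 ^ (k+2) * (δ1 * (q / 4) ^ k) := by gcongr
        _ = 4 * A * δ1 * (q / 2) ^ k := by
          rw [div_pow, div_pow, show (4:ℝ) = 2 * 2 by norm_num, mul_pow]; field_simp; ring
        _ ≤ 4 * A * δ1 * q ^ k := by
          gcongr; linarith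
    have hm' : 4 * A * δ1 * q ^ k = q * δ2 / 2 * q ^ k := by
      have : 4 * A * δ1 = q * δ2 / 2 := by linarith
      rw [this]
    have hqk : 0 < q ^ k := by positivity
    constructor
    · have := hh k
      have h2 : q / 2 * h k ≤ q / 2 * (δ2 * q ^ k) := by gcongr
      rw [pow_succ]
      linarith
    · refine (hM k).trans ?_
      have hb : h k + 2 * A * 2 ^ (k+2) * M k ≤ t * q ^ k := by
        have : q * δ2 * q ^ k ≤ 1 * δ2 * q ^ k := by gcongr
        have h3 : 2 * A * 2 ^ (k+2) * M k = 2 * (A * 2 ^ (k+2) * M k) := by ring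
        have h4 : t * q ^ k = 2 * (δ2 * q ^ k) := by rw [hd2]; ring
        rw [h3, h4]
        linarith
      have hb0 : 0 ≤ h k + 2 * A * 2 ^ (k+2) * M k := by
        have := h0 k; have := M0 k; positivity
      calc K * (h k + 2 * A * 2 ^ (k+2) * M k) ^ p ≤ K * (t * q ^ k) ^ p := by
            gcongr
            linarith
        _ = K * t ^ (p - 1) * t * (q / 4) ^ k := by
            rw [Real.mul_rpow ht0.le hqk.le, ← Real.rpow_natCast q k, ← Real.rpow_mul hq0.le,
              mul_comm (k:ℝ) p, Real.rpow_mul hq0.le, hqp, Real.rpow_natCast, Real.rpow_sub_one ht0.ne']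
            field_simp
        _ ≤ q ^ 2 / (64 * A) * t * (q / 4) ^ k := by gcongr
        _ = δ1 * (q / 4) ^ (k+1) := by
            rw [hd1, hd2]; ring

section
variable {n : ℕ}  {U E : Set (EV n)} {μ : Measure (EV n)} {ν : EV n → EV n}

lemma small_aux (hn : 2 ≤ n) : ∃ δ1 δ2 : ℝ, 0 < δ1 ∧ 0 < δ2 ∧
    ∀ (U E : Set (EV n)) (μ : Measure (EV n)) (ν : EV n → EV n) (x v : EV n),
    LD U E μ ν → MeasurableSet E → x ∈ U → Pt μ ν x v → ∀ᶠ r in 𝓝[>] (0:ℝ),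
      μ.real (ball x r) ≤ δ2 * r ^ (n-1) → volume.real (E ∩ ball x r) ≤ δ1 * r ^ n → False := by
  obtain ⟨q, ε, δ1, δ2, hq0, hq1, hε, hδ1, hδ2, hit⟩ :=
    iter_aux (A := cutA) (K := sobK n) cutA_pos (NNReal.coe_nonneg _) hn
  refine ⟨δ1, δ2, hδ1, hδ2, ?_⟩
  intro U E μ ν x v h hE hx hp
  have := h.fin
  have hn' : (2:ℝ) ≤ n := by exact_mod_cast hn
  obtain ⟨R0, hR0, hU⟩ := Metric.isOpen_iff.1 h.isOpen x hx
  obtain ⟨R1, hR1, hex⟩ := (mem_nhdsGT_iff_exists_Ioo_subset).1 (hp.exc ε hε)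
  simp only [mem_Ioi] at hR1
  have hev : Ioo (0:ℝ) (min R0 R1) ∈ 𝓝[>] (0:ℝ) := Ioo_mem_nhdsGT (lt_min hR0 hR1)
  filter_upwards [hev] with r hr hμ hV
  have hr0 := hr.1
  have hrR0 : r < R0 := hr.2.trans_le (min_le_left _ _)
  have hrR1 : r < R1 := hr.2.trans_le (min_le_right _ _)
  set s : ℕ → ℝ := fun k => r * (1/2 + (1/2) ^ (k+1)) with hs
  have hs0 : ∀ k, 0 < s k := fun k => by positivity
  have hsr : ∀ k, s k ≤ r := by
    intro k
    have : (1/2:ℝ) ^ (k+1) ≤ (1/2) ^ 1 := pow_le_pow_of_le_one (by norm_num) (by norm_num) (by omega)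
    have h2 : 1/2 + (1/2:ℝ) ^ (k+1) ≤ 1 := by linarith
    calc s k ≤ r * 1 := by simp only [hs]; gcongr
      _ = r := mul_one r
  have hgap : ∀ k, s k - s (k+1) = r / 2 ^ (k+2) := by
    intro k; simp only [hs, div_pow, one_pow, pow_succ]; field_simp; ring
  have hlt : ∀ k, s (k+1) < s k := by
    intro k
    have : 0 < r / 2 ^ (k+2) := by positivity
    linarith [hgap k]
  have hsU : ∀ k, ball x (s k) ⊆ U := fun k =>
    (ball_subset_ball ((hsr k).trans hrR0.le)).trans hU
  have hr1 : 0 < r ^ (n-1) := by positivity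
  have hrn : r ^ n = r ^ (n-1) * r := by rw [← pow_succ]; congr 1; omega
  have key := hit (fun k => μ.real (ball x (s k)) / r ^ (n-1))
    (fun k => volume.real (E ∩ ball x (s k)) / r ^ n)
    (fun k => by positivity) (fun k => by positivity)
    (by
      have : s 0 = r := by simp only [hs]; ring
      rw [this, div_le_iff₀ hr1]; exact hμ)
    (by
      have : s 0 = r := by simp only [hs]; ring
      rw [this, div_le_iff₀ (by positivity)]; exact hV)
    (by
      intro k
      have hc := h.caccioppoli hp.norm_v (hs0 (k+1)) (hlt k) (hsU k)
      have he := hex ⟨hs0 k, (hsr k).trans_lt hrR1⟩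
      simp only [mem_ofPred_eq] at he
      rw [hgap] at hc
      rw [div_le_iff₀ hr1]
      refine hc.trans ((add_le_add_left he _).trans (le_of_eq ?_))
      rw [hrn]
      field_simp)
    (by
      intro k
      have hsob := h.sobolev hE hn (hs0 (k+1)) (hlt k) (hsU k)
      rw [hgap] at hsob
      rw [div_le_iff₀ (by positivity)]
      refine hsob.trans (le_of_eq ?_)
      have e1 : μ.real (ball x (s k)) + cutA / (r / 2 ^ (k + 2) / 2) * volume.real (E ∩ ball x (s k))
        = r ^ (n-1) * (μ.real (ball x (s k)) / r ^ (n - 1) +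
          2 * cutA * 2 ^ (k + 2) * (volume.real (E ∩ ball x (s k)) / r ^ n)) := by
        rw [hrn]; field_simp
      have e2 : (r ^ (n-1)) ^ ((n:ℝ) / ((n:ℝ) - 1)) = r ^ n := by
        rw [← Real.rpow_natCast r (n-1), ← Real.rpow_mul hr0.le, Nat.cast_sub (by omega), Nat.cast_one,
          mul_div_cancel₀ _ (by linarith : (n:ℝ) - 1 ≠ 0), Real.rpow_natCast]
      have hA := cutA_pos
      rw [e1, Real.mul_rpow hr1.le (by positivity), e2]
      ring)
  have hle : ∀ k, μ.real (ball x (r/2)) ≤ r ^ (n-1) * (δ2 * q ^ k) := by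
    intro k
    have h1 := (key k).1
    rw [div_le_iff₀ hr1] at h1
    have h2 : μ.real (ball x (r/2)) ≤ μ.real (ball x (s k)) := by
      refine measureReal_mono (ball_subset_ball ?_)
      have : 0 < r * (1/2) ^ (k+1) := by positivity
      simp only [hs]; linarith
    linarith
  have hlim : Tendsto (fun k : ℕ => r ^ (n-1) * (δ2 * q ^ k)) atTop (𝓝 (r ^ (n-1) * (δ2 * 0))) :=
    ((tendsto_pow_atTop_nhds_zero_of_lt_one hq0.le hq1).const_mul _).const_mul _
  have hz := ge_of_tendsto' hlim hle
  have hpos := hp.pos (r/2) (by positivity)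
  have : 0 < μ.real (ball x (r/2)) := ENNReal.toReal_pos hpos.ne' (measure_ne_top _ _)
  simp at hz
  linarith

lemma Pt.neg {x v : EV n} (hp : Pt μ ν x v) : Pt μ (fun y => - ν y) x (-v) where
  norm_v := by rw [norm_neg]; exact hp.norm_v
  pos := hp.pos
  exc := by simpa only [inner_neg_neg] using hp.exc

lemma integral_fderiv_zero {φ : EV n → ℝ} (hφ : ContDiff ℝ (⊤ : ℕ∞) φ) (hc : HasCompactSupport φ) (w : EV n) :
    ∫ x, fderiv ℝ φ x w = 0 := by
  have h1 : ContDiff ℝ 1 φ := hφ.of_le (by exact_mod_cast le_top)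
  have hcf : HasCompactSupport (fun x => fderiv ℝ φ x w) := hc.fderiv_apply (𝕜 := ℝ) w
  have hcont : Continuous (fun x => fderiv ℝ φ x w) := by
    have := h1.continuous_fderiv one_ne_zero
    fun_prop
  have := integral_mul_fderiv_eq_neg_fderiv_mul_of_integrable (μ := (volume : Measure (EV n)))
    (f := fun _ => (1:ℝ)) (g := φ) (v := w) (by simp)
    (by simpa using hcont.integrable_of_hasCompactSupport hcf)
    (by simpa using h1.continuous.integrable_of_hasCompactSupport hc)
    (fun _ _ => by fun_prop) (fun x _ => h1.differentiable one_ne_zero x)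
  simpa using this

lemma LD.compl (h : LD U E μ ν) (hE : MeasurableSet E) : LD U Eᶜ μ (fun y => - ν y) where
  isOpen := h.isOpen
  fin := h.fin
  meas := h.meas.neg
  unit := by simpa using h.unit
  parts := by
    intro φ hφ hc hs w
    have h1 : ContDiff ℝ 1 φ := hφ.of_le (by exact_mod_cast le_top)
    have hcf : HasCompactSupport (fun x => fderiv ℝ φ x w) := hc.fderiv_apply (𝕜 := ℝ) w
    have hcont : Continuous (fun x => fderiv ℝ φ x w) := by
      have := h1.continuous_fderiv one_ne_zero
      fun_prop
    have := integral_add_compl hE (hcont.integrable_of_hasCompactSupport hcf (μ := volume))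
    rw [integral_fderiv_zero hφ hc, h.parts φ hφ hc hs w] at this
    simp only [inner_neg_left, mul_neg, integral_neg]
    linarith

lemma LD.lower (h : LD U E μ ν) (hE : MeasurableSet E) (hn : 2 ≤ n) {x v : EV n} (hx : x ∈ U)
    (hp : Pt μ ν x v) :
    ∃ c : ℝ, 0 < c ∧ ∀ᶠ r in 𝓝[>] (0:ℝ), c * r ^ (n-1) ≤ μ.real (ball x r) := by
  have := h.fin
  obtain ⟨δ1, δ2, hδ1, hδ2, hsm⟩ := small_aux hn
  set ω := volume.real (ball (0 : EV n) 1) with hω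
  have hω0 : 0 < ω := ENNReal.toReal_pos (measure_ball_pos _ _ one_pos).ne' measure_ball_lt_top.ne
  refine ⟨min (δ2 / 2 ^ (n-1)) ((δ1 / 2 ^ n) ^ 2 / ω), by positivity, ?_⟩
  set c := min (δ2 / 2 ^ (n-1)) ((δ1 / 2 ^ n) ^ 2 / ω) with hc
  have hhalf : Tendsto (fun r : ℝ => r / 2) (𝓝[>] 0) (𝓝[>] 0) := by
    refine tendsto_nhdsWithin_iff.2 ⟨?_, ?_⟩
    · have : Tendsto (fun r : ℝ => r / 2) (𝓝 0) (𝓝 (0/2)) := tendsto_id.div_const 2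
      rw [zero_div] at this
      exact this.mono_left nhdsWithin_le_nhds
    · filter_upwards [self_mem_nhdsWithin] with r hr
      simp only [mem_Ioi] at hr ⊢; positivity
  obtain ⟨R0, hR0, hU⟩ := Metric.isOpen_iff.1 h.isOpen x hx
  have hev : Ioo (0:ℝ) R0 ∈ 𝓝[>] (0:ℝ) := Ioo_mem_nhdsGT hR0
  filter_upwards [hev, hhalf.eventually (hsm U E μ ν x v h hE hx hp),
    hhalf.eventually (hsm U Eᶜ μ _ x (-v) (h.compl hE) hE.compl hx hp.neg)] with r hr h1 h2
  by_contra hlt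
  push Not at hlt
  have hr0 := hr.1
  have hrn : r ^ n = r ^ (n-1) * r := by rw [← pow_succ]; congr 1; omega
  have hμ : μ.real (ball x (r/2)) ≤ δ2 * (r/2) ^ (n-1) := by
    calc μ.real (ball x (r/2)) ≤ μ.real (ball x r) :=
          measureReal_mono (ball_subset_ball (by linarith))
      _ ≤ c * r ^ (n-1) := hlt.le
      _ ≤ δ2 / 2 ^ (n-1) * r ^ (n-1) := by gcongr; exact min_le_left _ _
      _ = _ := by rw [div_pow]; ring
  have hpo := h.poincare hE (x := x) (ρ := r/2) (R := r) (by positivity) (by linarith)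
    ((ball_subset_ball hr.2.le).trans hU)
  rw [show 2 * (r/2) = r by ring, ball_vol 0 hr0] at hpo
  have hpo2 : volume.real (E ∩ ball x (r/2)) * volume.real (Eᶜ ∩ ball x (r/2)) ≤
      (δ1 * (r/2) ^ n) * (δ1 * (r/2) ^ n) := by
    refine hpo.trans ?_
    calc r ^ n * volume.real (ball (0 : EV n) 1) * r * μ.real (ball x r)
        ≤ r ^ n * ω * r * (((δ1 / 2 ^ n) ^ 2 / ω) * r ^ (n-1)) := by
          gcongr
          exact hlt.le.trans (by gcongr; exact min_le_right _ _)
      _ = _ := by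
          rw [div_pow r]
          have : r * r ^ (n-1) = r ^ n := by rw [hrn]; ring
          calc _ = r ^ n * (r * r ^ (n-1)) * (δ1 / 2 ^ n) ^ 2 := by field_simp
            _ = _ := by rw [this]; ring
  rcases le_total (volume.real (E ∩ ball x (r/2))) (δ1 * (r/2) ^ n) with hh | hh
  · exact h1 hμ hh
  · apply h2 hμ
    by_contra h3
    push Not at h3
    have : 0 < δ1 * (r/2) ^ n := by positivity
    exact absurd hpo2 (not_le.2 (mul_lt_mul' hh h3 this.le (this.trans_le hh)))
end

section
variable {n : ℕ}  {U E : Set (EV n)} {μ σ : Measure (EV n)} {ν : EV n → EV n}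

lemma comp_scale_contDiff {g : EV n → ℝ} (hg : ContDiff ℝ (⊤ : ℕ∞) g) (x : EV n) (r : ℝ) :
    ContDiff ℝ (⊤ : ℕ∞) (fun y => g (r⁻¹ • (y - x))) := by fun_prop

lemma scale_notMem {ρ r : ℝ} (hr : 0 < r) {x y : EV n} (hy : y ∉ ball x (r * ρ)) :
    r⁻¹ • (y - x) ∉ ball (0 : EV n) ρ := by
  intro h
  apply hy
  rw [mem_ball_zero_iff, norm_smul, norm_inv, Real.norm_of_nonneg hr.le, inv_mul_lt_iff₀ hr] at h
  rwa [mem_ball, dist_eq_norm]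

lemma scale_tsupport {g : EV n → ℝ} {ρ r : ℝ} (hr : 0 < r) (x : EV n)
    (hg : ∀ z, z ∉ ball (0 : EV n) ρ → g z = 0) :
    tsupport (fun y => g (r⁻¹ • (y - x))) ⊆ closedBall x (r * ρ) := by
  apply closure_minimal _ isClosed_closedBall
  intro y hy
  by_contra hne
  exact hy (hg _ (scale_notMem hr fun h => hne (ball_subset_closedBall h)))

lemma scale_hasCompactSupport {g : EV n → ℝ} {ρ r : ℝ} (hr : 0 < r) (x : EV n)
    (hg : ∀ z, z ∉ ball (0 : EV n) ρ → g z = 0) :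
    HasCompactSupport (fun y => g (r⁻¹ • (y - x))) :=
  (isCompact_closedBall x (r * ρ)).of_isClosed_subset (isClosed_tsupport _) (scale_tsupport hr x hg)

lemma fderiv_scale {g : EV n → ℝ} (hg : Differentiable ℝ g) (x : EV n) (r : ℝ) (y w : EV n) :
    fderiv ℝ (fun y => g (r⁻¹ • (y - x))) y w = r⁻¹ * fderiv ℝ g (r⁻¹ • (y - x)) w := by
  have h1 : HasFDerivAt (fun y : EV n => r⁻¹ • (y - x)) (r⁻¹ • ContinuousLinearMap.id ℝ (EV n)) y :=
    ((hasFDerivAt_id y).sub_const x).const_smul r⁻¹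
  have h2 := (hg (r⁻¹ • (y - x))).hasFDerivAt.comp y h1
  have h3 : fderiv ℝ (fun y => g (r⁻¹ • (y - x))) y = _ := h2.fderiv
  rw [h3]
  simp

lemma exists_supp_ball {g : EV n → ℝ} (hg : HasCompactSupport g) :
    ∃ ρ : ℝ, 0 < ρ ∧ tsupport g ⊆ ball (0 : EV n) ρ := by
  obtain ⟨ρ, hρ, h⟩ := hg.isCompact.isBounded.subset_ball_lt 0 0
  exact ⟨ρ, hρ, h⟩

lemma fderiv_out {ψ : EV n → ℝ} {ρ : ℝ} (h : tsupport ψ ⊆ ball (0 : EV n) ρ) (w z : EV n)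
    (hz : z ∉ ball (0 : EV n) ρ) : fderiv ℝ ψ z w = 0 := by
  have : fderiv ℝ ψ z = 0 := by
    by_contra hne
    exact hz (h (support_fderiv_subset ℝ hne))
  rw [this]; simp

lemma LD.inv_identity (h : LD U E μ ν) {x : EV n} {ψ : EV n → ℝ} (hψ : ContDiff ℝ (⊤ : ℕ∞) ψ)
    {ρ r : ℝ} (hs : tsupport ψ ⊆ ball (0 : EV n) ρ) (hr : 0 < r) (hU : closedBall x (r * ρ) ⊆ U) (v w : EV n) :
    ∫ y, fderiv ℝ ψ (r⁻¹ • (y - x)) w * inner ℝ (ν y) v ∂μ =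
    ∫ y, fderiv ℝ ψ (r⁻¹ • (y - x)) v * inner ℝ (ν y) w ∂μ := by
  have hsm : ∀ w, ContDiff ℝ (⊤ : ℕ∞) (fun z => fderiv ℝ ψ z w) := by
    intro w
    have : ContDiff ℝ (⊤ : ℕ∞) (fderiv ℝ ψ) := hψ.fderiv_right (by norm_cast)
    exact this.clm_apply contDiff_const
  have hp : ∀ v w, ∫ y, fderiv ℝ ψ (r⁻¹ • (y - x)) w * inner ℝ (ν y) v ∂μ =
      ∫ y in E, r⁻¹ * fderiv ℝ (fderiv ℝ ψ) (r⁻¹ • (y - x)) v w := by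
    intro v w
    have := h.parts (fun y => fderiv ℝ ψ (r⁻¹ • (y - x)) w) (comp_scale_contDiff (hsm w) x r)
      (scale_hasCompactSupport hr x (fderiv_out hs w))
      ((scale_tsupport hr x (fderiv_out hs w)).trans hU) v
    rw [← this]
    congr 1
    ext y
    rw [fderiv_scale (g := fun z => fderiv ℝ ψ z w) ((hsm w).differentiable (by simp))]
    congr 1
    have hd : DifferentiableAt ℝ (fderiv ℝ ψ) (r⁻¹ • (y - x)) :=
      (hψ.fderiv_right (m := 1) (by norm_cast)).differentiable one_ne_zero _
    rw [fderiv_clm_apply hd (by fun_prop)]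
    simp
  rw [hp, hp]
  congr 1
  ext y
  congr 1
  have : IsSymmSndFDerivAt ℝ ψ (r⁻¹ • (y - x)) :=
    (hψ.contDiffAt).isSymmSndFDerivAt (by simp; exact WithTop.coe_le_coe.2 (le_top : (2:ℕ∞) ≤ ⊤))
  exact this v w

lemma inner_bd {ν v w : EV n} (h1 : ‖ν‖ = 1) (hv : ‖v‖ = 1) (hw : inner ℝ v w = 0) {δ : ℝ} (hδ : 0 < δ) :
    |inner ℝ ν w| ≤ ‖w‖ * (δ + δ⁻¹ * (1 - inner ℝ ν v)) := by
  have e : inner ℝ ν w = inner ℝ (ν - v) w := by rw [inner_sub_left, hw, sub_zero]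
  have h2 : ‖ν - v‖ ^ 2 = 2 * (1 - inner ℝ ν v) := by
    rw [norm_sub_sq_real, h1, hv]; ring
  have h3 : ‖ν - v‖ ≤ δ + δ⁻¹ * (1 - inner ℝ ν v) := by
    have : 1 - inner ℝ ν v = ‖ν - v‖ ^ 2 / 2 := by linarith
    rw [this]
    have h4 : δ + δ⁻¹ * (‖ν - v‖ ^ 2 / 2) - ‖ν - v‖ = δ⁻¹ * ((‖ν - v‖ - δ) ^ 2 / 2 + δ ^ 2 / 2) := by
      field_simp; ring
    have : 0 ≤ δ⁻¹ * ((‖ν - v‖ - δ) ^ 2 / 2 + δ ^ 2 / 2) := by positivity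
    linarith
  rw [e]
  refine (abs_real_inner_le_norm _ _).trans ?_
  rw [mul_comm]
  gcongr

lemma tendsto_scale {ρ : ℝ} (hρ : 0 < ρ) : Tendsto (fun r : ℝ => r * ρ) (𝓝[>] 0) (𝓝[>] 0) := by
  refine tendsto_nhdsWithin_iff.2 ⟨?_, ?_⟩
  · have : Tendsto (fun r : ℝ => r * ρ) (𝓝 0) (𝓝 (0 * ρ)) := tendsto_id.mul_const ρ
    rw [zero_mul] at this
    exact this.mono_left nhdsWithin_le_nhds
  · filter_upwards [self_mem_nhdsWithin] with r hr
    simp only [mem_Ioi] at hr ⊢; positivity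

/-- asymptotic invariance in direction `w` -/
def AInv (σ : Measure (EV n)) (x w : EV n) : Prop :=
  ∀ ψ : EV n → ℝ, ContDiff ℝ (⊤ : ℕ∞) ψ → HasCompactSupport ψ →
    Tendsto (fun r : ℝ => (∫ y, fderiv ℝ ψ (r⁻¹ • (y - x)) w ∂σ) / r ^ (n-1)) (𝓝[>] 0) (𝓝 0)

lemma LD.inv (h : LD U E μ ν) (hn : 1 ≤ n) {x v : EV n} (hx : x ∈ U) (hp : Pt μ ν x v) {w : EV n}
    (hw : inner ℝ v w = 0) : AInv μ x w := by
  have := h.fin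
  intro ψ hψ hc
  obtain ⟨ρ, hρ, hs⟩ := exists_supp_ball hc
  obtain ⟨C, hC, hup⟩ := h.upper hx hp hn
  have hcontf : Continuous (fderiv ℝ ψ) := hψ.continuous_fderiv (by simp)
  obtain ⟨B, hB⟩ := hcontf.bounded_above_of_compact_support (hc.fderiv (𝕜 := ℝ))
  have hB0 : 0 ≤ B := (norm_nonneg _).trans (hB 0)
  have hbd : ∀ z w, |fderiv ℝ ψ z w| ≤ B * ‖w‖ := fun z w =>
    ((fderiv ℝ ψ z).le_opNorm w).trans (by gcongr; exact hB z)
  obtain ⟨R0, hR0, hU⟩ := Metric.isOpen_iff.1 h.isOpen x hx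
  rw [Metric.tendsto_nhds]
  intro η hη
  obtain ⟨δ, hδ, hδη⟩ : ∃ δ : ℝ, 0 < δ ∧ B * ‖w‖ * (3 * δ) * (C * ρ ^ (n-1)) < η := by
    set K := B * ‖w‖ * 3 * (C * ρ ^ (n-1)) with hK
    have hK0 : 0 ≤ K := by positivity
    refine ⟨η / (K + 1), by positivity, ?_⟩
    calc B * ‖w‖ * (3 * (η / (K + 1))) * (C * ρ ^ (n-1)) = K * η / (K + 1) := by rw [hK]; ring
      _ < η := by rw [div_lt_iff₀ (by positivity)]; nlinarith
  set ε := min δ (δ ^ 2) with hε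
  have hε0 : 0 < ε := by positivity
  filter_upwards [(tendsto_scale hρ).eventually (Ioo_mem_nhdsGT hR0), self_mem_nhdsWithin,
    (tendsto_scale hρ).eventually hup, (tendsto_scale hρ).eventually (hp.exc ε hε0)] with r hrR hr hup hexc
  simp only [mem_Ioi] at hr
  have hUr : closedBall x (r * ρ) ⊆ U := (closedBall_subset_ball hrR.2).trans hU
  have hid := h.inv_identity hψ hs hr hUr v w
  have hcw : ∀ w, Continuous (fun y => fderiv ℝ ψ (r⁻¹ • (y - x)) w) := by intro w; fun_prop
  have hcs : ∀ w, HasCompactSupport (fun y => fderiv ℝ ψ (r⁻¹ • (y - x)) w) := fun w =>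
    scale_hasCompactSupport hr x (fderiv_out hs w)
  have i1 := integrable_smooth_mul (hcw w) (hcs w) (h.integrable_exc v)
  have i2 := integrable_smooth_mul (hcw v) (hcs v) (h.integrable_inner w)
  have i3 := integrable_smooth_mul (hcw w) (hcs w) (h.integrable_inner v)
  have hsplit : ∫ y, fderiv ℝ ψ (r⁻¹ • (y - x)) w ∂μ =
      ∫ y, (fderiv ℝ ψ (r⁻¹ • (y - x)) w * (1 - inner ℝ (ν y) v) +
        fderiv ℝ ψ (r⁻¹ • (y - x)) v * inner ℝ (ν y) w) ∂μ := by
    rw [integral_add i1 i2, ← hid, ← integral_add i1 i3]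
    congr 1; ext y; ring
  have hbound : |∫ y, fderiv ℝ ψ (r⁻¹ • (y - x)) w ∂μ| ≤
      ∫ y in ball x (r * ρ), (B * ‖w‖ * δ + B * ‖w‖ * (1 + δ⁻¹) * (1 - inner ℝ (ν y) v)) ∂μ := by
    rw [hsplit, ← integral_indicator measurableSet_ball, ← Real.norm_eq_abs]
    refine norm_integral_le_of_norm_le (Integrable.indicator ?_ (measurableSet_ball (x := x) (ε := r * ρ))) ?_
    · exact (integrable_const _).add ((h.integrable_exc v).const_mul _)
    · filter_upwards [h.unit, h.exc_nonneg hp.norm_v] with y hy hey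
      by_cases hyb : y ∈ ball x (r * ρ)
      · rw [indicator_of_mem hyb]
        have hb1 := hbd (r⁻¹ • (y - x)) w
        have hb2 := hbd (r⁻¹ • (y - x)) v
        rw [hp.norm_v, mul_one] at hb2
        have hin := inner_bd hy hp.norm_v hw hδ
        calc ‖_‖ ≤ |fderiv ℝ ψ (r⁻¹ • (y - x)) w| * (1 - inner ℝ (ν y) v) +
              |fderiv ℝ ψ (r⁻¹ • (y - x)) v| * |inner ℝ (ν y) w| := by
              refine (norm_add_le _ _).trans ?_
              rw [Real.norm_eq_abs, Real.norm_eq_abs, abs_mul, abs_mul, abs_of_nonneg hey]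
          _ ≤ B * ‖w‖ * (1 - inner ℝ (ν y) v) + B * (‖w‖ * (δ + δ⁻¹ * (1 - inner ℝ (ν y) v))) := by
              gcongr
          _ = _ := by ring
      · rw [indicator_of_notMem hyb, fderiv_out hs w _ (scale_notMem hr hyb),
          fderiv_out hs v _ (scale_notMem hr hyb)]
        simp
  rw [integral_add (integrable_const _).integrableOn (((h.integrable_exc v).const_mul _).integrableOn),
    integral_const_mul (B * ‖w‖ * (1 + δ⁻¹)), setIntegral_const, smul_eq_mul] at hbound
  have hfin : |∫ y, fderiv ℝ ψ (r⁻¹ • (y - x)) w ∂μ| ≤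
      B * ‖w‖ * (3 * δ) * (C * ρ ^ (n-1)) * r ^ (n-1) := by
    refine hbound.trans ?_
    have he : (1 + δ⁻¹) * ε ≤ 2 * δ := by
      have a1 : ε ≤ δ := min_le_left _ _
      have a2 : δ⁻¹ * ε ≤ δ := by
        rw [inv_mul_le_iff₀ hδ]; exact (min_le_right _ _).trans (by rw [sq])
      linarith
    have hm0 : 0 ≤ μ.real (ball x (r * ρ)) := measureReal_nonneg
    calc _ ≤ μ.real (ball x (r * ρ)) * (B * ‖w‖ * δ) +
          B * ‖w‖ * (1 + δ⁻¹) * (ε * μ.real (ball x (r * ρ))) := by gcongr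
      _ = B * ‖w‖ * (δ + (1 + δ⁻¹) * ε) * μ.real (ball x (r * ρ)) := by ring
      _ ≤ B * ‖w‖ * (δ + 2 * δ) * (C * (r * ρ) ^ (n-1)) := by gcongr
      _ = _ := by rw [mul_pow]; ring
  have hrn : 0 < r ^ (n-1) := by positivity
  rw [dist_zero_right, norm_div, Real.norm_eq_abs, Real.norm_of_nonneg hrn.le, div_lt_iff₀ hrn]
  exact hfin.trans_lt (by gcongr)
end

section
variable {n : ℕ} {μ σ : Measure (EV n)} 

lemma integrable_scaled [IsFiniteMeasure σ] {ψ : EV n → ℝ} (hψ : ContDiff ℝ (⊤ : ℕ∞) ψ) (hc : HasCompactSupport ψ)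
    (x w : EV n) {r : ℝ} (hr : 0 < r) : Integrable (fun y => fderiv ℝ ψ (r⁻¹ • (y - x)) w) σ := by
  obtain ⟨ρ, hρ, hs⟩ := exists_supp_ball hc
  have hcontf : Continuous (fderiv ℝ ψ) := hψ.continuous_fderiv (by simp)
  refine Continuous.integrable_of_hasCompactSupport (by fun_prop)
    (scale_hasCompactSupport hr x (fderiv_out hs w))

lemma AInv.add [IsFiniteMeasure σ] {x w1 w2 : EV n} (h1 : AInv σ x w1) (h2 : AInv σ x w2) :
    AInv σ x (w1 + w2) := by
  intro ψ hψ hc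
  have := (h1 ψ hψ hc).add (h2 ψ hψ hc)
  rw [add_zero] at this
  refine this.congr' ?_
  filter_upwards [self_mem_nhdsWithin] with r hr
  simp only [mem_Ioi] at hr
  rw [← add_div, ← integral_add (integrable_scaled hψ hc x w1 hr) (integrable_scaled hψ hc x w2 hr)]
  simp only [map_add]

lemma exists_decomp {v1 v2 : EV n} (h1 : ‖v1‖ = 1) (h2 : ‖v2‖ = 1) (hne : v1 ≠ v2) (hne' : v1 ≠ -v2)
    (w : EV n) : ∃ w1 w2, w = w1 + w2 ∧ inner ℝ v1 w1 = 0 ∧ inner ℝ v2 w2 = 0 := by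
  set c : ℝ := inner ℝ v1 v2 with hc
  have hc1 : c ≠ 1 := fun h => hne ((inner_eq_one_iff_of_norm_eq_one h1 h2).1 h)
  have hc2 : c ≠ -1 := fun h => hne' ((inner_eq_one_iff_of_norm_eq_one (𝕜 := ℝ) h1 (by rwa [norm_neg])).1
    (by rw [inner_neg_right, ← hc, h, neg_neg]))
  have hd : 1 - c ^ 2 ≠ 0 := by
    intro h
    have : (1 - c) * (1 + c) = 0 := by linarith [h]
    rcases mul_eq_zero.1 this with h | h
    · exact hc1 (by linarith)
    · exact hc2 (by linarith)
  have e1 : inner ℝ v1 v1 = (1:ℝ) := by rw [real_inner_self_eq_norm_sq, h1]; norm_num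
  have e2 : inner ℝ v2 v2 = (1:ℝ) := by rw [real_inner_self_eq_norm_sq, h2]; norm_num
  set u := v1 - c • v2 with hu
  set t : ℝ := inner ℝ v1 w / (1 - c ^ 2) with ht
  refine ⟨w - t • u, t • u, by abel, ?_, ?_⟩
  · rw [inner_sub_right, inner_smul_right, hu, inner_sub_right, inner_smul_right, e1, ← hc, ht]
    field_simp
    ring
  · rw [inner_smul_right, hu, inner_sub_right, inner_smul_right, e2, real_inner_comm, ← hc]
    ring

lemma AInv.transfer [IsFiniteMeasure σ] {f : EV n → ℝ} (hf : Integrable f σ)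
    (hμ : ∀ g : EV n → ℝ, ∫ y, g y ∂μ = ∫ y, f y * g y ∂σ) {x w : EV n} {a C : ℝ} (ha : a ≠ 0)
    (hleb : ∀ ε > 0, ∀ᶠ r in 𝓝[>] (0:ℝ), ∫ y in closedBall x r, |f y - a| ∂σ ≤ ε * σ.real (closedBall x r))
    (hup : ∀ᶠ r in 𝓝[>] (0:ℝ), σ.real (closedBall x r) ≤ C * r ^ (n-1))
    (h : AInv μ x w) : AInv σ x w := by
  intro ψ hψ hc
  obtain ⟨ρ, hρ, hs⟩ := exists_supp_ball hc
  have hcontf : Continuous (fderiv ℝ ψ) := hψ.continuous_fderiv (by simp)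
  obtain ⟨B, hB⟩ := hcontf.bounded_above_of_compact_support (hc.fderiv (𝕜 := ℝ))
  have hB0 : 0 ≤ B := (norm_nonneg _).trans (hB 0)
  have hbd : ∀ z w, |fderiv ℝ ψ z w| ≤ B * ‖w‖ := fun z w =>
    ((fderiv ℝ ψ z).le_opNorm w).trans (by gcongr; exact hB z)
  have herr : Tendsto (fun r : ℝ => (∫ y, (f y - a) * fderiv ℝ ψ (r⁻¹ • (y - x)) w ∂σ) / r ^ (n-1))
      (𝓝[>] 0) (𝓝 0) := by
    rw [Metric.tendsto_nhds]
    intro η hη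
    set K := B * ‖w‖ * (|C| * ρ ^ (n-1)) with hK
    have hK0 : 0 ≤ K := by positivity
    set ε := η / (K + 1) with hε
    have hε0 : 0 < ε := by positivity
    have hKη : K * ε < η := by
      rw [hε, ← mul_div_assoc, div_lt_iff₀ (by positivity)]; nlinarith
    filter_upwards [(tendsto_scale hρ).eventually (hleb ε hε0), self_mem_nhdsWithin,
      (tendsto_scale hρ).eventually hup] with r hl hr hup
    simp only [mem_Ioi] at hr
    have hbound : ‖∫ y, (f y - a) * fderiv ℝ ψ (r⁻¹ • (y - x)) w ∂σ‖ ≤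
        ∫ y in closedBall x (r * ρ), B * ‖w‖ * |f y - a| ∂σ := by
      rw [← integral_indicator measurableSet_closedBall]
      refine norm_integral_le_of_norm_le (Integrable.indicator ?_ (measurableSet_closedBall (x := x) (ε := r * ρ))) ?_
      · exact ((hf.sub (integrable_const a)).abs.const_mul _)
      · refine Eventually.of_forall fun y => ?_
        by_cases hyb : y ∈ closedBall x (r * ρ)
        · rw [indicator_of_mem hyb, norm_mul, mul_comm, Real.norm_eq_abs, Real.norm_eq_abs]
          gcongr
          exact hbd _ _
        · rw [indicator_of_notMem hyb, fderiv_out hs w _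
            (scale_notMem hr fun hh => hyb (ball_subset_closedBall hh))]
          simp
    rw [integral_const_mul] at hbound
    have hrn : 0 < r ^ (n-1) := by positivity
    rw [dist_zero_right, norm_div, Real.norm_of_nonneg hrn.le, div_lt_iff₀ hrn]
    have hup' : σ.real (closedBall x (r * ρ)) ≤ |C| * (r * ρ) ^ (n-1) :=
      hup.trans (by gcongr; exact le_abs_self C)
    calc _ ≤ _ := hbound
      _ ≤ B * ‖w‖ * (ε * (|C| * (r * ρ) ^ (n-1))) := by
          gcongr
          exact hl.trans (by gcongr)
      _ = K * ε * r ^ (n-1) := by rw [mul_pow, hK]; ring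
      _ < η * r ^ (n-1) := by gcongr
  have := ((h ψ hψ hc).sub herr).const_mul a⁻¹
  rw [sub_zero, mul_zero] at this
  refine this.congr' ?_
  filter_upwards [self_mem_nhdsWithin] with r hr
  simp only [mem_Ioi] at hr
  have hg := integrable_scaled (σ := σ) hψ hc x w hr
  have hfg : Integrable (fun y => f y * fderiv ℝ ψ (r⁻¹ • (y - x)) w) σ := by
    have := integrable_smooth_mul (φ := fun y => fderiv ℝ ψ (r⁻¹ • (y - x)) w) (by fun_prop)
      (scale_hasCompactSupport hr x (fderiv_out hs w)) hf
    simpa only [mul_comm] using this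
  have hfa : Integrable (fun y => (f y - a) * fderiv ℝ ψ (r⁻¹ • (y - x)) w) σ := by
    simp only [sub_mul]
    exact hfg.sub (hg.const_mul a)
  rw [hμ, ← sub_div, ← integral_sub hfg hfa]
  have : ∀ y, f y * fderiv ℝ ψ (r⁻¹ • (y - x)) w - (f y - a) * fderiv ℝ ψ (r⁻¹ • (y - x)) w
    = a * fderiv ℝ ψ (r⁻¹ • (y - x)) w := fun y => by ring
  simp only [this]
  rw [integral_const_mul]
  field_simp

set_option maxHeartbeats 1000000 in
lemma no_inv [IsFiniteMeasure σ] (hn : 1 ≤ n) {x : EV n} (h : ∀ w, AInv σ x w) {c : ℝ} (hc : 0 < c)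
    (hlow : ∀ᶠ r in 𝓝[>] (0:ℝ), c * r ^ (n-1) ≤ σ.real (ball x r)) : False := by
  obtain ⟨η, hη, hcη, h0, h1, hone, hts, -⟩ := cutoff (0 : EV n) one_pos one_lt_two
  have hηd : Differentiable ℝ η := hη.differentiable (by simp)
  have hcontf : Continuous (fderiv ℝ η) := hη.continuous_fderiv (by simp)
  set k : EV n → ℝ := fun z => fderiv ℝ η z z with hk
  have hkc : Continuous k := by fun_prop
  have hkz : ∀ z, z ∉ ball (0 : EV n) 2 → k z = 0 := fun z hz => fderiv_out hts z z hz
  have hηz : ∀ z, z ∉ ball (0 : EV n) 2 → η z = 0 := fun z hz =>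
    image_eq_zero_of_notMem_tsupport fun hh => hz (hts hh)
  have hkcs : HasCompactSupport k := by
    have := scale_hasCompactSupport (x := (0 : EV n)) (r := 1) one_pos hkz
    simpa using this
  obtain ⟨B, hB⟩ := hkc.bounded_above_of_compact_support hkcs
  have hB0 : 0 ≤ B := (norm_nonneg _).trans (hB 0)
  set G : ℝ → ℝ := fun r => ∫ y, η (r⁻¹ • (y - x)) ∂σ with hG
  set D : ℝ → ℝ := fun r => ∫ y, k (r⁻¹ • (y - x)) ∂σ with hD
  have iη : ∀ r : ℝ, 0 < r → Integrable (fun y => η (r⁻¹ • (y - x))) σ := fun r hr =>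
    Continuous.integrable_of_hasCompactSupport (by have := hη.continuous; fun_prop)
      (scale_hasCompactSupport hr x hηz)
  have ik : ∀ r : ℝ, 0 < r → Integrable (fun y => k (r⁻¹ • (y - x))) σ := fun r hr =>
    Continuous.integrable_of_hasCompactSupport (by fun_prop)
      (scale_hasCompactSupport hr x hkz)
  -- derivative
  have hder : ∀ r : ℝ, 0 < r → HasDerivAt G (-(r⁻¹) * D r) r := by
    intro r hr
    have hpt : ∀ (y : EV n) (s : ℝ), 0 < s →
        HasDerivAt (fun s : ℝ => η (s⁻¹ • (y - x))) (-(s⁻¹) * k (s⁻¹ • (y - x))) s := by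
      intro y s hs
      have e1 : HasDerivAt (fun s : ℝ => s⁻¹ • (y - x)) ((-(s ^ 2)⁻¹) • (y - x)) s :=
        (hasDerivAt_inv hs.ne').smul_const (y - x)
      have e2 := (hηd (s⁻¹ • (y - x))).hasFDerivAt.comp_hasDerivAt s e1
      have e3 : -(s⁻¹) * k (s⁻¹ • (y - x)) = fderiv ℝ η (s⁻¹ • (y - x)) (-(s ^ 2)⁻¹ • (y - x)) := by
        simp only [hk, map_smul, smul_eq_mul]
        field_simp
      rw [e3]
      exact e2
    have := hasDerivAt_integral_of_dominated_loc_of_deriv_le (μ := σ) (x₀ := r)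
      (F := fun s y => η (s⁻¹ • (y - x))) (F' := fun s y => -(s⁻¹) * k (s⁻¹ • (y - x)))
      (bound := fun _ => (r/2)⁻¹ * B) (s := Ioi (r/2)) (Ioi_mem_nhds (by linarith))
      (Eventually.of_forall fun s => (by
        have := hη.continuous
        exact Continuous.aestronglyMeasurable (by fun_prop)))
      (iη r hr) ((ik r hr).const_mul _).aestronglyMeasurable
      (Eventually.of_forall fun y s hs => (by
        simp only [mem_Ioi] at hs
        have hs0 : 0 < s := by linarith
        rw [norm_mul, norm_neg, norm_inv, Real.norm_of_nonneg hs0.le]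
        gcongr
        exact hB _))
      (integrable_const _)
      (Eventually.of_forall fun y s hs => hpt y s (by simp only [mem_Ioi] at hs; linarith))
    have h2 := this.2
    rw [integral_const_mul] at h2
    exact h2
  -- limit
  have hlim : Tendsto (fun r : ℝ => (n * G r + D r) / r ^ (n-1)) (𝓝[>] 0) (𝓝 0) := by
    set ψ : Fin n → EV n → ℝ := fun i z => z i * η z with hψ
    have hproj : ∀ i : Fin n, ContDiff ℝ (⊤ : ℕ∞) (fun z : EV n => z i) := by
      intro i
      exact (EuclideanSpace.proj i : EV n →L[ℝ] ℝ).contDiff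
    have hsm : ∀ i, ContDiff ℝ (⊤ : ℕ∞) (ψ i) := fun i => (hproj i).mul hη
    have hcs : ∀ i, HasCompactSupport (ψ i) := fun i => hcη.mul_left
    have hsum := tendsto_finsetSum (Finset.univ : Finset (Fin n)) fun i _ =>
      h (EuclideanSpace.single i 1) (ψ i) (hsm i) (hcs i)
    rw [Finset.sum_const_zero] at hsum
    refine hsum.congr' ?_
    filter_upwards [self_mem_nhdsWithin] with r hr
    simp only [mem_Ioi] at hr
    rw [← Finset.sum_div, ← integral_finsetSum _ (fun i _ => integrable_scaled (hsm i) (hcs i) x _ hr)]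
    congr 1
    have hdiv : ∀ z : EV n, ∑ i, fderiv ℝ (ψ i) z (EuclideanSpace.single i 1) = n * η z + k z := by
      intro z
      have hi : ∀ i, fderiv ℝ (ψ i) z (EuclideanSpace.single i 1) =
          η z + fderiv ℝ η z (z i • EuclideanSpace.single i (1:ℝ)) := by
        intro i
        have e1 : HasFDerivAt (fun z : EV n => z i)
          (EuclideanSpace.proj i : EV n →L[ℝ] ℝ) z :=
          (EuclideanSpace.proj i : EV n →L[ℝ] ℝ).hasFDerivAt
        have e2 := (e1.mul (hηd z).hasFDerivAt).fderiv
        have e3 : fderiv ℝ (ψ i) z = _ := e2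
        rw [e3]
        simp
        ring
      simp only [hi]
      rw [Finset.sum_add_distrib, ← map_sum]
      have hz : ∑ i, z i • EuclideanSpace.single i (1:ℝ) = z := by
        have := (EuclideanSpace.basisFun (Fin n) ℝ).sum_repr z
        simpa using this
      rw [hz]
      simp [hk]
    simp only [hdiv]
    rw [integral_add ((iη r hr).const_mul _) (ik r hr), integral_const_mul]
  -- contradiction
  have hlim' := hlim.eventually (Ioo_mem_nhds (show -(c/2) < 0 by linarith) (show (0:ℝ) < c/2 by linarith))
  obtain ⟨r0, hr0, hsub⟩ := mem_nhdsGT_iff_exists_Ioo_subset.1 hlim'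
  simp only [mem_Ioi] at hr0
  set Kf : ℝ → ℝ := fun r => G r / r ^ n - (c/2) / r with hKf
  have hKd : ∀ r : ℝ, 0 < r → HasDerivAt Kf ((-(r⁻¹) * D r * r ^ n - G r * (n * r ^ (n-1))) / (r ^ n) ^ 2
      + (c/2) / r ^ 2) r := by
    intro r hr
    have e1 := (hder r hr).div (hasDerivAt_pow n r) (by positivity)
    have e2 := (hasDerivAt_inv hr.ne').const_mul (c/2)
    have e3 := e1.sub e2
    have e4 : Kf = (G / fun x => x ^ n) - fun y => c / 2 * y⁻¹ := by
      ext r; simp only [hKf, Pi.sub_apply, Pi.div_apply]; rw [div_eq_mul_inv (c/2) r]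
    rw [e4]
    refine e3.congr_deriv ?_
    rw [div_eq_mul_inv (c/2) (r^2)]
    ring
  have hmono : MonotoneOn Kf (Ioo 0 r0) := by
    apply monotoneOn_of_deriv_nonneg (convex_Ioo 0 r0)
    · intro r hr
      exact (hKd r hr.1).continuousAt.continuousWithinAt
    · intro r hr
      rw [interior_Ioo] at hr
      exact (hKd r hr.1).differentiableAt.differentiableWithinAt
    · intro r hr
      rw [interior_Ioo] at hr
      have hr' : 0 < r := hr.1
      rw [(hKd r hr').deriv]
      have hh := (hsub hr).2
      have hrn : r ^ n = r ^ (n-1) * r := by rw [← pow_succ]; congr 1; omega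
      have : (-(r⁻¹) * D r * r ^ n - G r * (n * r ^ (n-1))) / (r ^ n) ^ 2 + (c/2) / r ^ 2
        = (c/2 - (n * G r + D r) / r ^ (n-1)) / r ^ 2 := by
        rw [hrn]; field_simp; ring
      rw [this]
      apply div_nonneg _ (by positivity)
      linarith
  have hr1 : r0 / 2 ∈ Ioo 0 r0 := ⟨by linarith, by linarith⟩
  have hs0 : Tendsto (fun s : ℝ => s * Kf (r0/2)) (𝓝[>] 0) (𝓝 0) := by
    have : Tendsto (fun s : ℝ => s * Kf (r0/2)) (𝓝 0) (𝓝 (0 * Kf (r0/2))) := tendsto_id.mul_const _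
    rw [zero_mul] at this
    exact this.mono_left nhdsWithin_le_nhds
  have hev := (hs0.eventually (gt_mem_nhds (show (0:ℝ) < c/2 by linarith))).and
    (hlow.and (Ioo_mem_nhdsGT hr1.1))
  obtain ⟨s, hs1, hs2, hs3⟩ := hev.exists
  have hs : 0 < s := hs3.1
  have hm := hmono ⟨hs, hs3.2.trans hr1.2⟩ hr1 hs3.2.le
  have hGl : c * s ^ (n-1) ≤ G s := by
    refine hs2.trans ?_
    rw [← integral_indicator_one measurableSet_ball]
    refine integral_mono ((integrable_const 1).indicator measurableSet_ball) (iη s hs) ?_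
    intro y
    by_cases hy : y ∈ ball x s
    · rw [indicator_of_mem hy]
      simp only [Pi.one_apply]
      rw [hone]
      rw [mem_ball_zero_iff, norm_smul, norm_inv, Real.norm_of_nonneg hs.le, inv_mul_lt_iff₀ hs, mul_one]
      rwa [mem_ball, dist_eq_norm] at hy
    · rw [indicator_of_notMem hy]; exact h0 _
  have hsn : s ^ n = s ^ (n-1) * s := by rw [← pow_succ]; congr 1; omega
  have : c ≤ s * Kf s + c/2 := by
    have e : s * Kf s + c / 2 = G s / s ^ (n-1) := by
      simp only [hKf]; rw [hsn]; field_simp; ring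
    rw [e, le_div_iff₀ (by positivity)]
    exact hGl
  have h5 : s * Kf s ≤ s * Kf (r0/2) := by gcongr
  linarith
end

section
variable {n : ℕ} {σ : Measure (EV n)}

lemma haus_null_unif [IsFiniteMeasure σ] (hn : 1 ≤ n) {A : Set (EV n)} (hA : σ A = 0) {c δ : ℝ}
    (hc : 0 < c) (hδ : 0 < δ)
    (hlow : ∀ x ∈ A, ∀ r : ℝ, 0 < r → r < δ → c * r ^ (n-1) ≤ σ.real (ball x r)) :
    μH[(n : ℝ) - 1] A = 0 := by
  have hd : (n : ℝ) - 1 = ((n - 1 : ℕ) : ℝ) := by rw [Nat.cast_sub hn]; simp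
  have key : ∀ m : ℕ, ∃ (t : Set (EV n)) (r : EV n → ℝ), t.Countable ∧ t ⊆ A ∧
      (∀ x ∈ t, r x ∈ Ioo 0 (min (1 / ((m:ℝ) + 1)) δ)) ∧
      (A ⊆ ⋃ x ∈ t, closedBall x (r x)) ∧
      (∑' x : t, σ (closedBall x (r x))) ≤ σ A + ENNReal.ofReal (1 / ((m:ℝ)+1)) := by
    intro m
    have hm : (0:ℝ) < 1 / ((m:ℝ) + 1) := by positivity
    refine Besicovitch.exists_closedBall_covering_tsum_measure_le σ ?_
      (fun _ => Ioo 0 (min (1 / ((m:ℝ) + 1)) δ)) A ?_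
    · simpa using hm
    · intro x _ η hη
      rw [Ioo_inter_Ioo]
      simp only [nonempty_Ioo, sup_idem]
      exact lt_min (lt_min hm hδ) hη
  choose t r htc htA hr hcov hsum using key
  have hcount : ∀ m, Countable (t m) := fun m => (htc m).to_subtype
  have hM := Measure.hausdorffMeasure_le_liminf_tsum (X := EV n) (ι := fun m => t m) ((n:ℝ) - 1) A (l := atTop)
    (fun m : ℕ => ENNReal.ofReal (2 * (1 / ((m:ℝ)+1)))) ?_
    (fun m i => closedBall (i : EV n) (r m i)) ?_ ?_
  · refine le_antisymm (hM.trans ?_) bot_le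
    have hlim : Tendsto (fun m : ℕ => ENNReal.ofReal (2 ^ (n-1) * c⁻¹ * (1 / ((m:ℝ)+1)))) atTop (𝓝 0) := by
      have := (tendsto_one_div_add_atTop_nhds_zero_nat (𝕜 := ℝ)).const_mul (2 ^ (n-1) * c⁻¹)
      rw [mul_zero] at this
      simpa using ENNReal.tendsto_ofReal this
    rw [← hlim.liminf_eq]
    refine liminf_le_liminf (Eventually.of_forall fun m => ?_)
    have h1 : ∀ i : t m, ediam (closedBall (i : EV n) (r m i)) ^ ((n:ℝ)-1) ≤
        ENNReal.ofReal (2 ^ (n-1) * c⁻¹) * σ (closedBall (i : EV n) (r m i)) := by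
      intro i
      have hri := hr m i i.2
      have hr0 : 0 < r m i := hri.1
      have hr1 : r m i < δ := lt_of_lt_of_le hri.2 (min_le_right _ _)
      have hl := hlow i (htA m i.2) _ hr0 hr1
      have hle : σ.real (ball (i : EV n) (r m i)) ≤ σ.real (closedBall (i : EV n) (r m i)) :=
        measureReal_mono ball_subset_closedBall
      have h2 : (2 * r m i) ^ (n-1) ≤ 2 ^ (n-1) * c⁻¹ * σ.real (closedBall (i : EV n) (r m i)) := by
        have h3 : (r m i) ^ (n-1) ≤ c⁻¹ * σ.real (closedBall (i : EV n) (r m i)) := by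
          rw [inv_mul_eq_div, le_div_iff₀ hc]; linarith
        rw [mul_pow, mul_assoc]
        gcongr
      calc ediam (closedBall (i : EV n) (r m i)) ^ ((n:ℝ)-1)
          ≤ (ENNReal.ofReal (2 * r m i)) ^ ((n:ℝ)-1) := by
            refine ENNReal.rpow_le_rpow ?_ (by rw [hd]; positivity)
            rw [← Metric.closedEBall_ofReal hr0.le, ENNReal.ofReal_mul (by norm_num)]
            simpa using ediam_closedEBall_le (x := (i : EV n)) (r := ENNReal.ofReal (r m i))
        _ = ENNReal.ofReal ((2 * r m i) ^ (n-1)) := by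
            rw [hd, ENNReal.rpow_natCast, ENNReal.ofReal_pow (by positivity)]
        _ ≤ ENNReal.ofReal (2 ^ (n-1) * c⁻¹ * σ.real (closedBall (i : EV n) (r m i))) :=
            ENNReal.ofReal_le_ofReal h2
        _ = _ := by
            rw [ENNReal.ofReal_mul (by positivity), ofReal_measureReal]
    calc ∑' i : t m, ediam (closedBall (i : EV n) (r m i)) ^ ((n:ℝ)-1)
        ≤ ∑' i : t m, ENNReal.ofReal (2 ^ (n-1) * c⁻¹) * σ (closedBall (i : EV n) (r m i)) :=
          ENNReal.tsum_le_tsum h1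
      _ = ENNReal.ofReal (2 ^ (n-1) * c⁻¹) * ∑' i : t m, σ (closedBall (i : EV n) (r m i)) :=
          ENNReal.tsum_mul_left
      _ ≤ ENNReal.ofReal (2 ^ (n-1) * c⁻¹) * ENNReal.ofReal (1 / ((m:ℝ)+1)) := by
          have := hsum m
          rw [hA, zero_add] at this
          gcongr
      _ = _ := (ENNReal.ofReal_mul (by positivity)).symm
  · have := (tendsto_one_div_add_atTop_nhds_zero_nat (𝕜 := ℝ)).const_mul 2
    rw [mul_zero] at this
    simpa using ENNReal.tendsto_ofReal this
  · refine Eventually.of_forall fun m i => ?_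
    have hri := hr m i i.2
    rw [← Metric.closedEBall_ofReal hri.1.le, ENNReal.ofReal_mul (by norm_num)]
    refine ediam_closedEBall_le.trans ?_
    have : r m i ≤ 1 / ((m:ℝ)+1) := hri.2.le.trans (min_le_left _ _)
    have h2 : ENNReal.ofReal 2 = 2 := by simp
    rw [h2]
    gcongr
  · refine Eventually.of_forall fun m => ?_
    have := hcov m
    rwa [biUnion_eq_iUnion] at this

lemma haus_null [IsFiniteMeasure σ] (hn : 1 ≤ n) {A : Set (EV n)} (hA : σ A = 0)
    (hlow : ∀ x ∈ A, ∃ c : ℝ, 0 < c ∧ ∀ᶠ r in 𝓝[>] (0:ℝ), c * r ^ (n-1) ≤ σ.real (ball x r)) :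
    μH[(n : ℝ) - 1] A = 0 := by
  have hsub : A ⊆ ⋃ k : ℕ, {x ∈ A | ∀ r : ℝ, 0 < r → r < 1 / ((k:ℝ)+1) →
      (1 / ((k:ℝ)+1)) * r ^ (n-1) ≤ σ.real (ball x r)} := by
    intro x hx
    obtain ⟨c, hc, he⟩ := hlow x hx
    obtain ⟨δ, hδ, hb⟩ := mem_nhdsGT_iff_exists_Ioo_subset.1 he
    simp only [mem_Ioi] at hδ
    obtain ⟨k, hk⟩ := exists_nat_one_div_lt (lt_min hc hδ)
    refine mem_iUnion.2 ⟨k, hx, fun r h0 h1 => ?_⟩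
    have h2 := hb (show r ∈ Ioo 0 δ from ⟨h0, h1.trans (hk.trans_le (min_le_right _ _))⟩)
    have h3 : 1 / ((k:ℝ)+1) ≤ c := hk.le.trans (min_le_left _ _)
    exact le_trans (by gcongr) h2
  refine measure_mono_null hsub (measure_iUnion_null fun k => ?_)
  exact haus_null_unif (σ := σ) hn (measure_mono_null (fun x hx => hx.1) hA) (c := 1 / ((k:ℝ)+1))
    (δ := 1 / ((k:ℝ)+1)) (by positivity) (by positivity) fun x hx => hx.2
end

section
variable {n : ℕ} {U E F : Set (EV n)} {μ μ' σ : Measure (EV n)} {ν ν' : EV n → EV n}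

lemma leb_ae [IsFiniteMeasure σ] {f : EV n → ℝ} (hf : Integrable f σ) :
    ∀ᵐ x ∂σ, ∀ ε > 0, ∀ᶠ r in 𝓝[>] (0:ℝ),
      ∫ y in closedBall x r, |f y - f x| ∂σ ≤ ε * σ.real (closedBall x r) := by
  filter_upwards [(Besicovitch.vitaliFamily σ).ae_tendsto_average_norm_sub hf.locallyIntegrable] with x hx ε hε
  have h := hx.comp (Besicovitch.tendsto_filterAt σ x)
  filter_upwards [h.eventually (gt_mem_nhds hε)] with r hr
  simp only [Function.comp_apply, setAverage_eq, smul_eq_mul, Real.norm_eq_abs] at hr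
  rcases (measureReal_nonneg (μ := σ) (s := closedBall x r)).eq_or_lt with h0 | h0
  · have : σ (closedBall x r) = 0 := by
      rw [← ofReal_measureReal (μ := σ), ← h0]; simp
    rw [Measure.restrict_eq_zero.2 this, ← h0]; simp
  · rw [inv_mul_lt_iff₀ h0] at hr
    linarith

lemma upper_closed (h : LD U E μ ν) (hn : 1 ≤ n) {x v : EV n} (hx : x ∈ U) (hp : Pt μ ν x v) :
    ∃ C, 0 < C ∧ ∀ᶠ r in 𝓝[>] (0:ℝ), μ.real (closedBall x r) ≤ C * r ^ (n-1) := by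
  have := h.fin
  obtain ⟨C, hC, he⟩ := h.upper hx hp hn
  refine ⟨C * 2 ^ (n-1), by positivity, ?_⟩
  filter_upwards [(tendsto_scale (ρ := 2) (by norm_num)).eventually he, self_mem_nhdsWithin] with r hr hr0
  simp only [mem_Ioi] at hr0
  calc μ.real (closedBall x r) ≤ μ.real (ball x (r * 2)) :=
        measureReal_mono (closedBall_subset_ball (by linarith))
    _ ≤ _ := hr
    _ = _ := by rw [mul_pow]; ring

lemma local_null (hE : MeasurableSet E) (hF : MeasurableSet F) (h : LD U E μ ν) (h' : LD U F μ' ν')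
    (hn : 2 ≤ n) {S : Set (EV n)} (hSU : S ⊆ U)
    (hS : ∀ x ∈ S, ∃ v v', Pt μ ν x v ∧ Pt μ' ν' x v' ∧ v ≠ v' ∧ v ≠ -v') :
    μH[(n : ℝ) - 1] S = 0 := by
  have hf1 := h.fin
  have hf2 := h'.fin
  have hn1 : 1 ≤ n := by omega
  set σ := μ + μ' with hσ
  have hfσ : IsFiniteMeasure σ := by rw [hσ]; infer_instance
  have hd1 : μ.HaveLebesgueDecomposition σ := Measure.haveLebesgueDecomposition_of_sigmaFinite _ _
  have hd2 : μ'.HaveLebesgueDecomposition σ := Measure.haveLebesgueDecomposition_of_sigmaFinite _ _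
  have ac : μ ≪ σ := Measure.absolutelyContinuous_of_le (Measure.le_add_right le_rfl)
  have ac' : μ' ≪ σ := Measure.absolutelyContinuous_of_le (Measure.le_add_left le_rfl)
  set f : EV n → ℝ := fun y => (μ.rnDeriv σ y).toReal with hf
  set f' : EV n → ℝ := fun y => (μ'.rnDeriv σ y).toReal with hf'
  have fint : Integrable f σ := Measure.integrable_toReal_rnDeriv
  have fint' : Integrable f' σ := Measure.integrable_toReal_rnDeriv
  have hμ : ∀ g : EV n → ℝ, ∫ y, g y ∂μ = ∫ y, f y * g y ∂σ := fun g =>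
    (integral_rnDeriv_smul (f := g) ac).symm
  have hμ' : ∀ g : EV n → ℝ, ∫ y, g y ∂μ' = ∫ y, f' y * g y ∂σ := fun g =>
    (integral_rnDeriv_smul (f := g) ac').symm
  have hlow : ∀ x ∈ S, ∃ c : ℝ, 0 < c ∧ ∀ᶠ r in 𝓝[>] (0:ℝ), c * r ^ (n-1) ≤ μ.real (ball x r) := by
    intro x hx
    obtain ⟨v, v', hp, -⟩ := hS x hx
    exact h.lower hE hn (hSU hx) hp
  have hlow' : ∀ x ∈ S, ∃ c : ℝ, 0 < c ∧ ∀ᶠ r in 𝓝[>] (0:ℝ), c * r ^ (n-1) ≤ μ'.real (ball x r) := by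
    intro x hx
    obtain ⟨v, v', -, hp, -⟩ := hS x hx
    exact h'.lower hF hn (hSU hx) hp
  have hlowσ : ∀ x ∈ S, ∃ c : ℝ, 0 < c ∧ ∀ᶠ r in 𝓝[>] (0:ℝ), c * r ^ (n-1) ≤ σ.real (ball x r) := by
    intro x hx
    obtain ⟨c, hc, he⟩ := hlow x hx
    refine ⟨c, hc, ?_⟩
    filter_upwards [he] with r hr
    refine hr.trans ?_
    rw [hσ, measureReal_add_apply]
    linarith [measureReal_nonneg (μ := μ') (s := ball x r)]
  have z1 : μ {x | f x = 0} = 0 := by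
    have h1 : ∀ᵐ x ∂μ, 0 < μ.rnDeriv σ x := Measure.rnDeriv_pos ac
    have h2 : ∀ᵐ x ∂μ, μ.rnDeriv σ x < ∞ := ac.ae_le (Measure.rnDeriv_lt_top μ σ)
    have h3 : ∀ᵐ x ∂μ, ¬ (f x = 0) := by
      filter_upwards [h1, h2] with x a b
      exact (ENNReal.toReal_pos a.ne' b.ne).ne'
    simpa [ae_iff] using h3
  have z2 : μ' {x | f' x = 0} = 0 := by
    have h1 : ∀ᵐ x ∂μ', 0 < μ'.rnDeriv σ x := Measure.rnDeriv_pos ac'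
    have h2 : ∀ᵐ x ∂μ', μ'.rnDeriv σ x < ∞ := ac'.ae_le (Measure.rnDeriv_lt_top μ' σ)
    have h3 : ∀ᵐ x ∂μ', ¬ (f' x = 0) := by
      filter_upwards [h1, h2] with x a b
      exact (ENNReal.toReal_pos a.ne' b.ne).ne'
    simpa [ae_iff] using h3
  have z3 := (leb_ae fint).and (leb_ae fint')
  rw [ae_iff] at z3
  set Z := {x | ¬ ((∀ ε > 0, ∀ᶠ r in 𝓝[>] (0:ℝ),
      ∫ y in closedBall x r, |f y - f x| ∂σ ≤ ε * σ.real (closedBall x r)) ∧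
      (∀ ε > 0, ∀ᶠ r in 𝓝[>] (0:ℝ),
      ∫ y in closedBall x r, |f' y - f' x| ∂σ ≤ ε * σ.real (closedBall x r)))} with hZ
  have n1 : μH[(n : ℝ) - 1] (S ∩ {x | f x = 0}) = 0 :=
    haus_null (σ := μ) hn1 (measure_mono_null inter_subset_right z1) fun x hx => hlow x hx.1
  have n2 : μH[(n : ℝ) - 1] (S ∩ {x | f' x = 0}) = 0 :=
    haus_null (σ := μ') hn1 (measure_mono_null inter_subset_right z2) fun x hx => hlow' x hx.1
  have n3 : μH[(n : ℝ) - 1] (S ∩ Z) = 0 :=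
    haus_null (σ := σ) hn1 (measure_mono_null inter_subset_right z3) fun x hx => hlowσ x hx.1
  refine measure_mono_null ?_ (measure_union_null (measure_union_null n1 n2) n3)
  intro x hx
  by_contra hcon
  simp only [mem_union, mem_inter_iff, hx, true_and, not_or] at hcon
  obtain ⟨⟨c1, c2⟩, c3⟩ := hcon
  have a1 : f x ≠ 0 := c1
  have a2 : f' x ≠ 0 := c2
  have a3 := not_not.1 c3
  obtain ⟨v, v', hp, hp', hne, hne'⟩ := hS x hx
  obtain ⟨C, hC, hu⟩ := upper_closed h hn1 (hSU hx) hp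
  obtain ⟨C', hC', hu'⟩ := upper_closed h' hn1 (hSU hx) hp'
  have hup : ∀ᶠ r in 𝓝[>] (0:ℝ), σ.real (closedBall x r) ≤ (C + C') * r ^ (n-1) := by
    filter_upwards [hu, hu'] with r b1 b2
    rw [hσ, measureReal_add_apply, add_mul]
    linarith
  obtain ⟨c, hc, hl⟩ := hlowσ x hx
  refine no_inv (σ := σ) (x := x) hn1 (fun w => ?_) hc hl
  obtain ⟨w1, w2, rfl, o1, o2⟩ := exists_decomp hp.norm_v hp'.norm_v hne hne' w
  exact AInv.add (AInv.transfer fint hμ a1 a3.1 hup (h.inv hn1 (hSU hx) hp o1))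
    (AInv.transfer fint' hμ' a2 a3.2 hup (h'.inv hn1 (hSU hx) hp' o2))
end

section
variable {m : ℕ} {G : Set (EV m)}

lemma GG.toLD (D : GaussGreenData m G) {U : Set (EV m)} (hU : IsOpen U) (hi : IntegrableOn D.nu U D.mu) :
    LD U G (D.mu.restrict U) D.nu := by
  have hfin := D.finite
  refine ⟨hU, inferInstance, hi.aestronglyMeasurable, ae_restrict_of_ae D.nu_unit, ?_⟩
  intro φ hφ hc hs w
  have hi' : Integrable D.nu (D.mu.restrict U) := hi
  have hcoord : ∀ i, Integrable (fun x => D.nu x i) (D.mu.restrict U) := fun i =>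
    (EuclideanSpace.proj (𝕜 := ℝ) i : EV m →L[ℝ] ℝ).integrable_comp hi'
  obtain ⟨C, hC⟩ := hc.exists_bound_of_continuous hφ.continuous
  have hint : ∀ i, Integrable (fun x => φ x * D.nu x i) (D.mu.restrict U) := fun i =>
    (hcoord i).bdd_mul hφ.continuous.aestronglyMeasurable (Eventually.of_forall hC)
  have hcf : Continuous (fderiv ℝ φ) := hφ.continuous_fderiv (by simp)
  have hintL : ∀ i : Fin m, Integrable (fun x => fderiv ℝ φ x (EuclideanSpace.single i 1))
      (volume.restrict G) := by
    intro i
    refine Integrable.restrict ?_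
    refine Continuous.integrable_of_hasCompactSupport (by fun_prop) ?_
    exact hc.fderiv_apply (𝕜 := ℝ) _
  have hw : w = ∑ i, w i • (EuclideanSpace.single i (1:ℝ) : EV m) := by
    ext j
    simp [Finset.sum_apply, Pi.single_apply]
  have h1 : ∀ x, fderiv ℝ φ x w = ∑ i, w i * fderiv ℝ φ x (EuclideanSpace.single i 1) := by
    intro x
    conv_lhs => rw [hw]
    simp only [map_sum, map_smul, smul_eq_mul]
  have h2 : ∀ x, φ x * inner ℝ (D.nu x) w = ∑ i, w i * (φ x * D.nu x i) := by
    intro x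
    rw [PiLp.inner_apply, Finset.mul_sum]
    refine Finset.sum_congr rfl fun i _ => ?_
    simp
    ring
  simp only [h1, h2]
  rw [integral_finsetSum _ (fun i _ => (hintL i).const_mul _),
    integral_finsetSum _ (fun i _ => (hint i).const_mul _)]
  refine Finset.sum_congr rfl fun i _ => ?_
  rw [integral_const_mul, integral_const_mul, D.parts φ hφ hc i]
  congr 1
  symm
  refine setIntegral_eq_integral_of_forall_compl_eq_zero fun x hx => ?_
  rw [image_eq_zero_of_notMem_tsupport (fun h => hx (hs h)), zero_mul]

lemma GG.toPt (D : GaussGreenData m G) {U : Set (EV m)} (hU : IsOpen U) (hi : IntegrableOn D.nu U D.mu)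
    {x v : EV m} (hx : x ∈ U) (hv : IsUnitNormalAt D x v) : Pt (D.mu.restrict U) D.nu x v := by
  have hfin := D.finite
  obtain ⟨hpos, hnorm, hlim⟩ := hv
  obtain ⟨R, hR, hRU⟩ := Metric.isOpen_iff.1 hU x hx
  refine ⟨hnorm, ?_, ?_⟩
  · intro r hr
    have h1 : ball x (min r R) ⊆ ball x r ∩ U :=
      subset_inter (ball_subset_ball (min_le_left _ _)) ((ball_subset_ball (min_le_right _ _)).trans hRU)
    rw [Measure.restrict_apply measurableSet_ball]
    exact (hpos _ (lt_min hr hR)).trans_le (measure_mono h1)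
  · intro ε hε
    have h1 : Tendsto (fun r : ℝ => inner ℝ (((D.mu (ball x r)).toReal)⁻¹ • ∫ y in ball x r, D.nu y ∂D.mu) v)
        (𝓝[>] 0) (𝓝 (inner ℝ v v)) := hlim.inner tendsto_const_nhds
    rw [real_inner_self_eq_norm_sq, hnorm, one_pow] at h1
    filter_upwards [h1.eventually (lt_mem_nhds (show 1 - ε < 1 by linarith)),
      Ioo_mem_nhdsGT hR] with r hr hr0
    have hsub : ball x r ⊆ U := (ball_subset_ball hr0.2.le).trans hRU
    have hir : IntegrableOn D.nu (ball x r) D.mu := hi.mono_set hsub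
    rw [Measure.restrict_restrict measurableSet_ball, inter_eq_left.2 hsub, measureReal_restrict_apply measurableSet_ball,
      inter_eq_left.2 hsub]
    have hm : 0 < D.mu.real (ball x r) := ENNReal.toReal_pos (hpos r hr0.1).ne' (measure_ne_top _ _)
    have h3 : ∫ y in ball x r, (1 - inner ℝ (D.nu y) v) ∂D.mu
        = D.mu.real (ball x r) - inner ℝ (∫ y in ball x r, D.nu y ∂D.mu) v := by
      rw [integral_sub (integrable_const _) (hir.inner_const v)]
      congr 1
      · simp
      · have h4 := integral_inner (𝕜 := ℝ) hir v
        rw [real_inner_comm, ← h4]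
        exact integral_congr_ae (Eventually.of_forall fun y => real_inner_comm _ _)
    rw [h3]
    rw [real_inner_smul_left] at hr
    change 1 - ε < (D.mu.real (ball x r))⁻¹ * _ at hr
    rw [inv_mul_eq_div, lt_div_iff₀ hm] at hr
    linarith

lemma GG.exists_int (D : GaussGreenData m G) {x v : EV m} (hv : IsUnitNormalAt D x v) :
    ∃ r : ℝ, 0 < r ∧ IntegrableOn D.nu (ball x r) D.mu := by
  obtain ⟨-, hnorm, hlim⟩ := hv
  have hv0 : v ≠ 0 := by rintro rfl; simp at hnorm
  obtain ⟨r, hr, hr0⟩ := ((hlim.eventually_ne hv0).and self_mem_nhdsWithin).exists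
  refine ⟨r, hr0, ?_⟩
  by_contra hcon
  apply hr
  rw [integral_undef hcon, smul_zero]

lemma mtNormal_spec (D : GaussGreenData m G) {x : EV m} (hx : x ∈ reducedBoundary D) :
    IsUnitNormalAt D x (mtNormal D x) := by
  have h : ∃ v, IsUnitNormalAt D x v := hx
  rw [mtNormal, dif_pos h]
  exact h.choose_spec

lemma unit_dim_le_one (hm : m ≤ 1) {v w : EV m} (hv : ‖v‖ = 1) (hw : ‖w‖ = 1) : v = w ∨ v = -w := by
  interval_cases m
  · left; exact Subsingleton.elim _ _
  · rw [EuclideanSpace.norm_eq, Real.sqrt_eq_one] at hv hw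
    simp only [Fin.sum_univ_one, Real.norm_eq_abs, sq_abs] at hv hw
    have : v 0 = w 0 ∨ v 0 = - w 0 := sq_eq_sq_iff_eq_or_eq_neg.1 (hv.trans hw.symm)
    rcases this with h | h
    · left; ext i; fin_cases i; exact h
    · right; ext i; fin_cases i; exact h

lemma main_null {G' : Set (EV m)} (hG : MeasurableSet G) (hG' : MeasurableSet G')
    (D : GaussGreenData m G) (D' : GaussGreenData m G') :
    μH[(m : ℝ) - 1] {x | x ∈ reducedBoundary D ∩ reducedBoundary D' ∧ mtNormal D x ≠ mtNormal D' x ∧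
      mtNormal D x ≠ - mtNormal D' x} = 0 := by
  set S := {x | x ∈ reducedBoundary D ∩ reducedBoundary D' ∧ mtNormal D x ≠ mtNormal D' x ∧
      mtNormal D x ≠ - mtNormal D' x} with hS
  rcases le_or_gt m 1 with hm | hm
  · have : S = ∅ := by
      rw [eq_empty_iff_forall_notMem]
      rintro x ⟨⟨h1, h2⟩, h3, h4⟩
      rcases unit_dim_le_one hm (mtNormal_spec D h1).2.1 (mtNormal_spec D' h2).2.1 with h | h
      · exact h3 h
      · exact h4 h
    rw [this, measure_empty]
  · refine measure_null_of_locally_null S fun x hx => ?_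
    obtain ⟨r, hr, hi⟩ := GG.exists_int D (mtNormal_spec D hx.1.1)
    obtain ⟨r', hr', hi'⟩ := GG.exists_int D' (mtNormal_spec D' hx.1.2)
    set U := ball x (min r r') with hUd
    have hU : IsOpen U := isOpen_ball
    have hiU : IntegrableOn D.nu U D.mu := hi.mono_set (ball_subset_ball (min_le_left _ _))
    have hiU' : IntegrableOn D'.nu U D'.mu := hi'.mono_set (ball_subset_ball (min_le_right _ _))
    refine ⟨S ∩ U, inter_mem_nhdsWithin _ (hU.mem_nhds (mem_ball_self (lt_min hr hr'))), ?_⟩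
    refine local_null hG hG' (GG.toLD D hU hiU) (GG.toLD D' hU hiU') (by omega) inter_subset_right ?_
    rintro y ⟨⟨⟨h1, h2⟩, h3, h4⟩, hy⟩
    exact ⟨_, _, GG.toPt D hU hiU hy (mtNormal_spec D h1), GG.toPt D' hU hiU' hy (mtNormal_spec D' h2), h3, h4⟩
end

/-- For sets `E, F` of finite perimeter, up to an `ℋ^{n-1}`-null set,
`∂*E ∩ ∂*F = {ν_E = ν_F} ∪ {ν_E = -ν_F}`. -/
theorem stmt8 {F : Set (EuclideanSpace ℝ (Fin n))}
    (hE : MeasurableSet E) (hF : MeasurableSet F)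
    (DE : GaussGreenData n E) (DF : GaussGreenData n F) :
    μH[(n : ℝ) - 1] (symmDiff (reducedBoundary DE ∩ reducedBoundary DF)
      ({x ∈ reducedBoundary DE ∩ reducedBoundary DF | mtNormal DE x = mtNormal DF x} ∪
       {x ∈ reducedBoundary DE ∩ reducedBoundary DF | mtNormal DE x = -mtNormal DF x}))
      = 0 := by
  refine measure_mono_null ?_ (main_null hE hF DE DF)
  rintro x (⟨h1, h2⟩ | ⟨h1, h2⟩)
  · refine ⟨h1, fun h => h2 (Or.inl ⟨h1, h⟩), fun h => h2 (Or.inr ⟨h1, h⟩)⟩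
  · rcases h1 with h1 | h1 <;> exact absurd h1.1 h2
end
end

section
/- Let E, F ⊆ ℝⁿ be disjoint sets of finite perimeter. Then, up to an ℋⁿ⁻¹-null set, ∂*E ∩ ∂*F = {x ∈ ∂*E ∩ ∂*F : ν_E(x) = -ν_F(x)}: the measure-theoretic unit normals are opposite at ℋⁿ⁻¹-almost every common reduced-boundary point. -/
open MeasureTheory Metric Filter Set
open scoped Topology ENNReal NNReal

noncomputable section
open scoped Classical

variable {n : ℕ} {E : Set (EuclideanSpace ℝ (Fin n))}

lemma gg_deriv (ψ : EuclideanSpace ℝ (Fin n) → ℝ)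
    (hψ : ContDiff ℝ (⊤ : ℕ∞) ψ) (hc : HasCompactSupport ψ)
    (h : EuclideanSpace ℝ (Fin n)) (t : ℝ) :
    HasDerivAt (fun t : ℝ => ∫ x in E, ψ (x - t • h) ∂volume)
      (∫ x in E, -(fderiv ℝ ψ (x - t • h) h) ∂volume) t := by
  have hdiff : Differentiable ℝ ψ := hψ.differentiable (by simp)
  have hcd : Continuous (fderiv ℝ ψ) := hψ.continuous_fderiv (by simp)
  have hcs : HasCompactSupport (fderiv ℝ ψ) := hc.fderiv ℝ
  obtain ⟨C, hC⟩ := hcs.exists_bound_of_continuous hcd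
  obtain ⟨M, hM⟩ := hcs.isCompact.isBounded.subset_closedBall (0 : EuclideanSpace ℝ (Fin n))
  have hC0 : 0 ≤ C := (norm_nonneg _).trans (hC 0)
  let B : Set (EuclideanSpace ℝ (Fin n)) := closedBall 0 (M + (|t| + 1) * ‖h‖)
  have := hasDerivAt_integral_of_dominated_loc_of_deriv_le (μ := volume.restrict E)
    (F := fun (t : ℝ) x => ψ (x - t • h))
    (F' := fun (t : ℝ) x => -(fderiv ℝ ψ (x - t • h) h))
    (s := Metric.ball t 1) (x₀ := t)
    (bound := B.indicator (fun _ => C * ‖h‖)) (Metric.ball_mem_nhds t one_pos)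
    ?_ ?_ ?_ ?_ ?_ ?_
  · exact this.2
  · refine Filter.Eventually.of_forall fun s => ?_
    exact (hψ.continuous.comp (by fun_prop)).aestronglyMeasurable
  · apply Integrable.restrict
    have : Integrable ψ volume := hψ.continuous.integrable_of_hasCompactSupport hc
    exact this.comp_sub_right (t • h)
  · apply Continuous.aestronglyMeasurable
    have : Continuous (fun x => fderiv ℝ ψ (x - t • h)) := hcd.comp (by fun_prop)
    fun_prop
  · refine Filter.Eventually.of_forall fun x s hs => ?_
    by_cases hx : x ∈ B
    · rw [indicator_of_mem hx, norm_neg]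
      exact (ContinuousLinearMap.le_opNorm _ _).trans
        (mul_le_mul_of_nonneg_right (hC _) (norm_nonneg _))
    · rw [indicator_of_notMem hx]
      have : fderiv ℝ ψ (x - s • h) = 0 := by
        by_contra hne
        apply hx
        have h1 := hM (subset_tsupport _ (Function.mem_support.2 hne))
        rw [mem_closedBall_zero_iff] at h1
        rw [mem_closedBall_zero_iff]
        have h2 : ‖x‖ ≤ ‖x - s • h‖ + ‖s • h‖ := by
          simpa using norm_add_le (x - s • h) (s • h)
        rw [norm_smul] at h2
        have h3 : ‖s‖ ≤ |t| + 1 := by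
          rw [Metric.mem_ball, Real.dist_eq] at hs
          rw [Real.norm_eq_abs]
          have := abs_sub_abs_le_abs_sub s t
          linarith
        have := mul_le_mul_of_nonneg_right h3 (norm_nonneg h)
        linarith
      simp [this]
  · apply Integrable.restrict
    rw [integrable_indicator_iff measurableSet_closedBall]
    exact integrableOn_const (measure_closedBall_lt_top.ne)
  · refine Filter.Eventually.of_forall fun x s hs => ?_
    have h1 : HasDerivAt (fun s : ℝ => x - s • h) (-h) s := by
      simpa using ((hasDerivAt_id s).smul_const h).const_sub x
    have h2 := (hdiff (x - s • h)).hasFDerivAt.comp_hasDerivAt s h1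
    rw [map_neg] at h2
    exact h2

/-- Localized data. -/
structure LocData (n : ℕ) (E : Set (EuclideanSpace ℝ (Fin n)))
    (μ : Measure (EuclideanSpace ℝ (Fin n)))
    (ν : EuclideanSpace ℝ (Fin n) → EuclideanSpace ℝ (Fin n))
    (x0 v : EuclideanSpace ℝ (Fin n)) (R0 : ℝ) : Prop where
  meas : MeasurableSet E
  fin : IsFiniteMeasure μ
  pos : ∀ r > (0 : ℝ), 0 < μ (ball x0 r)
  unit : ∀ᵐ x ∂μ, ‖ν x‖ = 1
  vunit : ‖v‖ = 1
  R0pos : 0 < R0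
  int : IntegrableOn ν (ball x0 R0) μ
  parts : ∀ φ : EuclideanSpace ℝ (Fin n) → ℝ, ContDiff ℝ (⊤ : ℕ∞) φ →
    tsupport φ ⊆ ball x0 R0 → ∀ u : EuclideanSpace ℝ (Fin n),
    ∫ x in E, fderiv ℝ φ x u ∂volume = ∫ x in ball x0 R0, φ x * inner ℝ (ν x) u ∂μ
  half : ∀ r, 0 < r → r < R0 → μ.real (ball x0 r) ≤ 2 * ∫ x in ball x0 r, inner ℝ (ν x) v ∂μ
  small : ∀ ε > (0 : ℝ), ∃ ρ > 0, ∀ r, 0 < r → r < ρ →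
    ∫ x in ball x0 r, ‖ν x - v‖ ∂μ ≤ ε * μ.real (ball x0 r)

lemma compactSupport_of_ball {φ : EuclideanSpace ℝ (Fin n) → ℝ}
    {x0 : EuclideanSpace ℝ (Fin n)} {R : ℝ} (h : tsupport φ ⊆ ball x0 R) :
    HasCompactSupport φ :=
  (Metric.isBounded_ball.subset h).isCompact_closure.of_isClosed_subset (isClosed_tsupport _)
    subset_closure

lemma loc_smooth {μ : Measure (EuclideanSpace ℝ (Fin n))}
    {ν : EuclideanSpace ℝ (Fin n) → EuclideanSpace ℝ (Fin n)}
    {x0 v : EuclideanSpace ℝ (Fin n)} {R0 : ℝ} (D : LocData n E μ ν x0 v R0)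
    (ψ : EuclideanSpace ℝ (Fin n) → ℝ)
    (hψ : ContDiff ℝ (⊤ : ℕ∞) ψ) (h01 : ∀ x, ψ x ∈ Icc (0 : ℝ) 1)
    {R : ℝ} (h : EuclideanSpace ℝ (Fin n)) (hs : tsupport ψ ⊆ ball x0 R)
    (hR : R + ‖h‖ ≤ R0) :
    ∫ x in E, ψ x ∂volume ≤ ∫ x in E, ψ (x - h) ∂volume
      + ∫ x in ball x0 (R + ‖h‖), max (inner ℝ (ν x) h) 0 ∂μ := by
  have hfin := D.fin
  have hc := compactSupport_of_ball hs
  set G : ℝ → ℝ := fun t => ∫ x in E, ψ (x - t • h) ∂volume with hG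
  have hd : ∀ t, HasDerivAt G (∫ x in E, -(fderiv ℝ ψ (x - t • h) h) ∂volume) t :=
    fun t => gg_deriv ψ hψ hc h t
  obtain ⟨t, ht, hteq⟩ := exists_hasDerivAt_eq_slope G _ (zero_lt_one)
    (fun t _ => (hd t).continuousAt.continuousWithinAt) (fun t _ => hd t)
  have hG1 : G 1 = ∫ x in E, ψ (x - h) ∂volume := by simp [hG]
  have hG0 : G 0 = ∫ x in E, ψ x ∂volume := by simp [hG]
  rw [hG1, hG0] at hteq
  simp only [sub_zero, div_one] at hteq
  rw [integral_neg] at hteq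
  set φ : EuclideanSpace ℝ (Fin n) → ℝ := fun x => ψ (x - t • h) with hφ
  have hφs : ContDiff ℝ (⊤ : ℕ∞) φ := hψ.comp (by fun_prop)
  have hth : ‖t • h‖ ≤ ‖h‖ := by
    rw [norm_smul, Real.norm_eq_abs, abs_of_pos ht.1]
    exact mul_le_of_le_one_left (norm_nonneg _) ht.2.le
  have hts : tsupport φ ⊆ ball x0 (R + ‖h‖) := by
    intro x hx
    have h1 : x - t • h ∈ tsupport ψ := 
      tsupport_comp_subset_preimage ψ (f := fun x => x - t • h) (by fun_prop) hx
    have h2 := hs h1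
    rw [Metric.mem_ball, dist_eq_norm] at h2 ⊢
    have : x - x0 = (x - t • h - x0) + t • h := by abel
    rw [this]
    have := norm_add_le (x - t • h - x0) (t • h)
    linarith
  have hp := D.parts φ hφs (hts.trans (ball_subset_ball hR)) h
  have hfd : ∀ x, fderiv ℝ φ x = fderiv ℝ ψ (x - t • h) := fun x => fderiv_comp_sub _
  simp only [hfd] at hp
  rw [hp] at hteq
  have hint : IntegrableOn (fun x => max (inner ℝ (ν x) h) 0) (ball x0 R0) μ := by
    have : IntegrableOn (fun x => (inner ℝ (ν x) h : ℝ)) (ball x0 R0) μ :=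
      D.int.inner_const h
    exact this.pos_part
  have hle : ∫ x in ball x0 R0, φ x * inner ℝ (ν x) h ∂μ
      ≤ ∫ x in ball x0 (R + ‖h‖), max (inner ℝ (ν x) h) 0 ∂μ := by
    rw [setIntegral_eq_of_subset_of_forall_sdiff_eq_zero
      (f := fun x => φ x * inner ℝ (ν x) h) (s := ball x0 (R + ‖h‖)) (t := ball x0 R0)
      measurableSet_ball (ball_subset_ball hR)]
    · have hint2 := hint.mono_set (ball_subset_ball hR)
      apply integral_mono_ae ?_ hint2
      · refine Filter.Eventually.of_forall fun x => ?_
        have := h01 (x - t • h)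
        change φ x * _ ≤ _
        calc φ x * inner ℝ (ν x) h ≤ φ x * max (inner ℝ (ν x) h) 0 :=
              mul_le_mul_of_nonneg_left (le_max_left _ _) this.1
          _ ≤ 1 * max (inner ℝ (ν x) h) 0 :=
              mul_le_mul_of_nonneg_right this.2 (le_max_right _ _)
          _ = _ := one_mul _
      · have hi : IntegrableOn (fun x => (inner ℝ (ν x) h : ℝ)) (ball x0 (R + ‖h‖)) μ :=
          Integrable.inner_const (D.int.mono_set (ball_subset_ball hR)) h
        refine hi.bdd_mul (c := 1) hφs.continuous.aestronglyMeasurable ?_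
        refine Filter.Eventually.of_forall fun x => ?_
        have := h01 (x - t • h)
        change ‖φ x‖ ≤ 1
        rw [Real.norm_eq_abs, abs_of_nonneg this.1]
        exact this.2
    · intro x hx
      have : φ x = 0 := by
        by_contra hne
        exact hx.2 (hts (subset_tsupport _ hne))
      simp [this]
  linarith

lemma exists_bump {K U : Set (EuclideanSpace ℝ (Fin n))} (hK : IsCompact K) (hU : IsOpen U)
    (hKU : K ⊆ U) : ∃ ψ : EuclideanSpace ℝ (Fin n) → ℝ, ContDiff ℝ (⊤ : ℕ∞) ψ ∧
      (∀ x, ψ x ∈ Icc (0 : ℝ) 1) ∧ (∀ x ∈ K, ψ x = 1) ∧ tsupport ψ ⊆ U := by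
  obtain ⟨K', hK', h1, h2⟩ := exists_compact_between hK hU hKU
  obtain ⟨f, hf1, hf0, hf⟩ := exists_contMDiffMap_one_nhds_of_subset_interior
    (n := (⊤ : ℕ∞)) (modelWithCornersSelf ℝ (EuclideanSpace ℝ (Fin n)))
    hK.isClosed h1
  refine ⟨f, f.contMDiff.contDiff, hf, fun x hx => hf1.self_of_nhdsSet x hx, ?_⟩
  refine (closure_minimal ?_ hK'.isClosed).trans h2
  intro x hx
  by_contra hne
  exact hx (hf0 x hne)

lemma loc_indic {μ : Measure (EuclideanSpace ℝ (Fin n))}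
    {ν : EuclideanSpace ℝ (Fin n) → EuclideanSpace ℝ (Fin n)}
    {x0 v : EuclideanSpace ℝ (Fin n)} {R0 : ℝ} (D : LocData n E μ ν x0 v R0)
    {A : Set (EuclideanSpace ℝ (Fin n))} (hA : MeasurableSet A)
    {R : ℝ} (h : EuclideanSpace ℝ (Fin n)) (hs : A ⊆ ball x0 R)
    (hR : R + ‖h‖ ≤ R0) :
    volume.real (A ∩ E) ≤ volume.real (A ∩ {x | x + h ∈ E})
      + ∫ x in ball x0 (R + ‖h‖), max (inner ℝ (ν x) h) 0 ∂μ := by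
  have hE := D.meas
  have hS : MeasurableSet {x | x + h ∈ E} := hE.preimage (by fun_prop)
  have hAf : volume A ≠ ∞ := ((measure_mono hs).trans_lt measure_ball_lt_top).ne
  apply le_of_forall_pos_le_add
  intro ε hε
  have hε' : ENNReal.ofReal (ε / 2) ≠ 0 := by simpa using hε
  obtain ⟨K, hKA, hK, hKd⟩ := hA.exists_isCompact_sdiff_lt hAf hε'
  obtain ⟨U', hKU', hU', hUd'⟩ := hK.measurableSet.exists_isOpen_sdiff_lt
    (hK.measure_lt_top (μ := volume)).ne hε'
  obtain ⟨hUlt, hUd'⟩ := hUd'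
  set U := U' ∩ ball x0 R with hUdef
  have hU : IsOpen U := hU'.inter isOpen_ball
  have hKU : K ⊆ U := subset_inter hKU' (hKA.trans hs)
  have hUf : volume U ≠ ∞ := ((measure_mono inter_subset_right).trans_lt measure_ball_lt_top).ne
  have hUd : volume (U \ K) < ENNReal.ofReal (ε / 2) :=
    (measure_mono (sdiff_subset_sdiff_left inter_subset_left)).trans_lt hUd'
  have r1 : volume.real (A \ K) ≤ ε / 2 := by
    rw [measureReal_def]
    exact ENNReal.toReal_le_of_le_ofReal (by positivity) hKd.le
  have r2 : volume.real (U \ K) ≤ ε / 2 := by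
    rw [measureReal_def]
    exact ENNReal.toReal_le_of_le_ofReal (by positivity) hUd.le
  obtain ⟨ψ, hψ, h01, h1, hsupp⟩ := exists_bump hK hU hKU
  have key := loc_smooth D ψ hψ h01 h (hsupp.trans inter_subset_right) hR
  have hint : Integrable ψ volume := hψ.continuous.integrable_of_hasCompactSupport
    (compactSupport_of_ball (hsupp.trans inter_subset_right))
  have e1 : volume.real (K ∩ E) ≤ ∫ x in E, ψ x ∂volume := by
    have : volume.real (K ∩ E) = ∫ x in E, K.indicator (fun _ => (1 : ℝ)) x ∂volume := by
      rw [integral_indicator_const _ hK.measurableSet, measureReal_restrict_apply hK.measurableSet]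
      simp
    rw [this]
    apply integral_mono
    · apply Integrable.restrict
      rw [integrable_indicator_iff hK.measurableSet]
      exact integrableOn_const hK.measure_lt_top.ne
    · exact hint.restrict
    · intro x
      by_cases hx : x ∈ K
      · simp [hx, h1 x hx]
      · simp [hx, (h01 x).1]
  have e2 : ∫ x in E, ψ (x - h) ∂volume ≤ volume.real (U ∩ {x | x + h ∈ E}) := by
    have a1 : ∫ x in E, ψ (x - h) ∂volume = ∫ x in {x | x + h ∈ E}, ψ x ∂volume := by
      rw [← integral_indicator hE, ← integral_indicator hS,
        ← integral_sub_right_eq_self (fun x => indicator {x | x + h ∈ E} (fun x => ψ x) x) h]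
      congr 1
      ext x
      by_cases hx : x ∈ E <;> simp [indicator, hx]
    have a2 : volume.real (U ∩ {x | x + h ∈ E})
        = ∫ x in {x | x + h ∈ E}, U.indicator (fun _ => (1 : ℝ)) x ∂volume := by
      rw [integral_indicator_const _ hU.measurableSet, measureReal_restrict_apply hU.measurableSet]
      simp
    rw [a1, a2]
    apply integral_mono hint.restrict
    · apply Integrable.restrict
      rw [integrable_indicator_iff hU.measurableSet]
      exact integrableOn_const hUf
    · intro x
      by_cases hx : x ∈ U
      · simp [hx, (h01 x).2]
      · have : ψ x = 0 := by
          by_contra hne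
          exact hx (hsupp (subset_tsupport _ hne))
        simp [hx, this]
  have e3 : volume.real (A ∩ E) ≤ volume.real (K ∩ E) + volume.real (A \ K) := by
    refine (measureReal_mono (s₂ := (K ∩ E) ∪ (A \ K)) ?_ ?_).trans (measureReal_union_le _ _)
    · rintro x ⟨hx, hx'⟩
      by_cases hk : x ∈ K
      · exact Or.inl ⟨hk, hx'⟩
      · exact Or.inr ⟨hx, hk⟩
    · refine ((measure_mono ?_).trans_lt hAf.lt_top).ne
      exact union_subset (inter_subset_left.trans hKA) sdiff_subset
  have e4 : volume.real (U ∩ {x | x + h ∈ E})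
      ≤ volume.real (A ∩ {x | x + h ∈ E}) + volume.real (U \ K) := by
    refine (measureReal_mono (s₂ := (A ∩ {x | x + h ∈ E}) ∪ (U \ K)) ?_ ?_).trans
      (measureReal_union_le _ _)
    · rintro x ⟨hx, hx'⟩
      by_cases hk : x ∈ K
      · exact Or.inl ⟨hKA hk, hx'⟩
      · exact Or.inr ⟨hx, hk⟩
    · refine ((measure_mono (t := ball x0 R) ?_).trans_lt measure_ball_lt_top).ne
      exact union_subset (inter_subset_left.trans hs) (sdiff_subset.trans inter_subset_right)
  linarith

lemma loc_tr1 {μ : Measure (EuclideanSpace ℝ (Fin n))}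
    {ν : EuclideanSpace ℝ (Fin n) → EuclideanSpace ℝ (Fin n)}
    {x0 v : EuclideanSpace ℝ (Fin n)} {R0 : ℝ} (D : LocData n E μ ν x0 v R0)
    {A : Set (EuclideanSpace ℝ (Fin n))} (hA : MeasurableSet A)
    {R : ℝ} (h : EuclideanSpace ℝ (Fin n)) (hs : A ⊆ ball x0 R)
    (hR : R + ‖h‖ ≤ R0) :
    volume.real (A ∩ E) ≤ volume.real (A ∩ {x | x + h ∈ E})
      + ‖h‖ * μ.real (ball x0 (R + ‖h‖)) := by
  have hfin := D.fin
  refine (loc_indic D hA h hs hR).trans ?_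
  gcongr
  have hi : IntegrableOn (fun x => (inner ℝ (ν x) h : ℝ)) (ball x0 (R + ‖h‖)) μ :=
    Integrable.inner_const (D.int.mono_set (ball_subset_ball hR)) h
  calc ∫ x in ball x0 (R + ‖h‖), max (inner ℝ (ν x) h) 0 ∂μ
      ≤ ∫ x in ball x0 (R + ‖h‖), ‖h‖ ∂μ := by
        apply integral_mono_ae hi.pos_part (integrable_const _)
        filter_upwards [ae_restrict_of_ae D.unit] with x hx
        refine max_le ?_ (norm_nonneg _)
        have := real_inner_le_norm (ν x) h
        rwa [hx, one_mul] at this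
    _ = ‖h‖ * μ.real (ball x0 (R + ‖h‖)) := by
        simp [mul_comm]

lemma loc_tr2 {μ : Measure (EuclideanSpace ℝ (Fin n))}
    {ν : EuclideanSpace ℝ (Fin n) → EuclideanSpace ℝ (Fin n)}
    {x0 v : EuclideanSpace ℝ (Fin n)} {R0 : ℝ} (D : LocData n E μ ν x0 v R0)
    {A : Set (EuclideanSpace ℝ (Fin n))} (hA : MeasurableSet A)
    {R : ℝ} (h : EuclideanSpace ℝ (Fin n)) (hs : A ⊆ ball x0 R)
    (hR : R + ‖h‖ + ‖h‖ ≤ R0) :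
    volume.real (A ∩ {x | x + h ∈ E}) ≤ volume.real (A ∩ E)
      + ‖h‖ * μ.real (ball x0 (R + ‖h‖ + ‖h‖)) := by
  have hA' : MeasurableSet ((fun x => x - h) ⁻¹' A) := hA.preimage (by fun_prop)
  have := loc_tr1 D hA' (R := R + ‖h‖) (-h) ?_ (by simpa using hR)
  · rw [norm_neg] at this
    have t1 : volume.real ((fun x => x - h) ⁻¹' A ∩ E) = volume.real (A ∩ {x | x + h ∈ E}) := by
      rw [measureReal_def, measureReal_def, ← measure_preimage_add_right volume h]
      congr 2
      ext x
      simp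
    have t2 : volume.real ((fun x => x - h) ⁻¹' A ∩ {x | x + -h ∈ E})
        = volume.real (A ∩ E) := by
      rw [measureReal_def, measureReal_def, ← measure_preimage_add_right volume h]
      congr 2
      ext x
      simp
    rwa [t1, t2] at this
  · intro x hx
    have h2 := hs hx
    rw [Metric.mem_ball, dist_eq_norm] at h2 ⊢
    have : x - x0 = (x - h - x0) + h := by abel
    rw [this]
    have := norm_add_le (x - h - x0) h
    linarith

lemma avg_fubini {A : Set (EuclideanSpace ℝ (Fin n))}
    (hE : MeasurableSet E) (s : ℝ) :
    ∫⁻ h in ball (0 : EuclideanSpace ℝ (Fin n)) s, volume (A ∩ {x | x + h ∈ E}) ∂volume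
      = ∫⁻ x in A, volume (E ∩ ball x s) ∂volume := by
  have hS : ∀ h, MeasurableSet {x | x + h ∈ E} := fun h => hE.preimage (by fun_prop)
  have l1 : ∀ h, volume (A ∩ {x | x + h ∈ E})
      = ∫⁻ x in A, E.indicator (fun _ => (1 : ℝ≥0∞)) (x + h) ∂volume := by
    intro h
    have : (fun x => E.indicator (fun _ => (1 : ℝ≥0∞)) (x + h))
        = {x | x + h ∈ E}.indicator (fun _ => (1 : ℝ≥0∞)) := by
      ext x; simp [indicator]
    rw [this, lintegral_indicator_const (hS h), Measure.restrict_apply (hS h), one_mul, inter_comm]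
  have l2 : ∀ x, volume (E ∩ ball x s)
      = ∫⁻ h in ball (0 : EuclideanSpace ℝ (Fin n)) s,
          E.indicator (fun _ => (1 : ℝ≥0∞)) (x + h) ∂volume := by
    intro x
    have hm : MeasurableSet {h | x + h ∈ E} := hE.preimage (by fun_prop)
    have : (fun h => E.indicator (fun _ => (1 : ℝ≥0∞)) (x + h))
        = {h | x + h ∈ E}.indicator (fun _ => (1 : ℝ≥0∞)) := by
      ext x; simp [indicator]
    rw [this, lintegral_indicator_const hm, Measure.restrict_apply hm, one_mul,
      ← measure_preimage_add volume x (E ∩ ball x s)]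
    congr 1
    ext h
    simp
  simp_rw [l1, l2]
  rw [lintegral_lintegral_swap]
  apply Measurable.aemeasurable
  have : Measurable (E.indicator (fun _ => (1 : ℝ≥0∞))) := measurable_const.indicator hE
  exact this.comp (by fun_prop)

lemma st_deriv_bound : ∃ K > 0, ∀ x, |deriv Real.smoothTransition x| ≤ K := by
  have hc : Continuous (deriv Real.smoothTransition) :=
    (Real.smoothTransition.contDiff (n := 1)).continuous_deriv (by simp)
  obtain ⟨C, hC⟩ := (isCompact_Icc (a := (-1 : ℝ)) (b := 2)).exists_bound_of_continuousOn
    hc.continuousOn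
  refine ⟨max C 1, lt_max_of_lt_right one_pos, fun x => ?_⟩
  by_cases hx : x ∈ Icc (-1 : ℝ) 2
  · exact (hC x hx).trans (le_max_left _ _)
  · have : deriv Real.smoothTransition x = 0 := by
      rw [mem_Icc, not_and_or, not_le, not_le] at hx
      rcases hx with hx | hx
      · have : Real.smoothTransition =ᶠ[𝓝 x] fun _ => 0 := by
          filter_upwards [Iio_mem_nhds hx] with y hy
          exact Real.smoothTransition.zero_of_nonpos (by simp at hy; linarith)
        rw [this.deriv_eq]; simp
      · have : Real.smoothTransition =ᶠ[𝓝 x] fun _ => 1 := by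
          filter_upwards [Ioi_mem_nhds hx] with y hy
          exact Real.smoothTransition.one_of_one_le (by simp at hy; linarith)
        rw [this.deriv_eq]; simp
    rw [this]; simp

lemma st_layer (q : ℝ) : Real.smoothTransition q
    = ∫ p in Ioc (0 : ℝ) 1, deriv Real.smoothTransition p * (Iio q).indicator (fun _ => (1 : ℝ)) p := by
  have hc : Continuous (deriv Real.smoothTransition) :=
    (Real.smoothTransition.contDiff (n := 1)).continuous_deriv (by simp)
  have hd : Differentiable ℝ Real.smoothTransition :=
    (Real.smoothTransition.contDiff (n := 1)).differentiable (by simp)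
  have e : ∀ p, deriv Real.smoothTransition p * (Iio q).indicator (fun _ => (1 : ℝ)) p
      = (Iio q).indicator (deriv Real.smoothTransition) p := by
    intro p; by_cases hp : p < q <;> simp [indicator, hp]
  simp_rw [e]
  rw [setIntegral_indicator measurableSet_Iio]
  have ftc : ∀ a, Real.smoothTransition a = ∫ p in (0 : ℝ)..a, deriv Real.smoothTransition p := by
    intro a
    rw [intervalIntegral.integral_deriv_eq_sub (fun x _ => hd x) (hc.intervalIntegrable _ _)]
    simp
  rcases le_total q 0 with hq | hq
  · have : Ioc (0 : ℝ) 1 ∩ Iio q = ∅ := by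
      ext p; simp; intro h1 _; linarith
    rw [this]; simp [Real.smoothTransition.zero_of_nonpos hq]
  · rcases le_or_gt q 1 with hq1 | hq1
    · have : Ioc (0 : ℝ) 1 ∩ Iio q = Ioo 0 q := by
        ext p
        rw [mem_inter_iff, mem_Ioc, mem_Iio, mem_Ioo]
        constructor
        · rintro ⟨⟨a, b⟩, c⟩; exact ⟨a, c⟩
        · rintro ⟨a, c⟩; exact ⟨⟨a, by linarith⟩, c⟩
      rw [this, ← integral_Ioc_eq_integral_Ioo, ← intervalIntegral.integral_of_le hq]
      exact ftc q
    · have : Ioc (0 : ℝ) 1 ∩ Iio q = Ioc 0 1 := by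
        ext p; simp; intro a b; linarith
      rw [this, ← intervalIntegral.integral_of_le zero_le_one, ← ftc]
      rw [Real.smoothTransition.one_of_one_le hq1.le, Real.smoothTransition.one_of_one_le le_rfl]

lemma st_deriv_nonneg (x : ℝ) : 0 ≤ deriv Real.smoothTransition x :=
  Real.smoothTransition.monotone.deriv_nonneg

lemma layer_nonneg {μ : Measure (EuclideanSpace ℝ (Fin n))} [IsFiniteMeasure μ]
    {x0 : EuclideanSpace ℝ (Fin n)} {R0 : ℝ} {g : EuclideanSpace ℝ (Fin n) → ℝ}
    (hg : IntegrableOn g (ball x0 R0) μ)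
    (hpos : ∀ ρ, 0 < ρ → ρ < R0 → 0 ≤ ∫ x in ball x0 ρ, g x ∂μ)
    {r R : ℝ} (hr : 0 < r) (hrR : r < R) (hR : R < R0) :
    0 ≤ ∫ x in ball x0 R0,
      Real.smoothTransition ((R ^ 2 - ‖x - x0‖ ^ 2) / (R ^ 2 - r ^ 2)) * g x ∂μ := by
  set q : EuclideanSpace ℝ (Fin n) → ℝ := fun x => (R ^ 2 - ‖x - x0‖ ^ 2) / (R ^ 2 - r ^ 2) with hq
  have hden : 0 < R ^ 2 - r ^ 2 := by nlinarith
  have hqc : Continuous q := by fun_prop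
  have hc : Continuous (deriv Real.smoothTransition) :=
    (Real.smoothTransition.contDiff (n := 1)).continuous_deriv (by simp)
  obtain ⟨K, hK, hKb⟩ := st_deriv_bound
  have e1 : ∀ x, Real.smoothTransition (q x) * g x = ∫ p in Ioc (0 : ℝ) 1,
      (deriv Real.smoothTransition p * (Iio (q x)).indicator (fun _ => (1 : ℝ)) p) * g x := by
    intro x
    rw [integral_mul_const, ← st_layer]
  change 0 ≤ ∫ x in ball x0 R0, Real.smoothTransition (q x) * g x ∂μ
  simp_rw [e1]
  rw [integral_integral_swap]
  · apply setIntegral_nonneg measurableSet_Ioc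
    intro p hp
    have e2 : ∀ x, deriv Real.smoothTransition p * (Iio (q x)).indicator (fun _ => (1 : ℝ)) p * g x
        = deriv Real.smoothTransition p * {x | p < q x}.indicator g x := by
      intro x; by_cases h : p < q x <;> simp [indicator, h]
    simp_rw [e2]
    rw [integral_const_mul]
    apply mul_nonneg (st_deriv_nonneg p)
    rw [integral_indicator (isOpen_lt continuous_const hqc).measurableSet,
      Measure.restrict_restrict (isOpen_lt continuous_const hqc).measurableSet]
    have hball : {x | p < q x} = ball x0 (Real.sqrt (R ^ 2 - p * (R ^ 2 - r ^ 2))) := by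
      ext x
      rw [mem_ball, dist_eq_norm, Real.lt_sqrt (norm_nonneg _), mem_ofPred_eq, hq,
        lt_div_iff₀ hden]
      constructor <;> intro h <;> linarith
    have hlt : Real.sqrt (R ^ 2 - p * (R ^ 2 - r ^ 2)) < R0 := by
      rw [Real.sqrt_lt' (by linarith)]
      have : 0 < p * (R ^ 2 - r ^ 2) := mul_pos hp.1 hden
      nlinarith
    rw [hball, inter_eq_left.2 (ball_subset_ball hlt.le)]
    apply hpos _ _ hlt
    apply Real.sqrt_pos.2
    have : p * (R ^ 2 - r ^ 2) ≤ 1 * (R ^ 2 - r ^ 2) := mul_le_mul_of_nonneg_right hp.2 hden.le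
    nlinarith
  · have hg' : Integrable (fun z : EuclideanSpace ℝ (Fin n) × ℝ => g z.1)
        ((μ.restrict (ball x0 R0)).prod (volume.restrict (Ioc (0 : ℝ) 1))) := hg.comp_fst _
    refine hg'.bdd_mul (c := K) (f := fun z : EuclideanSpace ℝ (Fin n) × ℝ =>
      deriv Real.smoothTransition z.2 * (Iio (q z.1)).indicator (fun _ => (1 : ℝ)) z.2) ?_ ?_
    · have : (fun z : EuclideanSpace ℝ (Fin n) × ℝ =>
          deriv Real.smoothTransition z.2 * (Iio (q z.1)).indicator (fun _ => (1 : ℝ)) z.2)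
          = {z : EuclideanSpace ℝ (Fin n) × ℝ | z.2 < q z.1}.indicator
            (fun z => deriv Real.smoothTransition z.2) := by
        ext z; by_cases h : z.2 < q z.1 <;> simp [indicator, h]
      rw [this]
      apply Measurable.aestronglyMeasurable
      exact (hc.measurable.comp measurable_snd).indicator
        (isOpen_lt continuous_snd (hqc.comp continuous_fst)).measurableSet
    · refine Filter.Eventually.of_forall fun z => ?_
      by_cases h : z.2 < q z.1
      · simpa [indicator, h] using hKb z.2
      · simpa [indicator, h] using hK.le

/-- upper perimeter bound -/
lemma loc_upper : ∃ C > (0 : ℝ), ∀ (n : ℕ) (E : Set (EuclideanSpace ℝ (Fin n)))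
    (μ : Measure (EuclideanSpace ℝ (Fin n)))
    (ν : EuclideanSpace ℝ (Fin n) → EuclideanSpace ℝ (Fin n))
    (x0 v : EuclideanSpace ℝ (Fin n)) (R0 : ℝ), LocData n E μ ν x0 v R0 →
    ∀ r R : ℝ, 0 < r → r < R → R < R0 →
    μ.real (ball x0 r) ≤ C / (R - r) * volume.real (E ∩ ball x0 R) := by
  obtain ⟨K, hK, hKb⟩ := st_deriv_bound
  refine ⟨4 * K, by positivity, ?_⟩
  intro n E μ ν x0 v R0 D r R hr hrR hR
  have hfin := D.fin
  have hE := D.meas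
  have hden : 0 < R ^ 2 - r ^ 2 := by nlinarith
  set q : EuclideanSpace ℝ (Fin n) → ℝ := fun x => (R ^ 2 - ‖x - x0‖ ^ 2) / (R ^ 2 - r ^ 2) with hq
  set φ : EuclideanSpace ℝ (Fin n) → ℝ := fun x => Real.smoothTransition (q x) with hφ
  have hqs : ContDiff ℝ (⊤ : ℕ∞) q := by
    apply ContDiff.div_const
    apply contDiff_const.sub
    exact (contDiff_id.sub contDiff_const).norm_sq ℝ
  have hφs : ContDiff ℝ (⊤ : ℕ∞) φ := Real.smoothTransition.contDiff.comp hqs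
  have hsub : Function.support φ ⊆ ball x0 R := by
    intro x hx
    by_contra hne
    apply hx
    apply Real.smoothTransition.zero_of_nonpos
    apply div_nonpos_of_nonpos_of_nonneg _ hden.le
    rw [mem_ball, dist_eq_norm, not_lt] at hne
    nlinarith
  have htc : tsupport φ ⊆ closedBall x0 R :=
    closure_minimal (hsub.trans ball_subset_closedBall) isClosed_closedBall
  have hts : tsupport φ ⊆ ball x0 R0 := htc.trans (closedBall_subset_ball hR)
  have hp := D.parts φ hφs hts v
  have hiv : IntegrableOn (fun x => (inner ℝ (ν x) v : ℝ)) (ball x0 R0) μ :=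
    Integrable.inner_const D.int v
  have hbd : ∀ f : EuclideanSpace ℝ (Fin n) → ℝ, IntegrableOn f (ball x0 R0) μ →
      IntegrableOn (fun x => φ x * f x) (ball x0 R0) μ := by
    intro f hf
    refine Integrable.bdd_mul (c := 1) hf hφs.continuous.aestronglyMeasurable ?_
    refine Filter.Eventually.of_forall fun x => ?_
    rw [Real.norm_eq_abs, abs_of_nonneg (Real.smoothTransition.nonneg _)]
    exact Real.smoothTransition.le_one _
  have hl := layer_nonneg (μ := μ) (x0 := x0) (R0 := R0) (r := r) (R := R)
    (g := fun x => 2 * inner ℝ (ν x) v - 1)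
    ((hiv.const_mul 2).sub (integrable_const _)) (fun ρ h1 h2 => by
      have := D.half ρ h1 h2
      rw [integral_sub ((Integrable.const_mul (hiv.mono_set (ball_subset_ball h2.le)) 2))
        (integrable_const _), integral_const_mul]
      simp
      linarith) hr hrR hR
  have hl2 : ∫ x in ball x0 R0, φ x * (2 * inner ℝ (ν x) v - 1) ∂μ
      = 2 * (∫ x in ball x0 R0, φ x * inner ℝ (ν x) v ∂μ) - ∫ x in ball x0 R0, φ x * 1 ∂μ := by
    rw [← integral_const_mul, ← integral_sub]
    · congr 1; ext x; ring
    · exact (hbd _ hiv).const_mul 2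
    · exact hbd _ (integrable_const _)
  change 0 ≤ ∫ x in ball x0 R0, φ x * (2 * inner ℝ (ν x) v - 1) ∂μ at hl
  rw [hl2, ← hp] at hl
  have l1 : μ.real (ball x0 r) ≤ ∫ x in ball x0 R0, φ x * 1 ∂μ := by
    have : μ.real (ball x0 r) = ∫ x in ball x0 R0, (ball x0 r).indicator (fun _ => (1 : ℝ)) x ∂μ := by
      rw [integral_indicator_const _ measurableSet_ball, measureReal_restrict_apply measurableSet_ball,
        inter_eq_left.2 (ball_subset_ball (by linarith))]
      simp
    rw [this]
    apply integral_mono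
    · exact (integrable_const _).indicator measurableSet_ball
    · exact hbd _ (integrable_const _)
    · intro x
      by_cases hx : x ∈ ball x0 r
      · have : φ x = 1 := by
          apply Real.smoothTransition.one_of_one_le
          rw [hq, one_le_div hden]
          rw [mem_ball, dist_eq_norm] at hx
          have := norm_nonneg (x - x0)
          nlinarith
        simp [hx, this]
      · simp [hx, hφ, Real.smoothTransition.nonneg]
  have l2 : ∫ x in E, fderiv ℝ φ x v ∂volume ≤ 2 * K / (R - r) * volume.real (E ∩ ball x0 R) := by
    have hpt : ∀ x, ‖fderiv ℝ φ x v‖ ≤ (closedBall x0 R).indicator (fun _ => 2 * K / (R - r)) x := by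
      intro x
      by_cases hx : x ∈ closedBall x0 R
      · rw [indicator_of_mem hx]
        have hqd : HasFDerivAt q ((R ^ 2 - r ^ 2)⁻¹ •
            (-((2 : ℕ) • (innerSL ℝ (x - x0))) : EuclideanSpace ℝ (Fin n) →L[ℝ] ℝ)) x := by
          have h0 : HasFDerivAt (fun x : EuclideanSpace ℝ (Fin n) => x - x0)
            (ContinuousLinearMap.id ℝ _) x := (hasFDerivAt_id x).sub_const x0
          have h1 := h0.norm_sq
          have h2 := (h1.const_sub (R ^ 2)).const_mul (R ^ 2 - r ^ 2)⁻¹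
          have e : q = fun y => (R ^ 2 - r ^ 2)⁻¹ * (R ^ 2 - ‖y - x0‖ ^ 2) := by
            funext y
            simp only [hq]
            rw [div_eq_inv_mul]
          rw [e]
          rw [ContinuousLinearMap.comp_id] at h2
          exact h2
        have hst : HasDerivAt Real.smoothTransition (deriv Real.smoothTransition (q x)) (q x) :=
          ((Real.smoothTransition.contDiff (n := 1)).differentiable (by simp) _).hasDerivAt
        have hfd := hst.comp_hasFDerivAt x hqd
        have : fderiv ℝ φ x = _ := hfd.fderiv
        rw [this]
        simp only [smul_apply, neg_apply, smul_eq_mul,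
          norm_mul, norm_neg, innerSL_apply_apply, nsmul_eq_mul, norm_inv]
        have i1 : ‖(inner ℝ (x - x0) v : ℝ)‖ ≤ R := by
          refine (norm_inner_le_norm _ _).trans ?_
          rw [D.vunit, mul_one, ← dist_eq_norm]
          exact hx
        have i2 := hKb (q x)
        rw [← Real.norm_eq_abs] at i2
        have i3 : ‖R ^ 2 - r ^ 2‖⁻¹ * (2 * R) ≤ 2 / (R - r) := by
          rw [Real.norm_eq_abs, abs_of_pos hden, inv_mul_eq_div, div_le_div_iff₀ hden (by linarith)]
          nlinarith
        have : 0 < ‖R ^ 2 - r ^ 2‖⁻¹ := by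
          rw [Real.norm_eq_abs, abs_of_pos hden]; positivity
        calc _ ≤ K * (‖R ^ 2 - r ^ 2‖⁻¹ * (2 * R)) := by
              gcongr
              simp
          _ ≤ K * (2 / (R - r)) := by gcongr
          _ = 2 * K / (R - r) := by ring
      · rw [indicator_of_notMem hx]
        have : fderiv ℝ φ x = 0 := by
          by_contra hne
          exact hx (htc ((support_fderiv_subset ℝ) hne))
        simp [this]
    have hi : Integrable ((closedBall x0 R).indicator (fun _ => 2 * K / (R - r)))
        (volume.restrict E) := by
      apply Integrable.restrict
      rw [integrable_indicator_iff measurableSet_closedBall]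
      exact integrableOn_const measure_closedBall_lt_top.ne
    calc ∫ x in E, fderiv ℝ φ x v ∂volume ≤ ‖∫ x in E, fderiv ℝ φ x v ∂volume‖ := le_abs_self _
      _ ≤ ∫ x in E, (closedBall x0 R).indicator (fun _ => 2 * K / (R - r)) x ∂volume :=
          norm_integral_le_of_norm_le hi (Filter.Eventually.of_forall hpt)
      _ ≤ 2 * K / (R - r) * volume.real (E ∩ ball x0 R) := by
          rw [integral_indicator_const _ measurableSet_closedBall,
            measureReal_restrict_apply measurableSet_closedBall, smul_eq_mul, mul_comm, inter_comm]
          have hRr : 0 < R - r := by linarith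
          gcongr 2 * K / (R - r) * ?_
          have hsp : volume.real (sphere x0 R) = 0 := by
            rw [measureReal_def, Measure.addHaar_sphere_of_ne_zero volume x0 (by linarith)]; simp
          have hu : volume.real (E ∩ closedBall x0 R)
              ≤ volume.real ((E ∩ ball x0 R) ∪ sphere x0 R) := by
            apply measureReal_mono
            · rw [← ball_union_sphere]
              rintro x ⟨h1, h2 | h2⟩
              · exact Or.inl ⟨h1, h2⟩
              · exact Or.inr h2
            · refine ((measure_mono (t := closedBall x0 R) ?_).trans_lt
                measure_closedBall_lt_top).ne
              exact union_subset (inter_subset_right.trans ball_subset_closedBall)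
                sphere_subset_closedBall
          have := measureReal_union_le (μ := volume) (E ∩ ball x0 R) (sphere x0 R)
          linarith
  have : 4 * K / (R - r) * volume.real (E ∩ ball x0 R)
    = 2 * (2 * K / (R - r) * volume.real (E ∩ ball x0 R)) := by ring
  rw [this]
  linarith

lemma avg_ge {A : Set (EuclideanSpace ℝ (Fin n))} (hAf : volume A ≠ ∞)
    (hE : MeasurableSet E) {t p q b : ℝ} (hp : 0 ≤ p) (hq : 0 ≤ q) (hb : 0 ≤ b)
    (h1 : ∀ h ∈ ball (0 : EuclideanSpace ℝ (Fin n)) t,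
      p ≤ volume.real (A ∩ {x | x + h ∈ E}) + q)
    (h2 : ∀ x, x ∈ A → volume.real (E ∩ ball x t) ≤ b) (hA : MeasurableSet A) :
    p * volume.real (ball (0 : EuclideanSpace ℝ (Fin n)) t)
      ≤ b * volume.real A + q * volume.real (ball (0 : EuclideanSpace ℝ (Fin n)) t) := by
  have f1 : ∀ h, volume (A ∩ {x | x + h ∈ E}) ≠ ∞ := fun h =>
    ((measure_mono inter_subset_left).trans_lt hAf.lt_top).ne
  have f2 : ∀ x, volume (E ∩ ball x t) ≠ ∞ := fun x =>
    ((measure_mono inter_subset_right).trans_lt measure_ball_lt_top).ne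
  have key : ENNReal.ofReal p * volume (ball (0 : EuclideanSpace ℝ (Fin n)) t)
      ≤ ENNReal.ofReal b * volume A
        + ENNReal.ofReal q * volume (ball (0 : EuclideanSpace ℝ (Fin n)) t) := by
    calc ENNReal.ofReal p * volume (ball (0 : EuclideanSpace ℝ (Fin n)) t)
        = ∫⁻ h in ball (0 : EuclideanSpace ℝ (Fin n)) t, ENNReal.ofReal p ∂volume := by simp
      _ ≤ ∫⁻ h in ball (0 : EuclideanSpace ℝ (Fin n)) t,
          (volume (A ∩ {x | x + h ∈ E}) + ENNReal.ofReal q) ∂volume := by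
          apply setLIntegral_mono' measurableSet_ball
          intro h hh
          rw [← ENNReal.ofReal_toReal (f1 h), ← ENNReal.ofReal_add ENNReal.toReal_nonneg hq]
          exact ENNReal.ofReal_le_ofReal (h1 h hh)
      _ = ∫⁻ x in A, volume (E ∩ ball x t) ∂volume
          + ENNReal.ofReal q * volume (ball (0 : EuclideanSpace ℝ (Fin n)) t) := by
          rw [lintegral_add_right _ measurable_const, avg_fubini hE]; simp
      _ ≤ _ := by
          gcongr
          calc ∫⁻ x in A, volume (E ∩ ball x t) ∂volume
              ≤ ∫⁻ x in A, ENNReal.ofReal b ∂volume := by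
                apply setLIntegral_mono' hA
                intro x hx
                rw [← ENNReal.ofReal_toReal (f2 x)]
                exact ENNReal.ofReal_le_ofReal (h2 x hx)
            _ = _ := by simp
  have hB : volume (ball (0 : EuclideanSpace ℝ (Fin n)) t) ≠ ∞ := measure_ball_lt_top.ne
  have := ENNReal.toReal_mono (by finiteness) key
  rw [ENNReal.toReal_add (by finiteness) (by finiteness)] at this
  simpa [ENNReal.toReal_mul, ENNReal.toReal_ofReal, hp, hq, hb, measureReal_def] using this

lemma avg_le {A : Set (EuclideanSpace ℝ (Fin n))} (hAf : volume A ≠ ∞)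
    (hE : MeasurableSet E) {t q b : ℝ} (hq : 0 ≤ q) (hb : 0 ≤ b)
    (h1 : ∀ h ∈ ball (0 : EuclideanSpace ℝ (Fin n)) t,
      volume.real (A ∩ {x | x + h ∈ E}) ≤ q)
    (h2 : ∀ x, x ∈ A → b ≤ volume.real (E ∩ ball x t)) (hA : MeasurableSet A) :
    b * volume.real A ≤ q * volume.real (ball (0 : EuclideanSpace ℝ (Fin n)) t) := by
  have f1 : ∀ h, volume (A ∩ {x | x + h ∈ E}) ≠ ∞ := fun h =>
    ((measure_mono inter_subset_left).trans_lt hAf.lt_top).ne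
  have f2 : ∀ x, volume (E ∩ ball x t) ≠ ∞ := fun x =>
    ((measure_mono inter_subset_right).trans_lt measure_ball_lt_top).ne
  have key : ENNReal.ofReal b * volume A
      ≤ ENNReal.ofReal q * volume (ball (0 : EuclideanSpace ℝ (Fin n)) t) := by
    calc ENNReal.ofReal b * volume A = ∫⁻ x in A, ENNReal.ofReal b ∂volume := by simp
      _ ≤ ∫⁻ x in A, volume (E ∩ ball x t) ∂volume := by
          apply setLIntegral_mono' hA
          intro x hx
          rw [← ENNReal.ofReal_toReal (f2 x)]
          exact ENNReal.ofReal_le_ofReal (h2 x hx)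
      _ = ∫⁻ h in ball (0 : EuclideanSpace ℝ (Fin n)) t, volume (A ∩ {x | x + h ∈ E}) ∂volume :=
          (avg_fubini hE t).symm
      _ ≤ ∫⁻ h in ball (0 : EuclideanSpace ℝ (Fin n)) t, ENNReal.ofReal q ∂volume := by
          apply setLIntegral_mono' measurableSet_ball
          intro h hh
          rw [← ENNReal.ofReal_toReal (f1 h)]
          exact ENNReal.ofReal_le_ofReal (h1 h hh)
      _ = _ := by simp
  have hB : volume (ball (0 : EuclideanSpace ℝ (Fin n)) t) ≠ ∞ := measure_ball_lt_top.ne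
  have := ENNReal.toReal_mono (by finiteness) key
  simpa [ENNReal.toReal_mul, ENNReal.toReal_ofReal, hq, hb, measureReal_def] using this

lemma vol_ball (x : EuclideanSpace ℝ (Fin n)) {r : ℝ} (hr : 0 < r) :
    volume.real (ball x r) = r ^ n * volume.real (ball (0 : EuclideanSpace ℝ (Fin n)) 1) := by
  rw [measureReal_def, measureReal_def, Measure.addHaar_ball_of_pos _ _ hr, ENNReal.toReal_mul,
    ENNReal.toReal_ofReal (by positivity)]
  simp

lemma vol_ball_one_pos : 0 < volume.real (ball (0 : EuclideanSpace ℝ (Fin n)) 1) := by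
  rw [measureReal_def]
  exact ENNReal.toReal_pos (measure_ball_pos _ _ one_pos).ne' measure_ball_lt_top.ne

/-- lower density bound -/
lemma loc_dens {μ : Measure (EuclideanSpace ℝ (Fin n))}
    {ν : EuclideanSpace ℝ (Fin n) → EuclideanSpace ℝ (Fin n)}
    {x0 v : EuclideanSpace ℝ (Fin n)} {R0 : ℝ} (D : LocData n E μ ν x0 v R0) :
    ∃ a > 0, ∀ r, 0 < r → r < R0 → a * r ^ n ≤ volume.real (E ∩ ball x0 r) := by
  obtain ⟨C, hC, hup⟩ := loc_upper
  have hup := hup n E μ ν x0 v R0 D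
  have hfin := D.fin
  have hE := D.meas
  set ω := volume.real (ball (0 : EuclideanSpace ℝ (Fin n)) 1) with hω
  have hωp : 0 < ω := vol_ball_one_pos
  set l : ℝ := min (1 / 2) (1 / (4 * C * 2 ^ n)) with hl
  have hlp : 0 < l := by positivity
  have hl2 : l ≤ 1 / 2 := min_le_left _ _
  have hl3 : 4 * C * l ≤ 1 / 2 ^ n := by
    have : l ≤ 1 / (4 * C * 2 ^ n) := min_le_right _ _
    calc 4 * C * l ≤ 4 * C * (1 / (4 * C * 2 ^ n)) := by gcongr
      _ = 1 / 2 ^ n := by field_simp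
  set a : ℝ := ω * l ^ n / 2 with ha
  have hap : 0 < a := by positivity
  have step : ∀ s R : ℝ, 0 < s → 0 < R - s → R < R0 →
      volume.real (E ∩ ball x0 R) ≤ a * s ^ n →
      volume.real (E ∩ ball x0 (R - s)) ≤ a * (s / 2) ^ n := by
    intro s R hs hRs hR hm
    set m := volume.real (E ∩ ball x0 R) with hmdef
    have htp : 0 < l * s := by positivity
    have hts : l * s ≤ s / 2 := by nlinarith
    have hAm : MeasurableSet (E ∩ ball x0 (R - s)) := hE.inter measurableSet_ball
    have hAf : volume (E ∩ ball x0 (R - s)) ≠ ∞ :=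
      ((measure_mono inter_subset_right).trans_lt measure_ball_lt_top).ne
    have hmu := hup (R - s / 2) R (by linarith) (by linarith) hR
    have hav := avg_ge (n := n) (E := E) (A := E ∩ ball x0 (R - s)) hAf hE (t := l * s)
      (p := volume.real (E ∩ ball x0 (R - s))) (q := l * s * μ.real (ball x0 (R - s / 2)))
      (b := m) measureReal_nonneg (by positivity) measureReal_nonneg ?_ ?_ hAm
    · rw [vol_ball _ htp, ← hω, mul_pow] at hav
      have e1 : R - (R - s / 2) = s / 2 := by ring
      rw [e1] at hmu
      set A := volume.real (E ∩ ball x0 (R - s))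
      have hA0 : 0 ≤ A := measureReal_nonneg
      set W := l ^ n * s ^ n * ω with hW
      have hWp : 0 < W := by positivity
      have hmW : m ≤ W / 2 := by
        calc m ≤ a * s ^ n := hm
          _ = W / 2 := by rw [ha, hW]; ring
      have h3 : A ≤ 2 * (l * s * μ.real (ball x0 (R - s / 2))) := by
        have : m * A ≤ W / 2 * A := by gcongr
        have h4 : A * W ≤ (2 * (l * s * μ.real (ball x0 (R - s / 2)))) * W := by nlinarith
        exact le_of_mul_le_mul_right h4 hWp
      calc A ≤ 2 * (l * s * μ.real (ball x0 (R - s / 2))) := h3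
        _ ≤ 2 * (l * s * (C / (s / 2) * m)) := by gcongr
        _ = (4 * C * l) * m := by field_simp; ring
        _ ≤ (1 / 2 ^ n) * (a * s ^ n) := by gcongr
        _ = a * (s / 2) ^ n := by rw [div_pow]; ring
    · intro h hh
      rw [mem_ball_zero_iff] at hh
      have h1 := loc_tr1 D hAm (R := R - s) h inter_subset_right (by linarith)
      have h2 : E ∩ ball x0 (R - s) ∩ E = E ∩ ball x0 (R - s) := by
        rw [inter_eq_left]; exact inter_subset_left
      rw [h2] at h1
      refine h1.trans ?_
      gcongr
      · finiteness
      · linarith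
    · intro x hx
      apply measureReal_mono
      · refine inter_subset_inter_right _ (ball_subset_ball' ?_)
        have : dist x x0 < R - s := hx.2
        linarith
      · exact ((measure_mono inter_subset_right).trans_lt measure_ball_lt_top).ne
  refine ⟨a * (1 / 4) ^ n, by positivity, fun r hr hr0 => ?_⟩
  by_contra hcon
  rw [not_le] at hcon
  have hn : n ≠ 0 := by
    rintro rfl
    have h1 := D.vunit
    have : v = 0 := Subsingleton.elim _ _
    rw [this] at h1; simp at h1
  have iter : ∀ k : ℕ, volume.real (E ∩ ball x0 (r / 2 + (r / 2) * (1 / 2) ^ k))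
      ≤ a * ((r / 4) * (1 / 2) ^ k) ^ n := by
    intro k
    induction k with
    | zero =>
      have e : r / 2 + r / 2 * (1 / 2) ^ 0 = r := by ring
      rw [e]
      refine hcon.le.trans (le_of_eq ?_)
      rw [mul_assoc, ← mul_pow]; congr 2; ring
    | succ k ih =>
      have hk : (0 : ℝ) < (1 / 2) ^ k := by positivity
      have hk1 : ((1 : ℝ) / 2) ^ k ≤ 1 := pow_le_one₀ (by norm_num) (by norm_num)
      have := step ((r / 4) * (1 / 2) ^ k) _ (by positivity) (by nlinarith) (by nlinarith) ih
      have e1 : r / 2 + r / 2 * (1 / 2) ^ k - r / 4 * (1 / 2) ^ k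
        = r / 2 + r / 2 * (1 / 2) ^ (k + 1) := by ring
      have e2 : r / 4 * (1 / 2) ^ k / 2 = r / 4 * (1 / 2) ^ (k + 1) := by ring
      rwa [e1, e2] at this
  have hzero : volume.real (E ∩ ball x0 (r / 2)) ≤ 0 := by
    have hlim : Tendsto (fun k : ℕ => a * ((r / 4) * (1 / 2) ^ k) ^ n) atTop (𝓝 0) := by
      have h1 : Tendsto (fun k : ℕ => ((1 : ℝ) / 2) ^ k) atTop (𝓝 0) :=
        tendsto_pow_atTop_nhds_zero_of_lt_one (by norm_num) (by norm_num)
      have h2 := ((h1.const_mul (r / 4)).pow n).const_mul a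
      simpa [hn] using h2
    refine ge_of_tendsto' hlim fun k => le_trans ?_ (iter k)
    apply measureReal_mono
    · refine inter_subset_inter_right _ (ball_subset_ball ?_)
      have : (0 : ℝ) < r / 2 * (1 / 2) ^ k := by positivity
      linarith
    · exact ((measure_mono inter_subset_right).trans_lt measure_ball_lt_top).ne
  have h5 := hup (r / 4) (r / 2) (by linarith) (by linarith) (by linarith)
  have h6 : volume.real (E ∩ ball x0 (r / 2)) = 0 := le_antisymm hzero measureReal_nonneg
  rw [h6, mul_zero] at h5
  have h7 : 0 < μ.real (ball x0 (r / 4)) := by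
    rw [measureReal_def]
    exact ENNReal.toReal_pos (D.pos _ (by linarith)).ne' (measure_ne_top _ _)
  linarith

lemma loc_half {μ : Measure (EuclideanSpace ℝ (Fin n))}
    {ν : EuclideanSpace ℝ (Fin n) → EuclideanSpace ℝ (Fin n)}
    {x0 v : EuclideanSpace ℝ (Fin n)} {R0 : ℝ} (D : LocData n E μ ν x0 v R0) :
    ∃ C > 0, ∀ δ : ℝ, 0 < δ → δ ≤ 1 → ∃ ρ > 0, ∀ r, 0 < r → r < ρ →
      ∀ K : Set (EuclideanSpace ℝ (Fin n)), MeasurableSet K → K ⊆ ball x0 r →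
      (∀ y ∈ K, inner ℝ (y - x0) v ≤ 0) → volume.real (K \ E) ≤ C * δ * r ^ n := by
  obtain ⟨C1, hC1, hup⟩ := loc_upper
  have hup := hup n E μ ν x0 v R0 D
  obtain ⟨a, hap, hdens⟩ := loc_dens D
  have hfin := D.fin
  have hE := D.meas
  set ω := volume.real (ball (0 : EuclideanSpace ℝ (Fin n)) 1) with hω
  have hωp : 0 < ω := vol_ball_one_pos
  set M : ℝ := C1 * 4 ^ n * ω with hM
  have hMp : 0 < M := by positivity
  refine ⟨2 * ω * M / a, by positivity, fun δ hδ hδ1 => ?_⟩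
  set ε : ℝ := a * δ ^ n / (2 * M) with hε
  have hεp : 0 < ε := by positivity
  obtain ⟨ρ, hρ, hsm⟩ := D.small ε hεp
  refine ⟨min (R0 / 4) (ρ / 3), by have := D.R0pos; positivity, ?_⟩
  intro r hr hrlt K hK hKr hKv
  have hr1 : 4 * r < R0 := by have := hrlt.trans_le (min_le_left _ _); linarith
  have hr2 : 3 * r < ρ := by have := hrlt.trans_le (min_le_right _ _); linarith
  have hs : 0 < δ * r := by positivity
  have hsr : δ * r ≤ r := by nlinarith
  have hmu : r * μ.real (ball x0 (3 * r)) ≤ M * r ^ n := by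
    have h1 := hup (3 * r) (4 * r) (by positivity) (by linarith) hr1
    have h2 : volume.real (E ∩ ball x0 (4 * r)) ≤ (4 * r) ^ n * ω := by
      rw [hω, ← vol_ball x0 (by positivity)]
      exact measureReal_mono inter_subset_right measure_ball_lt_top.ne
    have e : 4 * r - 3 * r = r := by ring
    rw [e] at h1
    calc r * μ.real (ball x0 (3 * r)) ≤ r * (C1 / r * ((4 * r) ^ n * ω)) := by gcongr; exact h1.trans (by gcongr)
      _ = M * r ^ n := by rw [hM, mul_pow]; field_simp
  have hnu : r * ∫ x in ball x0 (3 * r), ‖ν x - v‖ ∂μ ≤ a * (δ * r) ^ n / 2 := by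
    have h1 := hsm (3 * r) (by positivity) hr2
    calc r * ∫ x in ball x0 (3 * r), ‖ν x - v‖ ∂μ ≤ r * (ε * μ.real (ball x0 (3 * r))) := by gcongr
      _ = ε * (r * μ.real (ball x0 (3 * r))) := by ring
      _ ≤ ε * (M * r ^ n) := by gcongr
      _ = a * (δ * r) ^ n / 2 := by rw [hε, mul_pow]; field_simp
  have hlow : ∀ x, x ∈ K → a * (δ * r) ^ n / 2 ≤ volume.real (E ∩ ball x (δ * r)) := by
    intro x hx
    set h := x - x0 with hh
    have hhr : ‖h‖ ≤ r := by
      have := hKr hx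
      rw [mem_ball, dist_eq_norm] at this
      exact this.le
    have h1 := loc_indic D (A := ball x0 (δ * r)) measurableSet_ball h subset_rfl (by linarith)
    have h2 : volume.real (ball x0 (δ * r) ∩ {y | y + h ∈ E}) = volume.real (E ∩ ball x (δ * r)) := by
      rw [measureReal_def, measureReal_def,
        ← measure_preimage_add_right volume h (E ∩ ball x (δ * r))]
      congr 2
      ext y
      have hx0 : y + h - x = y - x0 := by rw [hh]; abel
      simp only [mem_inter_iff, mem_preimage, mem_ball, dist_eq_norm, hx0, mem_setOf_eq]
      exact and_comm
    have hsub : ball x0 (δ * r + ‖h‖) ⊆ ball x0 (3 * r) := ball_subset_ball (by linarith)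
    have hi3 : IntegrableOn ν (ball x0 (3 * r)) μ :=
      D.int.mono_set (ball_subset_ball (by linarith))
    have hid : IntegrableOn (fun x => ‖ν x - v‖) (ball x0 (3 * r)) μ :=
      (hi3.sub (integrable_const v)).norm
    have h3 : ∫ y in ball x0 (δ * r + ‖h‖), max (inner ℝ (ν y) h) 0 ∂μ
        ≤ r * ∫ x in ball x0 (3 * r), ‖ν x - v‖ ∂μ := by
      rw [← integral_const_mul]
      calc ∫ y in ball x0 (δ * r + ‖h‖), max (inner ℝ (ν y) h) 0 ∂μ
          ≤ ∫ y in ball x0 (δ * r + ‖h‖), r * ‖ν y - v‖ ∂μ := by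
            apply integral_mono
            · exact (Integrable.inner_const (hi3.mono_set hsub) h).pos_part
            · exact (Integrable.const_mul (hid.mono_set hsub) r)
            · intro y
              refine max_le ?_ (by positivity)
              have h4 : inner ℝ (ν y) h = inner ℝ (ν y - v) h + inner ℝ h v := by
                rw [inner_sub_left, real_inner_comm h v]; ring
              have h5 := real_inner_le_norm (ν y - v) h
              have h6 := hKv x hx
              have h7 : ‖ν y - v‖ * ‖h‖ ≤ r * ‖ν y - v‖ := by
                rw [mul_comm]; gcongr
              change inner ℝ (ν y) h ≤ _
              rw [h4]
              linarith
        _ ≤ ∫ y in ball x0 (3 * r), r * ‖ν y - v‖ ∂μ := by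
            apply setIntegral_mono_set (hid.const_mul r)
            · exact Filter.Eventually.of_forall fun y => by positivity
            · exact hsub.eventuallyLE
    have h4 := hdens (δ * r) hs (by linarith)
    rw [inter_comm] at h4
    rw [h2] at h1
    linarith
  have hAm : MeasurableSet (K \ E) := hK.diff hE
  have hAf : volume (K \ E) ≠ ∞ :=
    ((measure_mono (sdiff_subset.trans hKr)).trans_lt measure_ball_lt_top).ne
  have hav := avg_le (n := n) (E := E) hAf hE (t := δ * r) (q := δ * r * μ.real (ball x0 (3 * r)))
    (b := a * (δ * r) ^ n / 2) (by positivity) (by positivity) ?_ (fun x hx => hlow x hx.1) hAm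
  · rw [vol_ball _ hs, ← hω] at hav
    have hW : 0 < a * (δ * r) ^ n / 2 := by positivity
    refine le_of_mul_le_mul_left (hav.trans ?_) hW
    calc δ * r * μ.real (ball x0 (3 * r)) * ((δ * r) ^ n * ω)
        = δ * (δ * r) ^ n * ω * (r * μ.real (ball x0 (3 * r))) := by ring
      _ ≤ δ * (δ * r) ^ n * ω * (M * r ^ n) := by gcongr
      _ = _ := by field_simp
  · intro h hh
    rw [mem_ball_zero_iff] at hh
    have h1 := loc_tr2 D hAm (R := r) h (sdiff_subset.trans hKr) (by linarith)
    have h2 : K \ E ∩ E = ∅ := by simp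
    rw [h2] at h1
    simp only [measureReal_empty, zero_add] at h1
    refine h1.trans ?_
    gcongr
    · finiteness
    · linarith

lemma loc_disj {F : Set (EuclideanSpace ℝ (Fin n))} (hdisj : Disjoint E F)
    {μ μ' : Measure (EuclideanSpace ℝ (Fin n))}
    {ν ν' : EuclideanSpace ℝ (Fin n) → EuclideanSpace ℝ (Fin n)}
    {x0 v w : EuclideanSpace ℝ (Fin n)} {R0 R0' : ℝ} (D : LocData n E μ ν x0 v R0)
    (D' : LocData n F μ' ν' x0 w R0') : v = -w := by
  by_contra hne
  obtain ⟨C1, hC1, H1⟩ := loc_half D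
  obtain ⟨C2, hC2, H2⟩ := loc_half D'
  set e := v + w with he
  have hL : 0 < ‖e‖ := by
    rw [norm_pos_iff]
    intro h0
    exact hne (eq_neg_of_add_eq_zero_left h0)
  set L := ‖e‖ with hLdef
  set ω := volume.real (ball (0 : EuclideanSpace ℝ (Fin n)) 1) with hω
  have hωp : 0 < ω := vol_ball_one_pos
  have hL2 : L ≤ 2 := by
    have := norm_add_le v w
    rw [D.vunit, D'.vunit] at this
    linarith
  have hsq : L ^ 2 = 2 + 2 * inner ℝ v w := by
    rw [hLdef, he, norm_add_sq_real, D.vunit, D'.vunit]; ring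
  have hev : inner ℝ e v = L ^ 2 / 2 := by
    rw [he, inner_add_left, real_inner_self_eq_norm_sq, D.vunit, hsq, real_inner_comm v w]; ring
  have hew : inner ℝ e w = L ^ 2 / 2 := by
    rw [he, inner_add_left, real_inner_self_eq_norm_sq, D'.vunit, hsq]; ring
  set δ : ℝ := min 1 ((L / 4) ^ n * ω / (2 * (C1 + C2))) with hδ
  have hδp : 0 < δ := by positivity
  have hδ2 : (C1 + C2) * δ ≤ (L / 4) ^ n * ω / 2 := by
    calc (C1 + C2) * δ ≤ (C1 + C2) * ((L / 4) ^ n * ω / (2 * (C1 + C2))) := by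
          gcongr; exact min_le_right _ _
      _ = _ := by field_simp
  obtain ⟨ρ1, hρ1, H1⟩ := H1 δ hδp (min_le_left _ _)
  obtain ⟨ρ2, hρ2, H2⟩ := H2 δ hδp (min_le_left _ _)
  obtain ⟨r, hr, hrlt⟩ : ∃ r : ℝ, 0 < r ∧ r < min ρ1 ρ2 := exists_between (by positivity)
  set p := x0 - (r / (2 * L)) • e with hp
  set K := ball p (r * L / 4) with hK
  have hdec : ∀ y, y - x0 = (y - p) - (r / (2 * L)) • e := by intro y; rw [hp]; abel
  have hKr : K ⊆ ball x0 r := by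
    intro y hy
    rw [hK, mem_ball, dist_eq_norm] at hy
    rw [mem_ball, dist_eq_norm, hdec y]
    have h1 := norm_sub_le (y - p) ((r / (2 * L)) • e)
    have h2 : ‖(r / (2 * L)) • e‖ = r / 2 := by
      rw [norm_smul, Real.norm_eq_abs, abs_of_pos (by positivity), ← hLdef]
      field_simp
    have h3 : r * L / 4 ≤ r / 2 := by nlinarith
    linarith
  have hKin : ∀ u : EuclideanSpace ℝ (Fin n), ‖u‖ = 1 → inner ℝ e u = L ^ 2 / 2 →
      ∀ y ∈ K, inner ℝ (y - x0) u ≤ 0 := by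
    intro u hu heu y hy
    rw [hK, mem_ball, dist_eq_norm] at hy
    rw [hdec y, inner_sub_left, real_inner_smul_left, heu]
    have h1 := real_inner_le_norm (y - p) u
    rw [hu, mul_one] at h1
    have h2 : r / (2 * L) * (L ^ 2 / 2) = r * L / 4 := by field_simp; ring
    rw [h2]
    linarith
  have k1 := H1 r hr (hrlt.trans_le (min_le_left _ _)) K measurableSet_ball hKr
    (hKin v D.vunit hev)
  have k2 := H2 r hr (hrlt.trans_le (min_le_right _ _)) K measurableSet_ball hKr
    (hKin w D'.vunit hew)
  have k3 : volume.real K ≤ volume.real (K \ E) + volume.real (K \ F) := by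
    refine (measureReal_mono (s₂ := (K \ E) ∪ (K \ F)) ?_ ?_).trans (measureReal_union_le _ _)
    · intro x hx
      by_cases hxE : x ∈ E
      · exact Or.inr ⟨hx, fun hxF => disjoint_left.1 hdisj hxE hxF⟩
      · exact Or.inl ⟨hx, hxE⟩
    · exact ((measure_mono (union_subset sdiff_subset sdiff_subset)).trans_lt
        (measure_ball_lt_top (x := p) (r := r * L / 4))).ne
  rw [hK, vol_ball p (by positivity), ← hK, ← hω] at k3
  have k4 : (r * L / 4) ^ n * ω = (L / 4) ^ n * ω * r ^ n := by
    rw [show r * L / 4 = (L / 4) * r by ring, mul_pow]; ring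
  rw [k4] at k3
  have hrn : 0 < r ^ n := by positivity
  have k5 : (L / 4) ^ n * ω * r ^ n ≤ ((L / 4) ^ n * ω / 2) * r ^ n := by
    calc (L / 4) ^ n * ω * r ^ n ≤ ((C1 + C2) * δ) * r ^ n := by linarith
      _ ≤ _ := by gcongr
  have k6 := le_of_mul_le_mul_right k5 hrn
  have k7 : 0 < (L / 4) ^ n * ω := by positivity
  linarith

lemma exists_loc (hE : MeasurableSet E) (D : GaussGreenData n E)
    {x v : EuclideanSpace ℝ (Fin n)} (h : IsUnitNormalAt D x v) :
    ∃ R0, LocData n E D.mu D.nu x v R0 := by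
  obtain ⟨hpos, hv, hT⟩ := h
  have hfin := D.finite
  have hI : Tendsto (fun r : ℝ => inner ℝ (((D.mu (ball x r)).toReal)⁻¹ •
      ∫ y in ball x r, D.nu y ∂D.mu) v) (𝓝[>] 0) (𝓝 (1 : ℝ)) := by
    have := Filter.Tendsto.inner (𝕜 := ℝ) hT (tendsto_const_nhds (x := v))
    rwa [real_inner_self_eq_norm_sq, hv, one_pow] at this
  have hev : ∀ c < (1 : ℝ), ∃ R > 0, ∀ r, 0 < r → r < R →
      c < inner ℝ (((D.mu (ball x r)).toReal)⁻¹ • ∫ y in ball x r, D.nu y ∂D.mu) v := by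
    intro c hc
    have h1 := hI.eventually (lt_mem_nhds hc)
    rw [eventually_nhdsWithin_iff, Metric.eventually_nhds_iff] at h1
    obtain ⟨R, hR, h1⟩ := h1
    refine ⟨R, hR, fun r hr hrR => h1 ?_ hr⟩
    rw [Real.dist_eq, sub_zero, abs_of_pos hr]; exact hrR
  obtain ⟨R1, hR1, hhalf⟩ := hev (1 / 2) (by norm_num)
  have hint : IntegrableOn D.nu (ball x (R1 / 2)) D.mu := by
    by_contra hcon
    have h1 := hhalf (R1 / 2) (by positivity) (by linarith)
    rw [integral_undef hcon] at h1
    simp at h1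
    linarith
  have hmpos : ∀ r, 0 < r → 0 < D.mu.real (ball x r) := fun r hr =>
    ENNReal.toReal_pos (hpos r hr).ne' (measure_ne_top _ _)
  have hinn : ∀ r, r ≤ R1 / 2 → ∫ y in ball x r, inner ℝ (D.nu y) v ∂D.mu
      = inner ℝ (∫ y in ball x r, D.nu y ∂D.mu) v := by
    intro r hr
    have h2 : IntegrableOn D.nu (ball x r) D.mu := hint.mono_set (ball_subset_ball hr)
    rw [real_inner_comm, ← integral_inner h2]
    congr 1
    ext y
    rw [real_inner_comm]
  have hlow : ∀ c r, 0 < r → r ≤ R1 / 2 →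
      c < inner ℝ (((D.mu (ball x r)).toReal)⁻¹ • ∫ y in ball x r, D.nu y ∂D.mu) v →
      c * D.mu.real (ball x r) < ∫ y in ball x r, inner ℝ (D.nu y) v ∂D.mu := by
    intro c r hr hr1 hc
    rw [real_inner_smul_left, ← hinn r hr1, ← measureReal_def, inv_mul_eq_div,
      lt_div_iff₀ (hmpos r hr)] at hc
    exact hc
  refine ⟨R1 / 2, hE, hfin, hpos, D.nu_unit, hv, by positivity, hint, ?_, ?_, ?_⟩
  · intro φ hφ hts u
    have hc := compactSupport_of_ball hts
    have hcd : Continuous (fderiv ℝ φ) := hφ.continuous_fderiv (by simp)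
    have hcs : HasCompactSupport (fderiv ℝ φ) := hc.fderiv ℝ
    obtain ⟨C, hC⟩ := hc.exists_bound_of_continuous hφ.continuous
    have hu : u = ∑ i, u i • EuclideanSpace.single i (1 : ℝ) := by
      ext j
      simp [Finset.sum_apply, Pi.single_apply]
    have e1 : ∀ y, fderiv ℝ φ y u
        = ∑ i, u i * fderiv ℝ φ y (EuclideanSpace.single i (1 : ℝ)) := by
      intro y
      conv_lhs => rw [hu]
      simp [map_sum]
    have e2 : ∀ y, φ y * inner ℝ (D.nu y) u = ∑ i, u i * (φ y * D.nu y i) := by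
      intro y
      rw [PiLp.inner_apply, Finset.mul_sum]
      refine Finset.sum_congr rfl fun i _ => ?_
      simp
      ring
    simp_rw [e1, e2]
    rw [integral_finsetSum, integral_finsetSum]
    · refine Finset.sum_congr rfl fun i _ => ?_
      rw [integral_const_mul, integral_const_mul, D.parts φ hφ hc i]
      congr 1
      symm
      apply setIntegral_eq_integral_of_forall_compl_eq_zero
      intro y hy
      have : φ y = 0 := by
        by_contra hne
        exact hy (hts (subset_tsupport _ hne))
      simp [this]
    · intro i _
      apply Integrable.const_mul
      have hi : IntegrableOn (fun y => D.nu y i) (ball x (R1 / 2)) D.mu :=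
        (EuclideanSpace.proj i : EuclideanSpace ℝ (Fin n) →L[ℝ] ℝ).integrable_comp hint
      exact Integrable.bdd_mul (c := C) hi hφ.continuous.aestronglyMeasurable
        (Filter.Eventually.of_forall hC)
    · intro i _
      apply Integrable.const_mul
      apply Integrable.restrict
      apply Continuous.integrable_of_hasCompactSupport
      · fun_prop
      · exact hcs.comp_left (g := fun L : EuclideanSpace ℝ (Fin n) →L[ℝ] ℝ =>
          L (EuclideanSpace.single i (1 : ℝ))) (by simp)
  · intro r hr hr1
    have := hlow _ r hr hr1.le (hhalf r hr (by linarith))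
    linarith
  · intro ε hε
    obtain ⟨R2, hR2, h2⟩ := hev (1 - ε ^ 2 / 2) (by have : 0 < ε ^ 2 := by positivity
                                                    linarith)
    refine ⟨min R2 (R1 / 2), by positivity, fun r hr hrlt => ?_⟩
    have hr1 : r ≤ R1 / 2 := (hrlt.trans_le (min_le_right _ _)).le
    have h3 := hlow _ r hr hr1 (h2 r hr (hrlt.trans_le (min_le_left _ _)))
    have hir : IntegrableOn D.nu (ball x r) D.mu := hint.mono_set (ball_subset_ball hr1)
    have hii : IntegrableOn (fun y => (inner ℝ (D.nu y) v : ℝ)) (ball x r) D.mu :=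
      Integrable.inner_const hir v
    have h4 : ∫ y in ball x r, ‖D.nu y - v‖ ∂D.mu
        ≤ ∫ y in ball x r, ((ε / 2 + ε⁻¹) - ε⁻¹ * inner ℝ (D.nu y) v) ∂D.mu := by
      apply integral_mono_ae
      · exact (hir.sub (integrable_const v)).norm
      · exact (integrable_const _).sub (hii.const_mul _)
      · filter_upwards [ae_restrict_of_ae D.nu_unit] with y hy
        have h5 := norm_sub_sq_real (D.nu y) v
        rw [hy, hv] at h5
        set t := ‖D.nu y - v‖
        have h6 : ε / 2 + ε⁻¹ - ε⁻¹ * inner ℝ (D.nu y) v = ε / 2 + ε⁻¹ * (t ^ 2 / 2) := by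
          rw [h5]; ring
        rw [h6]
        have h7 : ε / 2 + ε⁻¹ * (t ^ 2 / 2) - t = ε⁻¹ * (ε - t) ^ 2 / 2 := by
          field_simp; ring
        have h8 : 0 ≤ ε⁻¹ * (ε - t) ^ 2 / 2 := by positivity
        linarith
    rw [integral_sub (integrable_const _) (hii.const_mul _), integral_const_mul] at h4
    simp only [integral_const, measureReal_restrict_apply_univ, smul_eq_mul] at h4
    set m := D.mu.real (ball x r)
    set J := ∫ y in ball x r, inner ℝ (D.nu y) v ∂D.mu
    have h9 : ε⁻¹ * ((1 - ε ^ 2 / 2) * m) ≤ ε⁻¹ * J := by gcongr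
    have h10 : ε⁻¹ * ((1 - ε ^ 2 / 2) * m) = ε⁻¹ * m - ε / 2 * m := by field_simp
    nlinarith

lemma mtNormal_spec_s9 (D : GaussGreenData n E) {x : EuclideanSpace ℝ (Fin n)}
    (h : x ∈ reducedBoundary D) : IsUnitNormalAt D x (mtNormal D x) := by
  have h' : ∃ v, IsUnitNormalAt D x v := h
  rw [mtNormal, dif_pos h']
  exact h'.choose_spec

/-- If `E` and `F` are disjoint sets of finite perimeter, then at
`ℋ^{n-1}`-almost every common reduced-boundary point the measure-theoretic unit
normals are opposite: `ℋ^{n-1}({x ∈ ∂*E ∩ ∂*F : ν_E(x) ≠ -ν_F(x)}) = 0`. -/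
theorem stmt9 {F : Set (EuclideanSpace ℝ (Fin n))}
    (hE : MeasurableSet E) (hF : MeasurableSet F) (hdisj : Disjoint E F)
    (DE : GaussGreenData n E) (DF : GaussGreenData n F) :
    μH[(n : ℝ) - 1]
      {x ∈ reducedBoundary DE ∩ reducedBoundary DF | mtNormal DE x ≠ -mtNormal DF x}
      = 0 := by

  have : {x ∈ reducedBoundary DE ∩ reducedBoundary DF | mtNormal DE x ≠ -mtNormal DF x} = ∅ := by
    rw [eq_empty_iff_forall_notMem]
    rintro x ⟨⟨h1, h2⟩, hne⟩
    obtain ⟨R1, D1⟩ := exists_loc hE DE (mtNormal_spec_s9 DE h1)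
    obtain ⟨R2, D2⟩ := exists_loc hF DF (mtNormal_spec_s9 DF h2)
    exact hne (loc_disj hdisj D1 D2)
  rw [this]
  exact measure_empty
end
end
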